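/- arXiv:1608.07656 — 6 statements merged into one kernel-verified Lean document; each statement's English description precedes it below -/
import Mathlib

section
/- Let p be a prime and let R₁ and R₂ be complete discrete valuation rings of mixed characteristic (0,p) with perfect residue fields, with maximal ideals 𝔪₁ and 𝔪₂. If for every integer n ≥ 1 there exists a ring isomorphism R₁/𝔪₁^n ≃ R₂/𝔪₂^n, then there exists a ring isomorphism R₁ ≃ R₂. -/
open IsLocalRing

namespace ResIso
open Polynomial
open scoped Ring

/-- Uniqueness of lifts out of Witt vectors of a perfect ring. -/
theorem witt_hom_unique {p : ℕ} [Fact p.Prime] {k : Type*} [CommRing k] [CharP k p]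
    [PerfectRing k p] {S : Type*} [CommRing S] (I : Ideal S) (N : ℕ) (hI : I ^ N = ⊥)
    (hp : (p : S) ∈ I) (f g : WittVector p k →+* S) (h : ∀ x, f x - g x ∈ I) : f = g := by
  apply WittVector.eq_of_apply_teichmuller_eq f g
  · exact ⟨N, by simpa [hI] using Ideal.pow_mem_pow hp N⟩
  · intro x
    obtain ⟨y, hy⟩ : ∃ y : k, y ^ p ^ N = x :=
      ⟨((frobeniusEquiv k p).symm)^[N] x, by
        rw [← iterate_frobenius]
        exact (frobeniusEquiv k p).right_inv.iterate N x⟩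
    have h1 : f (WittVector.teichmuller p y) ≡ g (WittVector.teichmuller p y) [SMOD I] :=
      SModEq.sub_mem.2 (h _)
    have h2 := SModEq.sub_mem.1 (SModEq.pow_pow_add_one hp h1 N)
    rw [pow_succ, hI, Ideal.bot_mul, Ideal.mem_bot, sub_eq_zero] at h2
    simpa only [← map_pow, hy] using h2

/-- Nilpotent lift. -/
theorem witt_hom_exists_mod {p : ℕ} [Fact p.Prime] {k : Type*} [CommRing k] [CharP k p]
    [PerfectRing k p] {R : Type*} [CommRing R] (I : Ideal R) (hp : (p : R) ∈ I)
    (g : k →+* R ⧸ I) (n : ℕ) :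
    ∃ f : WittVector p k →+* R ⧸ I ^ (n + 1),
      ∀ x y, f x = Ideal.Quotient.mk _ y → g (x.coeff 0) = Ideal.Quotient.mk I y := by
  have hker : RingHom.ker (WittVector.map (p := p) (Ideal.Quotient.mk I)) ≤
      RingHom.ker ((Ideal.Quotient.mk (I ^ (n + 1))).comp
        (WittVector.ghostComponent (p := p) n)) := by
    intro x hx
    rw [RingHom.mem_ker] at hx
    have hx' : ∀ i, x.coeff i ∈ I := by
      intro i
      have := congrArg (fun z => WittVector.coeff z i) hx
      simpa [WittVector.map_coeff, Ideal.Quotient.eq_zero_iff_mem] using this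
    rw [RingHom.mem_ker, RingHom.comp_apply, Ideal.Quotient.eq_zero_iff_mem,
      WittVector.ghostComponent_apply, aeval_wittPolynomial]
    refine Ideal.sum_mem _ fun i hi => ?_
    have hi' : i ≤ n := Nat.lt_succ_iff.1 (Finset.mem_range.1 hi)
    have h1 : (p : R) ^ i * x.coeff i ^ p ^ (n - i) ∈ I ^ (i + p ^ (n - i)) := by
      rw [pow_add]
      exact Ideal.mul_mem_mul (Ideal.pow_mem_pow hp _) (Ideal.pow_mem_pow (hx' i) _)
    refine Ideal.pow_le_pow_right ?_ h1
    have := Nat.lt_pow_self (n := n - i) (Fact.out : p.Prime).one_lt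
    omega
  let gh : WittVector p (R ⧸ I) →+* R ⧸ I ^ (n + 1) :=
    RingHom.liftOfSurjective (WittVector.map (Ideal.Quotient.mk I))
      (WittVector.map_surjective _ Ideal.Quotient.mk_surjective) ⟨_, hker⟩
  have hgh : ∀ z, gh (WittVector.map (Ideal.Quotient.mk I) z) =
      Ideal.Quotient.mk _ (WittVector.ghostComponent n z) := fun z =>
    RingHom.liftOfSurjective_comp_apply ..
  let F : k →+* k := ((frobeniusEquiv k p).symm : k →+* k) ^ n
  have hF : ∀ x, F x ^ p ^ n = x := by
    intro x
    have : F x = ((frobeniusEquiv k p).symm)^[n] x := by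
      simp only [F, RingHom.coe_pow]; rfl
    rw [this, ← iterate_frobenius]
    exact (frobeniusEquiv k p).right_inv.iterate n x
  refine ⟨gh.comp ((WittVector.map g).comp (WittVector.map F)), fun x y hxy => ?_⟩
  obtain ⟨z, hz⟩ := WittVector.map_surjective (p := p) _ (Ideal.Quotient.mk_surjective (I := I))
    (WittVector.map g (WittVector.map F x))
  rw [RingHom.comp_apply, RingHom.comp_apply, ← hz, hgh, Ideal.Quotient.eq] at hxy
  have h1 := Ideal.pow_le_self n.succ_ne_zero hxy
  rw [← Ideal.Quotient.eq] at h1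
  rw [← h1, WittVector.ghostComponent_apply, aeval_wittPolynomial, map_sum,
    Finset.sum_eq_single 0]
  · have := congrArg (fun z => WittVector.coeff z 0) hz
    simp only [WittVector.map_coeff] at this
    simp only [pow_zero, one_mul, Nat.sub_zero, map_pow, this]
    rw [← map_pow, hF]
  · intro i _ hi
    rw [Ideal.Quotient.eq_zero_iff_mem]
    exact Ideal.mul_mem_right _ _ (Ideal.pow_mem_of_mem _ hp _ (Nat.pos_of_ne_zero hi))
  · simp

/-- Lifting to a complete ring. -/
theorem witt_hom_exists {p : ℕ} [Fact p.Prime] {k : Type*} [CommRing k] [CharP k p]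
    [PerfectRing k p] {R : Type*} [CommRing R] (I : Ideal R) [IsAdicComplete I R]
    (hp : (p : R) ∈ I) (g : k →+* R ⧸ I) :
    ∃ f : WittVector p k →+* R, ∀ x, Ideal.Quotient.mk I (f x) = g (x.coeff 0) := by
  choose f hf using witt_hom_exists_mod I hp g
  have hs : StrictMono (fun n : ℕ => n + 1) := fun a b h => by simpa using h
  have hc : ∀ {m}, (Ideal.Quotient.factorPow I (hs.monotone m.le_succ)).comp (f (m + 1)) = f m := by
    intro m
    refine witt_hom_unique (I.map (Ideal.Quotient.mk (I ^ (m + 1)))) (m + 1) ?_ ?_ _ _ ?_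
    · rw [← Ideal.map_pow, Ideal.map_quotient_self]
    · simpa using Ideal.mem_map_of_mem (Ideal.Quotient.mk (I ^ (m + 1))) hp
    · intro x
      obtain ⟨a, ha⟩ := Ideal.Quotient.mk_surjective (f (m + 1) x)
      obtain ⟨b, hb⟩ := Ideal.Quotient.mk_surjective (f m x)
      have h1 := hf _ _ _ ha.symm
      have h2 := hf _ _ _ hb.symm
      rw [RingHom.comp_apply, ← ha, ← hb]
      have : (Ideal.Quotient.factorPow I (hs.monotone m.le_succ)) (Ideal.Quotient.mk _ a) =
        Ideal.Quotient.mk _ a := rfl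
      rw [this, ← map_sub]
      apply Ideal.mem_map_of_mem
      rw [← Ideal.Quotient.eq, ← h1, h2]
  refine ⟨IsAdicComplete.StrictMono.liftRingHom I hs f hc, fun x => ?_⟩
  symm
  exact hf 0 _ _ (IsAdicComplete.StrictMono.mk_liftRingHom I hs f hc x).symm

/-- Hensel's lemma for simple roots, for not necessarily monic polynomials. -/
theorem hensel_simple {R : Type*} [CommRing R] (I : Ideal R) [IsAdicComplete I R]
    (f : R[X]) (a₀ : R) (h₁ : f.eval a₀ ∈ I)
    (h₂ : IsUnit (Ideal.Quotient.mk I (f.derivative.eval a₀))) :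
    ∃ a : R, f.IsRoot a ∧ a - a₀ ∈ I := by
  classical
    let f' := derivative f
    let c : ℕ → R := fun n => Nat.recOn n a₀ fun _ b => b - f.eval b * (f'.eval b)⁻¹ʳ
    have hc : ∀ n, c (n + 1) = c n - f.eval (c n) * (f'.eval (c n))⁻¹ʳ := by
      intro n
      simp only [c]
    have hc_mod : ∀ n, c n ≡ a₀ [SMOD I] := by
      intro n
      induction n with
      | zero => rfl
      | succ n ih => ?_
      rw [hc, sub_eq_add_neg, ← add_zero a₀]
      refine ih.add ?_
      rw [SModEq.zero, Ideal.neg_mem_iff]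
      refine I.mul_mem_right _ ?_
      rw [← SModEq.zero] at h₁ ⊢
      exact (ih.eval f).trans h₁
    have hf'c : ∀ n, IsUnit (f'.eval (c n)) := by
      intro n
      have := isLocalHom_of_le_jacobson_bot I (IsAdicComplete.le_jacobson_bot I)
      apply IsUnit.of_map (Ideal.Quotient.mk I)
      convert! h₂ using 1
      exact SModEq.def.mp ((hc_mod n).eval _)
    have hfcI : ∀ n, f.eval (c n) ∈ I ^ (n + 1) := by
      intro n
      induction n with
      | zero => simpa only [Nat.rec_zero, zero_add, pow_one] using! h₁
      | succ n ih => ?_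
      rw [← taylor_eval_sub (c n), hc, sub_eq_add_neg, sub_eq_add_neg,
        add_neg_cancel_comm]
      rw [eval_eq_sum, sum_over_range' _ _ _ (lt_add_of_pos_right _ zero_lt_two), ←
        Finset.sum_range_add_sum_Ico _ (Nat.le_add_left _ _)]
      swap
      · intro i
        rw [zero_mul]
      refine Ideal.add_mem _ ?_ ?_
      · rw [← one_add_one_eq_two, Finset.sum_range_succ, Finset.range_one, Finset.sum_singleton,
          taylor_coeff_zero, taylor_coeff_one, pow_zero, pow_one, mul_one, mul_neg,
          mul_left_comm, Ring.mul_inverse_cancel _ (hf'c n), mul_one, add_neg_cancel]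
        exact Ideal.zero_mem _
      · refine Submodule.sum_mem _ ?_
        simp only [Finset.mem_Ico]
        rintro i ⟨h2i, _⟩
        have aux : n + 2 ≤ i * (n + 1) := by trans 2 * (n + 1) <;> nlinarith only [h2i]
        refine Ideal.mul_mem_left _ _ (Ideal.pow_le_pow_right aux ?_)
        rw [pow_mul']
        exact Ideal.pow_mem_pow ((Ideal.neg_mem_iff _).2 <| Ideal.mul_mem_right _ _ ih) _
    have aux : ∀ m n, m ≤ n → c m ≡ c n [SMOD (I ^ m • ⊤ : Ideal R)] := by
      intro m n hmn
      rw [← Ideal.one_eq_top, Ideal.smul_eq_mul, mul_one]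
      obtain ⟨k, rfl⟩ := Nat.exists_eq_add_of_le hmn
      clear hmn
      induction k with
      | zero => rw [add_zero]
      | succ k ih => ?_
      rw [← add_assoc, hc, ← add_zero (c m), sub_eq_add_neg]
      refine ih.add ?_
      symm
      rw [SModEq.zero, Ideal.neg_mem_iff]
      refine Ideal.mul_mem_right _ _ (Ideal.pow_le_pow_right ?_ (hfcI _))
      rw [add_assoc]
      exact le_self_add
    obtain ⟨a, ha⟩ := IsPrecomplete.prec' c (aux _ _)
    refine ⟨a, ?_, ?_⟩
    · show f.IsRoot a
      suffices ∀ n, f.eval a ≡ 0 [SMOD (I ^ n • ⊤ : Ideal R)] by exact IsHausdorff.haus' _ this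
      intro n
      specialize ha n
      rw [← Ideal.one_eq_top, Ideal.smul_eq_mul, mul_one] at ha ⊢
      refine (ha.symm.eval f).trans ?_
      rw [SModEq.zero]
      exact Ideal.pow_le_pow_right le_self_add (hfcI _)
    · show a - a₀ ∈ I
      specialize ha (0 + 1)
      rw [hc, pow_one, ← Ideal.one_eq_top, Ideal.smul_eq_mul, mul_one, sub_eq_add_neg] at ha
      rw [← SModEq.sub_mem, ← add_zero a₀]
      refine ha.symm.trans (SModEq.rfl.add ?_)
      rw [SModEq.zero, Ideal.neg_mem_iff]
      exact Ideal.mul_mem_right _ _ h₁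


/-- Hensel's lemma for multiple roots. -/
theorem hensel_multiple {R : Type*} [CommRing R] (I : Ideal R) [IsAdicComplete I R]
    (f : R[X]) (a₀ c : R) (hc : c ∈ I ^ 2)
    (h : f.eval a₀ = f.derivative.eval a₀ ^ 2 * c) :
    ∃ a : R, f.eval a = 0 ∧ a - a₀ ∈ I ^ 2 := by
  set d := f.derivative.eval a₀ with hd
  let H : R[X] := divX (divX (taylor a₀ f))
  have hH : ∀ z, f.eval (a₀ + z) = f.eval a₀ + z * (d + z * H.eval z) := by
    intro z
    have h1 : taylor a₀ f = (H * X + C d) * X + C (f.eval a₀) := by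
      have e1 := divX_mul_X_add (taylor a₀ f)
      have e2 := divX_mul_X_add (divX (taylor a₀ f))
      rw [coeff_divX, taylor_coeff_one] at e2
      rw [taylor_coeff_zero] at e1
      rw [← e1, ← e2]
    have h2 := congrArg (eval z) h1
    rw [taylor_eval] at h2
    simp only [eval_add, eval_mul, eval_X, eval_C] at h2
    rw [add_comm a₀ z, h2]; ring
  let G : R[X] := C c + X + X ^ 2 * H.comp (C d * X)
  have hG : ∀ y, G.eval y = c + y + y ^ 2 * H.eval (d * y) := by
    intro y; simp [G]
  obtain ⟨y, hy, hyI⟩ := hensel_simple I G 0 (by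
      rw [hG]; simpa using Ideal.pow_le_self two_ne_zero hc) (by
      have : G.derivative.eval 0 = 1 := by simp [G]
      rw [this, map_one]; exact isUnit_one)
  rw [IsRoot, hG] at hy
  rw [sub_zero] at hyI
  have hy2 : y ∈ I ^ 2 := by
    have : y = -(c + y ^ 2 * H.eval (d * y)) := by linear_combination hy
    rw [this]
    exact neg_mem (add_mem hc (Ideal.mul_mem_right _ _ (Ideal.pow_mem_pow hyI 2)))
  refine ⟨a₀ + d * y, ?_, ?_⟩
  · rw [hH, h]
    linear_combination d ^ 2 * hy
  · simpa using Ideal.mul_mem_left _ d hy2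

theorem precomplete_pi {A : Type*} [CommRing A] (π : A) [IsAdicComplete (Ideal.span {π}) A]
    (e : ℕ) : IsPrecomplete (Ideal.span {π}) (Fin e → A) := by
  have key : ∀ n (x y : Fin e → A),
      x ≡ y [SMOD ((Ideal.span {π}) ^ n • ⊤ : Submodule A (Fin e → A))] ↔
      ∀ i, x i ≡ y i [SMOD ((Ideal.span {π}) ^ n • ⊤ : Submodule A A)] := by
    intro n x y
    simp only [SModEq.sub_mem, Ideal.span_singleton_pow, Submodule.ideal_span_singleton_smul,
      Submodule.mem_smul_pointwise_iff_exists, Submodule.mem_top, true_and]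
    constructor
    · rintro ⟨z, hz⟩ i
      exact ⟨z i, by rw [← Pi.sub_apply, ← hz]; rfl⟩
    · intro h
      choose z hz using h
      exact ⟨z, funext hz⟩
  constructor
  intro f hf
  have : ∀ i, ∃ L : A, ∀ n, f n i ≡ L [SMOD ((Ideal.span {π}) ^ n • ⊤ : Submodule A A)] := by
    intro i
    exact IsPrecomplete.prec' (fun n => f n i) fun {m n} hmn => (key _ _ _).1 (hf hmn) i
  choose L hL using this
  exact ⟨L, fun n => (key _ _ _).2 fun i => hL i n⟩

/-- Every element of `R` is a polynomial of degree `< e` in the uniformizer. -/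
theorem generation {A R : Type*} [CommRing A] [CommRing R] [Algebra A R] (π : A)
    [IsAdicComplete (Ideal.span {π}) A] (ϖ : R) [IsAdicComplete (Ideal.span {ϖ}) R]
    (hres : ∀ r : R, ∃ a : A, r - algebraMap A R a ∈ Ideal.span {ϖ})
    (hπ : algebraMap A R π ∈ Ideal.span {ϖ}) (e : ℕ) (he : algebraMap A R π ∣ ϖ ^ e) :
    Module.Finite A R ∧ Function.Surjective (aeval ϖ : A[X] →ₐ[A] R) := by
  have : IsPrecomplete (Ideal.span {π}) (Fin e → A) := precomplete_pi π e
  have : IsHausdorff (Ideal.span {π}) R := by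
    refine IsHausdorff.of_map (J := Ideal.span {ϖ}) ?_
    rw [Ideal.map_span, Set.image_singleton, Ideal.span_le]
    simpa using hπ
  let F : (Fin e → A) →ₗ[A] R := Fintype.linearCombination A (fun i : Fin e => ϖ ^ (i : ℕ))
  have hFa : ∀ v, F v = ∑ i, v i • ϖ ^ (i : ℕ) := fun v => Fintype.linearCombination_apply ..
  have approx : ∀ (N : ℕ) (r : R), ∃ v : Fin N → A, ∃ s, r = ∑ i, v i • ϖ ^ (i : ℕ) + ϖ ^ N * s := by
    intro N
    induction N with
    | zero => intro r; exact ⟨Fin.elim0, r, by simp⟩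
    | succ N ih =>
      intro r
      obtain ⟨v, s, hv⟩ := ih r
      obtain ⟨a, ha⟩ := hres s
      obtain ⟨t, ht⟩ := Ideal.mem_span_singleton.1 ha
      refine ⟨Fin.snoc v a, t, ?_⟩
      rw [Fin.sum_univ_castSucc]
      simp only [Fin.snoc_castSucc, Fin.snoc_last, Fin.val_castSucc, Fin.val_last]
      rw [hv, Algebra.smul_def a]
      linear_combination ϖ ^ N * ht
  have hF : Function.Surjective F := by
    apply surjective_of_mkQ_comp_surjective (I := Ideal.span {π})
    intro q
    obtain ⟨r, rfl⟩ := Submodule.mkQ_surjective _ q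
    obtain ⟨v, s, hv⟩ := approx e r
    obtain ⟨u, hu⟩ := he
    refine ⟨v, ?_⟩
    rw [LinearMap.comp_apply, Submodule.mkQ_apply, Submodule.mkQ_apply, eq_comm,
      Submodule.Quotient.eq, Submodule.ideal_span_singleton_smul,
      Submodule.mem_smul_pointwise_iff_exists]
    refine ⟨u * s, trivial, ?_⟩
    rw [hFa, hv, hu, Algebra.smul_def π]
    ring
  refine ⟨Module.Finite.of_surjective F hF, fun r => ?_⟩
  obtain ⟨v, rfl⟩ := hF r
  refine ⟨∑ i, C (v i) * X ^ (i : ℕ), ?_⟩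
  simp [hFa, Algebra.smul_def]

theorem transfer {R₁ R₂ : Type*} [CommRing R₁] [CommRing R₂] [IsLocalRing R₁] [IsLocalRing R₂]
    {n : ℕ} (hn : n ≠ 0)
    (φ : (R₁ ⧸ (maximalIdeal R₁) ^ n) ≃+* (R₂ ⧸ (maximalIdeal R₂) ^ n)) :
    Function.Surjective (((Ideal.Quotient.factor (Ideal.pow_le_self hn)).comp
      (φ : (R₁ ⧸ (maximalIdeal R₁) ^ n) →+* (R₂ ⧸ (maximalIdeal R₂) ^ n))).comp
        (Ideal.Quotient.mk _) : R₁ →+* (R₂ ⧸ maximalIdeal R₂)) ∧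
    ∀ x y, φ (Ideal.Quotient.mk _ x) = Ideal.Quotient.mk _ y → ∀ j ≤ n,
      x ∈ maximalIdeal R₁ ^ j → y ∈ maximalIdeal R₂ ^ j := by
  have hsurj : Function.Surjective (((Ideal.Quotient.factor (Ideal.pow_le_self hn)).comp
      (φ : (R₁ ⧸ (maximalIdeal R₁) ^ n) →+* (R₂ ⧸ (maximalIdeal R₂) ^ n))).comp
        (Ideal.Quotient.mk _) : R₁ →+* (R₂ ⧸ maximalIdeal R₂)) := by
    rw [RingHom.coe_comp, RingHom.coe_comp]
    exact ((Ideal.Quotient.factor_surjective _).comp φ.surjective).comp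
      Ideal.Quotient.mk_surjective
  refine ⟨hsurj, ?_⟩
  set ψ := (((Ideal.Quotient.factor (Ideal.pow_le_self hn)).comp
      (φ : (R₁ ⧸ (maximalIdeal R₁) ^ n) →+* (R₂ ⧸ (maximalIdeal R₂) ^ n))).comp
        (Ideal.Quotient.mk _) : R₁ →+* (R₂ ⧸ maximalIdeal R₂)) with hψ
  have hker : RingHom.ker ψ = maximalIdeal R₁ :=
    ker_eq_maximalIdeal (K := ResidueField R₂) ψ hsurj
  have h1 : (maximalIdeal R₁).map ((φ : (R₁ ⧸ (maximalIdeal R₁) ^ n) →+*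
      (R₂ ⧸ (maximalIdeal R₂) ^ n)).comp (Ideal.Quotient.mk _)) ≤
      (maximalIdeal R₂).map (Ideal.Quotient.mk _) := by
    rw [Ideal.map_le_iff_le_comap]
    intro x hx
    rw [Ideal.mem_comap]
    obtain ⟨y, hy⟩ := Ideal.Quotient.mk_surjective (φ (Ideal.Quotient.mk _ x))
    rw [← hker, RingHom.mem_ker] at hx
    rw [RingHom.comp_apply, RingHom.coe_coe, ← hy]
    apply Ideal.mem_map_of_mem
    rw [← Ideal.Quotient.eq_zero_iff_mem, ← hx, hψ, RingHom.comp_apply, RingHom.comp_apply,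
      RingHom.coe_coe, ← hy]
    rfl
  intro x y hxy j hj hx
  have h2 := Ideal.mem_map_of_mem ((φ : (R₁ ⧸ (maximalIdeal R₁) ^ n) →+*
      (R₂ ⧸ (maximalIdeal R₂) ^ n)).comp (Ideal.Quotient.mk _)) hx
  rw [Ideal.map_pow] at h2
  have h3 := Ideal.pow_right_mono h1 j h2
  rw [RingHom.comp_apply, RingHom.coe_coe, hxy, ← Ideal.map_pow, ← Ideal.mem_comap,
    Ideal.comap_map_of_surjective _ Ideal.Quotient.mk_surjective, ← RingHom.ker_eq_comap_bot,
    Ideal.mk_ker, sup_eq_left.2 (Ideal.pow_le_pow_right hj)] at h3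
  exact h3

/-- A convenient package: a `W(k)`-structure on a complete DVR of mixed characteristic. -/
theorem dvr_generation {p : ℕ} [Fact p.Prime] {k R : Type*} [Field k] [CharP k p]
    [PerfectRing k p] [CommRing R] [IsDomain R] [IsDiscreteValuationRing R]
    [IsAdicComplete (maximalIdeal R) R] [CharZero R] [Algebra (WittVector p k) R]
    (hp : (p : R) ∈ maximalIdeal R) (ϖ : R) (hϖ : Ideal.span {ϖ} = maximalIdeal R)
    (hres : ∀ r : R, ∃ a : WittVector p k,
      r - algebraMap (WittVector p k) R a ∈ maximalIdeal R) :
    Module.Finite (WittVector p k) R ∧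
      Function.Surjective (aeval ϖ : (WittVector p k)[X] →ₐ[WittVector p k] R) := by
  have hirr : Irreducible ϖ := (IsDiscreteValuationRing.irreducible_iff_uniformizer ϖ).2 hϖ.symm
  have hp0 : (p : R) ≠ 0 := Nat.cast_ne_zero.2 (Fact.out : p.Prime).ne_zero
  obtain ⟨e, he⟩ := IsDiscreteValuationRing.associated_pow_irreducible hp0 hirr
  have : IsAdicComplete (Ideal.span {ϖ}) R := by rw [hϖ]; infer_instance
  refine generation (p : WittVector p k) ϖ ?_ ?_ e ?_
  · rw [hϖ]; exact hres
  · rw [hϖ]; simpa using hp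
  · simpa using he.dvd

end ResIso

open ResIso Polynomial

/-- If two complete discrete valuation rings of mixed characteristic `(0, p)` with perfect
residue fields have isomorphic `n`-th residue rings for every `n ≥ 1`, then they are
isomorphic. -/
theorem residue_rings_iso_imp_iso (p : ℕ) [Fact p.Prime]
    (R₁ R₂ : Type) [CommRing R₁] [CommRing R₂] [IsDomain R₁] [IsDomain R₂]
    [IsLocalRing R₁] [IsLocalRing R₂]
    [IsDiscreteValuationRing R₁] [IsDiscreteValuationRing R₂]
    [IsAdicComplete (maximalIdeal R₁) R₁] [IsAdicComplete (maximalIdeal R₂) R₂]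
    [CharZero R₁] [CharZero R₂]
    [CharP (ResidueField R₁) p] [CharP (ResidueField R₂) p]
    [PerfectRing (ResidueField R₁) p] [PerfectRing (ResidueField R₂) p]
    (h : ∀ n : ℕ, 1 ≤ n →
      Nonempty ((R₁ ⧸ (maximalIdeal R₁) ^ n) ≃+* (R₂ ⧸ (maximalIdeal R₂) ^ n))) :
    Nonempty (R₁ ≃+* R₂) := by
  have hp₁ : (p : R₁) ∈ maximalIdeal R₁ := by
    rw [← residue_eq_zero_iff, map_natCast, CharP.cast_eq_zero]
  have hp₂ : (p : R₂) ∈ maximalIdeal R₂ := by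
    rw [← residue_eq_zero_iff, map_natCast, CharP.cast_eq_zero]
  obtain ⟨θ₁, hθ₁⟩ := witt_hom_exists (p := p) (k := ResidueField R₁) (maximalIdeal R₁) hp₁
    (RingHom.id (ResidueField R₁))
  let A := WittVector p (ResidueField R₁)
  let alg₁ : Algebra A R₁ := θ₁.toAlgebra
  obtain ⟨ϖ, hϖ⟩ := IsDiscreteValuationRing.exists_irreducible R₁
  have hϖm : maximalIdeal R₁ = Ideal.span {ϖ} :=
    (IsDiscreteValuationRing.irreducible_iff_uniformizer ϖ).1 hϖ
  obtain ⟨hfin, hsurj₁⟩ := dvr_generation (k := ResidueField R₁) hp₁ ϖ hϖm.symm (by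
    intro r
    obtain ⟨a, ha⟩ := WittVector.coeff_surjective (p := p) 0 (residue R₁ r)
    refine ⟨a, ?_⟩
    rw [← Ideal.Quotient.eq]
    change _ = Ideal.Quotient.mk _ (θ₁ a)
    rw [hθ₁]; exact ha.symm)
  have hp0 : (p : R₁) ≠ 0 := Nat.cast_ne_zero.2 (Fact.out : p.Prime).ne_zero
  have hinj : Function.Injective (algebraMap A R₁) := by
    rw [injective_iff_map_eq_zero]
    intro a ha
    by_contra h0
    obtain ⟨m, b, rfl⟩ := WittVector.exists_eq_pow_p_mul' a h0
    rw [map_mul, map_pow, map_natCast] at ha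
    exact mul_ne_zero (pow_ne_zero m hp0) ((b.isUnit.map (algebraMap A R₁)).ne_zero) ha
  have : FaithfulSMul A R₁ := (faithfulSMul_iff_algebraMap_injective A R₁).2 hinj
  have : Module.IsTorsionFree A R₁ := inferInstance
  have hint : IsIntegral A ϖ := IsIntegral.of_finite A ϖ
  set E : A[X] := minpoly A ϖ with hE
  have hE0 : aeval ϖ E = 0 := minpoly.aeval A ϖ
  have hmonic : E.Monic := minpoly.monic hint
  have : CharZero A := ⟨fun i j hij => Nat.cast_injective (R := R₁) (by
    simpa only [map_natCast] using congrArg (algebraMap A R₁) hij)⟩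
  have hE' : aeval ϖ E.derivative ≠ 0 := by
    intro h0
    have hdvd := minpoly.isIntegrallyClosed_dvd hint h0
    have hd := minpoly.natDegree_pos hint
    have hlt : E.derivative.degree < E.degree := degree_derivative_lt hmonic.ne_zero
    have hz := eq_zero_of_dvd_of_degree_lt hdvd hlt
    exact hd.ne' (derivative_eq_zero.1 hz)
  obtain ⟨δ, hδ⟩ : ∃ δ : ℕ, aeval ϖ E.derivative ∉ maximalIdeal R₁ ^ (δ + 1) := by
    by_contra! hcon
    apply hE'
    refine IsHausdorff.haus (I := maximalIdeal R₁) inferInstance _ fun n => ?_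
    rw [SModEq.zero, smul_eq_mul, Ideal.mul_top]
    exact Ideal.pow_le_pow_right n.le_succ (hcon n)
  let n := 2 * δ + 2
  have hn : n ≠ 0 := by omega
  obtain ⟨φ⟩ := h n (by omega)
  obtain ⟨hψ, htr⟩ := transfer hn φ
  obtain ⟨-, htr'⟩ := transfer hn φ.symm
  set ψ := (((Ideal.Quotient.factor (Ideal.pow_le_self hn)).comp
      (φ : (R₁ ⧸ (maximalIdeal R₁) ^ n) →+* (R₂ ⧸ (maximalIdeal R₂) ^ n))).comp
        (Ideal.Quotient.mk _) : R₁ →+* (R₂ ⧸ maximalIdeal R₂)) with hψdef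
  have hker : RingHom.ker ψ = maximalIdeal R₁ :=
    ker_eq_maximalIdeal (K := ResidueField R₂) ψ hψ
  let g : ResidueField R₁ →+* R₂ ⧸ maximalIdeal R₂ :=
    Ideal.Quotient.lift (maximalIdeal R₁) ψ (fun a ha => by rwa [← hker] at ha)
  have hg : ∀ r, g (Ideal.Quotient.mk _ r) = ψ r := fun r => Ideal.Quotient.lift_mk ..
  obtain ⟨θ₂, hθ₂⟩ := witt_hom_exists (p := p) (k := ResidueField R₁) (maximalIdeal R₂) hp₂ g
  have hcomp : ((φ : (R₁ ⧸ (maximalIdeal R₁) ^ n) →+* (R₂ ⧸ (maximalIdeal R₂) ^ n)).comp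
      (Ideal.Quotient.mk _)).comp θ₁ = (Ideal.Quotient.mk _).comp θ₂ := by
    refine witt_hom_unique ((maximalIdeal R₂).map (Ideal.Quotient.mk _)) n ?_ ?_ _ _ ?_
    · rw [← Ideal.map_pow, Ideal.map_quotient_self]
    · simpa using Ideal.mem_map_of_mem (Ideal.Quotient.mk (maximalIdeal R₂ ^ n)) hp₂
    · intro x
      obtain ⟨y, hy⟩ := Ideal.Quotient.mk_surjective (φ (Ideal.Quotient.mk _ (θ₁ x)))
      rw [RingHom.comp_apply, RingHom.comp_apply, RingHom.comp_apply, RingHom.coe_coe, ← hy,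
        ← map_sub]
      apply Ideal.mem_map_of_mem
      rw [← Ideal.Quotient.eq, hθ₂]
      have h1 : Ideal.Quotient.mk (maximalIdeal R₂) y = ψ (θ₁ x) := by
        rw [hψdef, RingHom.comp_apply, RingHom.comp_apply, RingHom.coe_coe, ← hy]
        rfl
      rw [h1, ← hg, hθ₁]; rfl
  let alg₂ : Algebra A R₂ := θ₂.toAlgebra
  obtain ⟨b, hb⟩ := Ideal.Quotient.mk_surjective (φ (Ideal.Quotient.mk _ ϖ))
  have hev : ∀ P : A[X], φ (Ideal.Quotient.mk _ (aeval ϖ P)) =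
      Ideal.Quotient.mk _ (aeval b P) := by
    intro P
    have h1 : ((φ : (R₁ ⧸ (maximalIdeal R₁) ^ n) →+* (R₂ ⧸ (maximalIdeal R₂) ^ n)).comp
      (Ideal.Quotient.mk _)) (eval₂ θ₁ ϖ P) = Ideal.Quotient.mk _ (eval₂ θ₂ b P) := by
      rw [hom_eval₂, hom_eval₂, hcomp, hb]; rfl
    exact h1
  have hϖ1 : ϖ ∈ maximalIdeal R₁ := by rw [hϖm]; exact Ideal.mem_span_singleton_self ϖ
  have hϖ2 : ϖ ∉ maximalIdeal R₁ ^ 2 := by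
    rw [hϖm, Ideal.span_singleton_pow, Ideal.mem_span_singleton]
    intro hd
    have := (pow_dvd_pow_iff hϖ.ne_zero hϖ.not_isUnit (n := 2) (m := 1)).1 (by simpa using hd)
    omega
  have hb1 : b ∈ maximalIdeal R₂ := by
    simpa using htr _ _ hb.symm 1 (by omega) (by simpa using hϖ1)
  have hb2 : b ∉ maximalIdeal R₂ ^ 2 := fun hh =>
    hϖ2 (htr' b ϖ (by rw [hb, RingEquiv.symm_apply_apply]) 2 (by omega) hh)
  let f : R₂[X] := E.map (algebraMap A R₂)
  have hfe : ∀ x, f.eval x = aeval x E := fun x => by simp [f, aeval_def, eval_map]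
  have hfd : ∀ x, f.derivative.eval x = aeval x E.derivative := fun x => by
    simp [f, aeval_def, eval_map, derivative_map]
  have hfb : f.eval b ∈ maximalIdeal R₂ ^ n := by
    rw [hfe, ← Ideal.Quotient.eq_zero_iff_mem, ← hev, hE0, map_zero, map_zero]
  have hfb' : f.derivative.eval b ∉ maximalIdeal R₂ ^ (δ + 1) := fun hh => by
    rw [hfd] at hh
    exact hδ (htr' _ _ (by rw [← hev, RingEquiv.symm_apply_apply]) (δ + 1) (by omega) hh)
  obtain ⟨ϖ₂, hϖ₂⟩ := IsDiscreteValuationRing.exists_irreducible R₂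
  have hϖm₂ : maximalIdeal R₂ = Ideal.span {ϖ₂} :=
    (IsDiscreteValuationRing.irreducible_iff_uniformizer ϖ₂).1 hϖ₂
  obtain ⟨c, hc, hfc⟩ : ∃ c ∈ maximalIdeal R₂ ^ 2,
      f.eval b = f.derivative.eval b ^ 2 * c := by
    have hd0 : f.derivative.eval b ≠ 0 := fun h0 => hfb' (by rw [h0]; exact zero_mem _)
    obtain ⟨i, u, hu⟩ := IsDiscreteValuationRing.eq_unit_mul_pow_irreducible hd0 hϖ₂
    have hi : i ≤ δ := by
      by_contra! hlt
      apply hfb'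
      rw [hu, hϖm₂, Ideal.span_singleton_pow, Ideal.mem_span_singleton]
      exact Dvd.dvd.mul_left (pow_dvd_pow _ hlt) _
    rw [hϖm₂, Ideal.span_singleton_pow, Ideal.mem_span_singleton] at hfb
    obtain ⟨t, ht⟩ := hfb
    refine ⟨ϖ₂ ^ 2 * (ϖ₂ ^ (2 * (δ - i)) * (↑(u⁻¹) : R₂) ^ 2 * t), ?_, ?_⟩
    · apply Ideal.mul_mem_right
      exact Ideal.pow_mem_pow (by rw [hϖm₂]; exact Ideal.mem_span_singleton_self _) 2
    · rw [ht, hu]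
      have hnn : n = 2 * i + 2 + 2 * (δ - i) := by omega
      have huu : (u : R₂) * (↑(u⁻¹) : R₂) = 1 := u.mul_inv
      rw [hnn, pow_add, pow_add, pow_mul']
      linear_combination (-(ϖ₂ ^ i) ^ 2 * ϖ₂ ^ 2 * ϖ₂ ^ (2 * (δ - i)) * t *
        ((u : R₂) * (↑(u⁻¹) : R₂) + 1)) * huu
  obtain ⟨a, hfa, hab⟩ := hensel_multiple (maximalIdeal R₂) f b c hc hfc
  have ha1 : a ∈ maximalIdeal R₂ := by
    have := add_mem (Ideal.pow_le_self two_ne_zero hab) hb1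
    simpa using this
  have ha2 : a ∉ maximalIdeal R₂ ^ 2 := fun hh => hb2 (by
    have := sub_mem hh hab
    simpa using this)
  have ham : Ideal.span {a} = maximalIdeal R₂ := by
    rw [hϖm₂, Ideal.mem_span_singleton] at ha1
    obtain ⟨w, hw⟩ := ha1
    have hwu : IsUnit w := by
      by_contra hnu
      apply ha2
      rw [hw, sq]
      refine Ideal.mul_mem_mul ?_ ((mem_maximalIdeal w).2 hnu)
      rw [hϖm₂]; exact Ideal.mem_span_singleton_self _
    rw [hϖm₂, hw, Ideal.span_singleton_mul_right_unit hwu]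
  have hgs : Function.Surjective g := by
    intro q
    obtain ⟨r, hr⟩ := hψ q
    exact ⟨Ideal.Quotient.mk _ r, by rw [hg, hr]⟩
  obtain ⟨-, hsurj₂⟩ := dvr_generation (k := ResidueField R₁) hp₂ a ham (by
    intro r
    obtain ⟨q, hq⟩ := hgs (Ideal.Quotient.mk _ r)
    obtain ⟨w, hw⟩ := WittVector.coeff_surjective (p := p) 0 q
    refine ⟨w, ?_⟩
    rw [← Ideal.Quotient.eq]
    change _ = Ideal.Quotient.mk _ (θ₂ w)
    rw [hθ₂, ← hq]; exact congrArg g hw.symm)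
  have hkk : RingHom.ker (aeval ϖ : A[X] →ₐ[A] R₁).toRingHom ≤
      RingHom.ker (aeval a : A[X] →ₐ[A] R₂).toRingHom := by
    intro P hP
    have hP' : aeval ϖ P = 0 := hP
    obtain ⟨Q, hQ⟩ := minpoly.isIntegrallyClosed_dvd hint hP'
    change aeval a P = 0
    rw [hQ, map_mul, ← hE, ← hfe, hfa, zero_mul]
  let Φ : R₁ →+* R₂ := RingHom.liftOfSurjective (aeval ϖ : A[X] →ₐ[A] R₁).toRingHom hsurj₁
    ⟨(aeval a : A[X] →ₐ[A] R₂).toRingHom, hkk⟩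
  have hΦ : ∀ P : A[X], Φ (aeval ϖ P) = aeval a P := fun P =>
    RingHom.liftOfSurjective_comp_apply (aeval ϖ : A[X] →ₐ[A] R₁).toRingHom hsurj₁
      ⟨(aeval a : A[X] →ₐ[A] R₂).toRingHom, hkk⟩ P
  have hΦϖ : Φ ϖ = a := by simpa using hΦ X
  have ha0 : a ≠ 0 := fun h0 => ha2 (by rw [h0]; exact zero_mem _)
  refine ⟨RingEquiv.ofBijective Φ ⟨?_, ?_⟩⟩
  · rw [injective_iff_map_eq_zero]
    intro x hx
    by_contra hx0
    obtain ⟨m, u, hu⟩ := IsDiscreteValuationRing.eq_unit_mul_pow_irreducible hx0 hϖ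
    rw [hu, map_mul, map_pow, hΦϖ] at hx
    exact mul_ne_zero ((u.isUnit.map Φ).ne_zero) (pow_ne_zero m ha0) hx
  · intro y
    obtain ⟨P, hP⟩ := hsurj₂ y
    exact ⟨aeval ϖ P, by rw [hΦ]; exact hP⟩
end

section
/- Let p be a prime and let R₁, R₂ be complete discrete valuation rings of mixed characteristic (0,p) with perfect residue fields, with maximal ideals 𝔪₁, 𝔪₂ and absolute ramification indices e₁, e₂ (so Ideal.span {(p : Rᵢ)} = 𝔪ᵢ^eᵢ). Let c ≥ 0 be the integer with Ideal.span {(e₁ : R₁)} = 𝔪₁^c. Let n₁, n₂ ≥ 1 be integers with n₂ > e₂ + e₂·c, and let φ : R₁/𝔪₁^{n₁} →+* R₂/𝔪₂^{n₂} be a ring homomorphism. Then there exists a ring homomorphism g : R₁ →+* R₂ such that the composite map R₁ → R₁/𝔪₁^{n₁} →(φ) R₂/𝔪₂^{n₂} → R₂/𝔪₂ (where the outer maps are the canonical projections) equals the composite R₁ →(g) R₂ → R₂/𝔪₂. Moreover, if φ is a ring isomorphism, then g can be chosen to be a ring isomorphism. -/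
open IsLocalRing

lemma aux_pow_complete {R : Type*} [CommRing R] (I : Ideal R) [h : IsAdicComplete I R] {e : ℕ}
    (he : 1 ≤ e) : IsAdicComplete (I ^ e) R := by
  let : WithIdeal R := ⟨I⟩
  have h1 : IsAdic I := rfl
  have h2 : IsAdic (I ^ e) := is_ideal_adic_pow h1 he
  rw [h2.isAdicComplete_iff]
  exact h1.isAdicComplete_iff.1 h

lemma aux_witt_hom (p : ℕ) [Fact p.Prime] (R : Type*) [CommRing R] [IsDomain R] [IsLocalRing R]
    [IsAdicComplete (maximalIdeal R) R] [CharP (ResidueField R) p]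
    [PerfectRing (ResidueField R) p] (e : ℕ) (he : 1 ≤ e)
    (hspan : Ideal.span {(p : R)} = maximalIdeal R ^ e) :
    ∃ ι : WittVector p (ResidueField R) →+* R, ∀ w, residue R (ι w) = w.coeff 0 := by
  have hpm : (p : R) ∈ maximalIdeal R := by
    have : (p : R) ∈ Ideal.span {(p : R)} := Ideal.mem_span_singleton_self _
    rw [hspan] at this
    exact Ideal.pow_le_self (by omega) this
  have hnu : Fact (¬ IsUnit (p : R)) := ⟨hpm⟩
  have hcomp : IsAdicComplete (Ideal.span {(p : R)}) R := by
    rw [hspan]; exact aux_pow_complete _ he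
  let F : R →+* ModP R p :=
    (iterateFrobenius (ModP R p) p e).comp (Ideal.Quotient.mk (Ideal.span {(p : R)}))
  have hF : ∀ a ∈ maximalIdeal R, F a = 0 := by
    intro a ha
    change (iterateFrobenius (ModP R p) p e) (Ideal.Quotient.mk (Ideal.span {(p : R)}) a) = 0
    rw [iterateFrobenius_def, ← map_pow]
    apply Ideal.Quotient.eq_zero_iff_mem.2
    rw [hspan]
    exact Ideal.pow_le_pow_right (Nat.lt_pow_self (Fact.out : p.Prime).one_lt).le
      (Ideal.pow_mem_pow ha _)
  let j0 : ResidueField R →+* ModP R p := Ideal.Quotient.lift (maximalIdeal R) F hF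
  have hj0 : ∀ a : R, j0 (residue R a) = F a := fun a => rfl
  let j : ResidueField R →+* ModP R p :=
    j0.comp ((iterateFrobeniusEquiv (ResidueField R) p e).symm : ResidueField R →+* ResidueField R)
  let J : ResidueField R →+* PreTilt R p := Perfection.lift p (ResidueField R) (ModP R p) j
  let q : ModP R p →+* ResidueField R :=
    Ideal.Quotient.lift (Ideal.span {(p : R)}) (residue R) (by
      intro a ha
      rw [hspan] at ha
      exact (residue_eq_zero_iff a).2 (Ideal.pow_le_self (by omega) ha))
  have hq : ∀ a : R, q (Ideal.Quotient.mk _ a) = residue R a := fun a => rfl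
  have hqj : ∀ a, q (j a) = a := by
    intro a
    obtain ⟨b, hb⟩ := residue_surjective ((iterateFrobeniusEquiv (ResidueField R) p e).symm a)
    have : j a = F b := by
      rw [← hj0, hb]; rfl
    rw [this]
    change q ((iterateFrobenius (ModP R p) p e) (Ideal.Quotient.mk (Ideal.span {(p : R)}) b)) = a
    rw [iterateFrobenius_def, map_pow, hq, hb, ← iterateFrobeniusEquiv_def]
    simp
  refine ⟨(WittVector.fontaineTheta R p).comp (WittVector.map J), fun w => ?_⟩
  rw [← hq]
  have := WittVector.mk_fontaineTheta (WittVector.map J w)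
  rw [RingHom.comp_apply]
  erw [this]
  rw [WittVector.map_coeff]
  have h2 : PreTilt.coeff 0 (J (w.coeff 0)) = j (w.coeff 0) := rfl
  rw [h2, hqj]

lemma aux_pow_sub {A : Type*} [CommRing A] (I : Ideal A) (p : ℕ) (hp : (p : A) ∈ I) {a b : A}
    (h : a - b ∈ I) (n : ℕ) : a ^ p ^ n - b ^ p ^ n ∈ I ^ (n + 1) := by
  induction n with
  | zero => simpa using h
  | succ n ih =>
    rw [pow_succ p n, pow_mul, pow_mul, ← geom_sum₂_mul, pow_succ' I]
    refine Ideal.mul_mem_mul ?_ ih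
    rw [← Ideal.Quotient.eq_zero_iff_mem, map_sub, sub_eq_zero] at h
    rw [← Ideal.Quotient.eq_zero_iff_mem, RingHom.map_geom_sum₂, map_pow, map_pow, h,
      geom_sum₂_self, mul_eq_zero_of_left]
    rw [← map_natCast (Ideal.Quotient.mk I), Ideal.Quotient.eq_zero_iff_mem]
    exact hp

lemma aux_witt_ext (p : ℕ) [Fact p.Prime] {k : Type*} [Field k] [CharP k p] [PerfectRing k p]
    {A : Type*} [CommRing A] (I : Ideal A) (hp : (p : A) ∈ I) (n : ℕ) (hI : I ^ n = ⊥)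
    (f g : WittVector p k →+* A) (h : ∀ w, f w - g w ∈ I) : f = g := by
  refine WittVector.eq_of_apply_teichmuller_eq f g ⟨n, ?_⟩ ?_
  · have := Ideal.pow_mem_pow hp n
    rwa [hI] at this
  · intro x
    have hx : x = ((iterateFrobeniusEquiv k p n).symm x) ^ p ^ n := by
      rw [← iterateFrobeniusEquiv_def]; simp
    rw [hx, map_pow, map_pow, map_pow]
    have := Ideal.pow_le_pow_right (Nat.le_succ n) (aux_pow_sub I p hp (h (WittVector.teichmuller p ((iterateFrobeniusEquiv k p n).symm x))) n)
    rw [hI] at this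
    exact sub_eq_zero.1 this

lemma aux_precomplete_pi {W : Type*} [CommRing W] (q : W) [IsPrecomplete (Ideal.span {q}) W]
   (e : ℕ) : IsPrecomplete (Ideal.span {q}) (Fin e → W) := by
  have key : ∀ (n : ℕ) (x : Fin e → W),
      x ∈ ((Ideal.span {q}) ^ n • ⊤ : Submodule W (Fin e → W)) ↔ ∀ i, q ^ n ∣ x i := by
    intro n x
    rw [Ideal.span_singleton_pow, Submodule.ideal_span_singleton_smul, Submodule.mem_smul_pointwise_iff_exists]
    constructor
    · rintro ⟨y, -, rfl⟩ i
      exact ⟨y i, rfl⟩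
    · intro h
      choose y hy using h
      exact ⟨y, trivial, (funext hy).symm⟩
  rw [isPrecomplete_iff]
  intro f hf
  have : ∀ i : Fin e, ∃ L : W, ∀ n, f n i ≡ L [SMOD ((Ideal.span {q}) ^ n • ⊤ : Submodule W W)] := by
    intro i
    apply IsPrecomplete.prec inferInstance
    intro m n hmn
    have := hf hmn
    rw [SModEq.sub_mem, key] at this
    rw [SModEq.sub_mem, smul_eq_mul, Ideal.mul_top, Ideal.span_singleton_pow, Ideal.mem_span_singleton]
    exact this i
  choose L hL using this
  refine ⟨L, fun n => ?_⟩
  rw [SModEq.sub_mem, key]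
  intro i
  have := hL i n
  rwa [SModEq.sub_mem, smul_eq_mul, Ideal.mul_top, Ideal.span_singleton_pow, Ideal.mem_span_singleton] at this

lemma aux_fixed {R : Type*} [CommRing R] (I : Ideal R) [IsAdicComplete I R] (G : R → R)
    (hG : ∀ n a b, a - b ∈ I ^ n → G a - G b ∈ I ^ (n + 1)) : ∃ t, G t = t := by
  let u : ℕ → R := fun n => G^[n] 0
  have h1 : ∀ n k, u n - u (n + k) ∈ I ^ n := by
    intro n k
    induction n with
    | zero => simp
    | succ n ih => 
      have := hG _ _ _ ih
      simpa [u, Nat.succ_add, Function.iterate_succ_apply'] using this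
  obtain ⟨L, hL⟩ := IsPrecomplete.prec (I := I) (M := R) inferInstance (f := u) (by
    intro m n hmn
    obtain ⟨k, rfl⟩ := Nat.exists_eq_add_of_le hmn
    rw [SModEq.sub_mem, smul_eq_mul, Ideal.mul_top]
    exact h1 m k)
  simp only [SModEq.sub_mem, smul_eq_mul, Ideal.mul_top] at hL
  refine ⟨L, ?_⟩
  rw [IsHausdorff.eq_iff_smodEq (I := I)]
  intro n
  rw [SModEq.sub_mem, smul_eq_mul, Ideal.mul_top]
  have a1 := Ideal.pow_le_pow_right (Nat.le_succ n) (hG _ _ _ (hL n))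
  have a2 := Ideal.pow_le_pow_right (Nat.le_succ n) (hL (n+1))
  have : u (n+1) = G (u n) := Function.iterate_succ_apply' _ _ _
  rw [this] at a2
  have := Ideal.sub_mem _ a2 a1
  simpa using this
open Polynomial

lemma aux_mem_pow {R : Type*} [CommRing R] [IsDomain R] [IsDiscreteValuationRing R]
    {π : R} (hπ : Irreducible π) (n : ℕ) (r : R) : r ∈ maximalIdeal R ^ n ↔ π ^ n ∣ r := by
  rw [hπ.maximalIdeal_eq, Ideal.span_singleton_pow, Ideal.mem_span_singleton]

lemma aux_dvd_unit {R : Type*} [CommRing R] [IsDomain R] [IsDiscreteValuationRing R]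
    {π : R} (hπ : Irreducible π) (n m : ℕ) (u : Rˣ) : π ^ n ∣ u * π ^ m ↔ n ≤ m := by
  rw [Units.dvd_mul_left, pow_dvd_pow_iff hπ.ne_zero hπ.not_isUnit]

lemma aux_p_eq {R : Type*} [CommRing R] [IsDomain R] [IsDiscreteValuationRing R]
    {π : R} (hπ : Irreducible π) (e : ℕ) (q : R) (h : Ideal.span {q} = maximalIdeal R ^ e) :
    ∃ u : Rˣ, q = u * π ^ e := by
  rw [hπ.maximalIdeal_eq, Ideal.span_singleton_pow, Ideal.span_singleton_eq_span_singleton] at h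
  obtain ⟨u, hu⟩ := h.symm
  exact ⟨u, by rw [← hu, mul_comm]⟩


lemma aux_surj (p : ℕ) [Fact p.Prime] {R : Type*} [CommRing R] [IsDomain R]
      [IsDiscreteValuationRing R]
      [IsAdicComplete (maximalIdeal R) R] [CharP (ResidueField R) p]
      [PerfectRing (ResidueField R) p] (e : ℕ) (he : 1 ≤ e)
      (hspan : Ideal.span {(p : R)} = maximalIdeal R ^ e)
      (ι : WittVector p (ResidueField R) →+* R) (hι : ∀ w, residue R (ι w) = w.coeff 0)
      {π : R} (hπ : Irreducible π)
    (r : R) : ∃ w : ℕ → WittVector p (ResidueField R),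
    r = ∑ i ∈ Finset.range e, ι (w i) * π ^ i := by
  let _ := ι.toAlgebra
  let I : Ideal (WittVector p (ResidueField R)) := Ideal.span {(p : WittVector p (ResidueField R))}
  have hI : I.map (algebraMap _ R) = Ideal.span {(p : R)} := by
    simp [I, Ideal.map_span]
  have hpre : IsPrecomplete I (Fin e → WittVector p (ResidueField R)) := aux_precomplete_pi _ e
  have hH : IsHausdorff I R := by
    rw [← IsHausdorff.map_algebraMap_iff (S := R), hI, hspan]
    exact (aux_pow_complete (maximalIdeal R) he).toIsHausdorff
  let L : (Fin e → WittVector p (ResidueField R)) →ₗ[WittVector p (ResidueField R)] R :=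
    { toFun := fun w => ∑ i, ι (w i) * π ^ (i : ℕ)
      map_add' := by
        intro a b
        simp [add_mul, Finset.sum_add_distrib]
      map_smul' := by
        intro a b
        simp [Algebra.smul_def, RingHom.algebraMap_toAlgebra, Finset.mul_sum, mul_assoc] }
  have hL : Function.Surjective L := by
    apply surjective_of_mkQ_comp_surjective (I := I)
    intro y
    obtain ⟨r, rfl⟩ := Submodule.mkQ_surjective _ y
    have key : ∀ j : ℕ, ∃ w : ℕ → WittVector p (ResidueField R),
        π ^ j ∣ r - ∑ i ∈ Finset.range j, ι (w i) * π ^ i := by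
      intro j
      induction j with
      | zero => exact ⟨0, by simp⟩
      | succ j ih =>
        obtain ⟨w, d, hd⟩ := ih
        obtain ⟨v, hv⟩ := WittVector.coeff_surjective (p := p) 0 (residue R d)
        have h1 : residue R (d - ι v) = 0 := by rw [map_sub, hι, sub_eq_zero]; exact hv.symm
        rw [residue_eq_zero_iff, ← pow_one (maximalIdeal R), aux_mem_pow hπ, pow_one] at h1
        refine ⟨Function.update w j v, ?_⟩
        rw [Finset.sum_range_succ, Function.update_self]
        have h2 : ∑ i ∈ Finset.range j, ι (Function.update w j v i) * π ^ i =
            ∑ i ∈ Finset.range j, ι (w i) * π ^ i := by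
          apply Finset.sum_congr rfl
          intro i hi
          rw [Function.update_of_ne (Finset.mem_range.1 hi).ne]
        rw [h2, ← sub_sub, hd, mul_comm (ι v), ← mul_sub, pow_succ]
        exact mul_dvd_mul_left _ h1
    obtain ⟨w, hw⟩ := key e
    refine ⟨fun i => w i, ?_⟩
    simp only [LinearMap.comp_apply]
    rw [Submodule.mkQ_apply, Submodule.mkQ_apply, eq_comm, Submodule.Quotient.eq]
    rw [Ideal.smul_top_eq_map, hI, hspan, Submodule.restrictScalars_mem, aux_mem_pow hπ]
    convert hw using 2
    exact Fin.sum_univ_eq_sum_range (fun i => ι (w i) * π ^ i) e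
  obtain ⟨w, hw⟩ := hL r
  refine ⟨fun i => if h : i < e then w ⟨i, h⟩ else 0, ?_⟩
  rw [← Fin.sum_univ_eq_sum_range, ← hw]
  simp [L]

lemma aux_val (p : ℕ) [Fact p.Prime] {R : Type*} [CommRing R] [IsDomain R]
      [IsDiscreteValuationRing R]
      [IsAdicComplete (maximalIdeal R) R] [CharP (ResidueField R) p]
      [PerfectRing (ResidueField R) p] (e : ℕ) (he : 1 ≤ e)
      (hspan : Ideal.span {(p : R)} = maximalIdeal R ^ e)
      (ι : WittVector p (ResidueField R) →+* R) (hι : ∀ w, residue R (ι w) = w.coeff 0)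
      {π : R} (hπ : Irreducible π)
    (w : WittVector p (ResidueField R)) (hw : w ≠ 0) :
    ∃ (k : ℕ) (u : Rˣ), ι w = u * π ^ (e * k) := by
  obtain ⟨m, b, hb⟩ := WittVector.exists_eq_pow_p_mul' w hw
  obtain ⟨v, hv⟩ := aux_p_eq hπ e _ hspan
  refine ⟨m, v ^ m * Units.map ι b, ?_⟩
  rw [hb, map_mul, map_pow, map_natCast, hv]
  simp
  ring

lemma aux_inj (p : ℕ) [Fact p.Prime] {R : Type*} [CommRing R] [IsDomain R]
      [IsDiscreteValuationRing R]
      [IsAdicComplete (maximalIdeal R) R] [CharP (ResidueField R) p]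
      [PerfectRing (ResidueField R) p] (e : ℕ) (he : 1 ≤ e)
      (hspan : Ideal.span {(p : R)} = maximalIdeal R ^ e)
      (ι : WittVector p (ResidueField R) →+* R) (hι : ∀ w, residue R (ι w) = w.coeff 0)
      {π : R} (hπ : Irreducible π)
    : Function.Injective ι := by
  rw [injective_iff_map_eq_zero]
  intro w hw
  by_contra h
  obtain ⟨k, u, hu⟩ := aux_val p e he hspan ι hι hπ w h
  rw [hw] at hu
  exact mul_ne_zero u.ne_zero (pow_ne_zero _ hπ.ne_zero) hu.symm

lemma aux_terms (p : ℕ) [Fact p.Prime] {R : Type*} [CommRing R] [IsDomain R]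
      [IsDiscreteValuationRing R]
      [IsAdicComplete (maximalIdeal R) R] [CharP (ResidueField R) p]
      [PerfectRing (ResidueField R) p] (e : ℕ) (he : 1 ≤ e)
      (hspan : Ideal.span {(p : R)} = maximalIdeal R ^ e)
      (ι : WittVector p (ResidueField R) →+* R) (hι : ∀ w, residue R (ι w) = w.coeff 0)
      {π : R} (hπ : Irreducible π)
    (w : ℕ → WittVector p (ResidueField R)) (n : ℕ)
    (h : π ^ n ∣ ∑ i ∈ Finset.range e, ι (w i) * π ^ i) :
    ∀ i < e, π ^ n ∣ ι (w i) * π ^ i := by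
  induction n with
  | zero => simp
  | succ n ih =>
    have ih := ih ((pow_dvd_pow _ (Nat.le_succ n)).trans h)
    have h1 : ∀ i < e, i ≠ n % e → π ^ (n + 1) ∣ ι (w i) * π ^ i := by
      intro i hi hne
      by_cases hw : w i = 0
      · simp [hw]
      obtain ⟨k, u, hu⟩ := aux_val p e he hspan ι hι hπ (w i) hw
      have h2 := ih i hi
      rw [hu, mul_assoc, ← pow_add, aux_dvd_unit hπ] at h2 ⊢
      rcases h2.lt_or_eq with h3 | h3
      · exact h3
      · exfalso
        apply hne
        rw [h3, Nat.mul_add_mod, Nat.mod_eq_of_lt hi]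
    intro i hi
    by_cases hne : i = n % e
    · rw [← Finset.add_sum_erase _ _ (Finset.mem_range.2 hi)] at h
      refine (dvd_add_left (Finset.dvd_sum ?_)).1 h
      intro j hj
      rw [Finset.mem_erase, Finset.mem_range] at hj
      exact h1 j hj.2 (hne ▸ hj.1)
    · exact h1 i hi hne

lemma aux_zero_of_dvd (p : ℕ) [Fact p.Prime] {R : Type*} [CommRing R] [IsDomain R]
      [IsDiscreteValuationRing R]
      [IsAdicComplete (maximalIdeal R) R] [CharP (ResidueField R) p]
      [PerfectRing (ResidueField R) p] (e : ℕ) (he : 1 ≤ e)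
      (hspan : Ideal.span {(p : R)} = maximalIdeal R ^ e)
      (ι : WittVector p (ResidueField R) →+* R) (hι : ∀ w, residue R (ι w) = w.coeff 0)
      {π : R} (hπ : Irreducible π)
    (r : R) (h : ∀ n, π ^ n ∣ r) : r = 0 := by
  by_contra h0
  obtain ⟨n, u, hu⟩ := IsDiscreteValuationRing.eq_unit_mul_pow_irreducible h0 hπ
  have := h (n + 1)
  rw [hu, aux_dvd_unit hπ] at this
  omega

lemma aux_dvd_terms (p : ℕ) [Fact p.Prime] {R : Type*} [CommRing R] [IsDomain R]
      [IsDiscreteValuationRing R]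
      [IsAdicComplete (maximalIdeal R) R] [CharP (ResidueField R) p]
      [PerfectRing (ResidueField R) p] (e : ℕ) (he : 1 ≤ e)
      (hspan : Ideal.span {(p : R)} = maximalIdeal R ^ e)
      (ι : WittVector p (ResidueField R) →+* R) (hι : ∀ w, residue R (ι w) = w.coeff 0)
      {π : R} (hπ : Irreducible π)
    (w : ℕ → WittVector p (ResidueField R)) :
    ∀ i < e, (∑ i ∈ Finset.range e, ι (w i) * π ^ i) ∣ ι (w i) * π ^ i := by
  intro i hi
  by_cases h0 : (∑ i ∈ Finset.range e, ι (w i) * π ^ i) = 0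
  · rw [h0, zero_dvd_iff]
    refine aux_zero_of_dvd p e he hspan ι hι hπ _ fun n => ?_
    exact aux_terms p e he hspan ι hι hπ w n (by simp [h0]) i hi
  · obtain ⟨n, u, hu⟩ := IsDiscreteValuationRing.eq_unit_mul_pow_irreducible h0 hπ
    rw [hu, Units.mul_left_dvd]
    exact aux_terms p e he hspan ι hι hπ w n (by rw [hu]; simp) i hi

lemma aux_dvd_terms' (p : ℕ) [Fact p.Prime] {R : Type*} [CommRing R] [IsDomain R]
      [IsDiscreteValuationRing R]
      [IsAdicComplete (maximalIdeal R) R] [CharP (ResidueField R) p]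
      [PerfectRing (ResidueField R) p] (e : ℕ) (he : 1 ≤ e)
      (hspan : Ideal.span {(p : R)} = maximalIdeal R ^ e)
      (ι : WittVector p (ResidueField R) →+* R) (hι : ∀ w, residue R (ι w) = w.coeff 0)
      {π : R} (hπ : Irreducible π)
    (h : (WittVector p (ResidueField R))[X]) (hd : h.degree < e) :
    ∀ i < e, h.eval₂ ι π ∣ ι (h.coeff i) * π ^ i := by
  have := aux_dvd_terms p e he hspan ι hι hπ h.coeff
  by_cases h0 : h = 0
  · simp [h0]
  rwa [← eval₂_eq_sum_range' ι ((natDegree_lt_iff_degree_lt h0).2 hd) π] at this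

lemma aux_structure (p : ℕ) [Fact p.Prime] {R : Type*} [CommRing R] [IsDomain R]
      [IsDiscreteValuationRing R]
      [IsAdicComplete (maximalIdeal R) R] [CharP (ResidueField R) p]
      [PerfectRing (ResidueField R) p] (e : ℕ) (he : 1 ≤ e)
      (hspan : Ideal.span {(p : R)} = maximalIdeal R ^ e)
      (ι : WittVector p (ResidueField R) →+* R) (hι : ∀ w, residue R (ι w) = w.coeff 0)
      {π : R} (hπ : Irreducible π)
    : ∃ U : (WittVector p (ResidueField R))[X], IsUnit (U.coeff 0) ∧
    U.degree < e ∧ Function.Surjective (eval₂RingHom ι π) ∧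
    (X ^ e - C (p : WittVector p (ResidueField R)) * U).eval₂ ι π = 0 ∧
    (∀ h : (WittVector p (ResidueField R))[X], h.eval₂ ι π = 0 →
      (X ^ e - C (p : WittVector p (ResidueField R)) * U) ∣ h) ∧
    (derivative (X ^ e - C (p : WittVector p (ResidueField R)) * U)).eval₂ ι π ∣
      (e : R) * π ^ (e - 1) := by
  have hs : ∀ r : R, ∃ U : (WittVector p (ResidueField R))[X], U.degree < e ∧ U.eval₂ ι π = r := by
    intro r
    obtain ⟨w, hw⟩ := aux_surj p e he hspan ι hι hπ r
    refine ⟨∑ i ∈ Finset.range e, C (w i) * X ^ i, ?_, ?_⟩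
    · rw [degree_lt_iff_coeff_zero]
      intro m hm
      rw [finsetSum_coeff]
      apply Finset.sum_eq_zero
      intro i hi
      rw [coeff_C_mul_X_pow, if_neg]
      have := Finset.mem_range.1 hi
      omega
    · rw [eval₂_finsetSum, hw]
      simp
  obtain ⟨v, hv⟩ := aux_p_eq hπ e _ hspan
  obtain ⟨U, hUd, hU⟩ := hs ((v⁻¹ : Rˣ) : R)
  have hdeg : (C (p : WittVector p (ResidueField R)) * U).degree < e :=
    lt_of_le_of_lt (by
      rw [← smul_eq_C_mul]
      exact degree_smul_le _ _) hUd
  have hmon : (X ^ e - C (p : WittVector p (ResidueField R)) * U).Monic :=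
    monic_X_pow_sub (by exact_mod_cast hdeg)
  have hfdeg : (X ^ e - C (p : WittVector p (ResidueField R)) * U).degree = (e : WithBot ℕ) := by
    rw [degree_sub_eq_left_of_degree_lt] <;> rw [degree_X_pow]
    exact hdeg
  have hzero : (X ^ e - C (p : WittVector p (ResidueField R)) * U).eval₂ ι π = 0 := by
    rw [eval₂_sub, eval₂_mul, eval₂_C, eval₂_pow, eval₂_X, map_natCast, hU, hv]
    rw [mul_right_comm, Units.mul_inv, one_mul, sub_self]
  refine ⟨U, ?_, hUd, ?_, hzero, ?_, ?_⟩
  · apply WittVector.isUnit_of_coeff_zero_ne_zero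
    rw [← hι]
    intro h
    have h1 : residue R (U.eval₂ ι π) = residue R (ι (U.coeff 0)) := by
      have : residue R π = 0 := (residue_eq_zero_iff _).2 hπ.not_isUnit
      conv_lhs => rw [← X_mul_divX_add U]
      rw [eval₂_add, eval₂_mul, eval₂_X, eval₂_C, map_add, map_mul, this, zero_mul, zero_add]
    rw [h, hU] at h1
    exact ((v⁻¹).isUnit.map (residue R)).ne_zero h1
  · intro r
    obtain ⟨h, -, hh⟩ := hs r
    exact ⟨h, hh⟩
  · intro h hh
    rw [← modByMonic_eq_zero_iff_dvd hmon]
    set r := h %ₘ (X ^ e - C (p : WittVector p (ResidueField R)) * U) with hr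
    have hrd : r.degree < e := by
      rw [← hfdeg]; exact degree_modByMonic_lt _ hmon
    have hr0 : r.eval₂ ι π = 0 := by
      have := modByMonic_add_div h (X ^ e - C (p : WittVector p (ResidueField R)) * U)
      rw [← this, eval₂_add, eval₂_mul, hzero, zero_mul, add_zero] at hh
      exact hh
    have := aux_dvd_terms' p e he hspan ι hι hπ r hrd
    ext1 i
    rw [coeff_zero]
    by_cases hi : i < e
    · have := this i hi
      rw [hr0, zero_dvd_iff, mul_eq_zero] at this
      rcases this with h1 | h1
      · exact (injective_iff_map_eq_zero ι).1 (aux_inj p e he hspan ι hι hπ) _ h1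
      · exact absurd h1 (pow_ne_zero _ hπ.ne_zero)
    · exact coeff_eq_zero_of_degree_lt (lt_of_lt_of_le hrd (by exact_mod_cast not_lt.1 hi))
  · have hd : (derivative (X ^ e - C (p : WittVector p (ResidueField R)) * U)).degree < e := by
      rw [← hfdeg]
      exact degree_derivative_lt hmon.ne_zero
    have := aux_dvd_terms' p e he hspan ι hι hπ _ hd (e - 1) (by omega)
    rw [coeff_derivative] at this
    have h2 : (X ^ e - C (p : WittVector p (ResidueField R)) * U).coeff (e - 1 + 1) = 1 := by
      rw [Nat.sub_add_cancel he]
      have := hmon.coeff_natDegree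
      rwa [natDegree_eq_of_degree_eq_some hfdeg] at this
    rw [h2] at this
    have h3 : ((e - 1 : ℕ) : WittVector p (ResidueField R)) + 1 = (e : ℕ) := by
      rw [← Nat.cast_add_one, Nat.sub_add_cancel he]
    rw [h3] at this
    simpa using this

lemma aux_val_root {R : Type*} [CommRing R] [IsDomain R] [IsDiscreteValuationRing R]
    {ϖ : R} (hϖ : Irreducible ϖ) (q : R) (e₁ e₂ : ℕ) (he₁ : 1 ≤ e₁) (υ : Rˣ) (hq : q = υ * ϖ ^ e₂)
    (V : R[X]) (hV : IsUnit (V.coeff 0))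
    (x : R) (hx : ϖ ∣ x) (h : ϖ ^ (e₂ + 1) ∣ (X ^ e₁ - C q * V).eval x) :
    ∃ (s : ℕ) (u : Rˣ), x = u * ϖ ^ s ∧ e₁ * s = e₂ := by
  have hVx : IsUnit (V.eval x) := by
    by_contra h0
    rw [← X_mul_divX_add V, eval_add, eval_mul, eval_X, eval_C] at h0
    have h1 : V.divX.eval x * x + V.coeff 0 ∈ maximalIdeal R := by
      rw [mul_comm]; exact h0
    have h2 : V.divX.eval x * x ∈ maximalIdeal R := by
      apply Ideal.mul_mem_left
      rw [hϖ.maximalIdeal_eq, Ideal.mem_span_singleton]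
      exact hx
    exact ((Ideal.add_mem_iff_right _ h2).1 h1) hV
  obtain ⟨t, ht⟩ := hVx
  simp only [eval_sub, eval_mul, eval_C, eval_pow, eval_X, ← ht, hq] at h
  have h3 : (υ : R) * ϖ ^ e₂ * t = ((υ * t : Rˣ) : R) * ϖ ^ e₂ := by push_cast; ring
  rw [h3] at h
  have hx0 : x ≠ 0 := by
    rintro rfl
    rw [zero_pow (by omega), zero_sub, dvd_neg, aux_dvd_unit hϖ] at h
    omega
  obtain ⟨s, u, hu⟩ := IsDiscreteValuationRing.eq_unit_mul_pow_irreducible hx0 hϖ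
  refine ⟨s, u, hu, ?_⟩
  have h4 : x ^ e₁ = ((u ^ e₁ : Rˣ) : R) * ϖ ^ (e₁ * s) := by
    rw [hu, mul_pow, ← pow_mul, mul_comm s]; push_cast; ring
  rw [h4] at h
  rcases lt_trichotomy (e₁ * s) e₂ with h5 | h5 | h5
  · exfalso
    have h6 : ϖ ^ (e₁ * s + 1) ∣ ((υ * t : Rˣ) : R) * ϖ ^ e₂ := (aux_dvd_unit hϖ _ _ _).2 h5
    have h7 := (dvd_sub_left h6).1 ((pow_dvd_pow _ (by omega)).trans h)
    rw [aux_dvd_unit hϖ] at h7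
    omega
  · exact h5
  · exfalso
    have h6 : ϖ ^ (e₂ + 1) ∣ ((u ^ e₁ : Rˣ) : R) * ϖ ^ (e₁ * s) := (aux_dvd_unit hϖ _ _ _).2 h5
    have h7 := (dvd_sub_right h6).1 h
    rw [aux_dvd_unit hϖ] at h7
    omega

lemma aux_root {R : Type*} [CommRing R] [IsDomain R] [IsDiscreteValuationRing R]
    {ϖ : R} (hϖ : Irreducible ϖ) (q : R) (e₁ e₂ : ℕ) (he₁ : 1 ≤ e₁) (υ : Rˣ) (hq : q = υ * ϖ ^ e₂)
    (V : R[X]) (hV : IsUnit (V.coeff 0))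
    [IsAdicComplete (maximalIdeal R) R] (hVd : V.degree < e₁) (x : R) (hx : ϖ ∣ x)
    (c n : ℕ) (hn : e₂ + e₂ * c < n)
    (h : ϖ ^ n ∣ (X ^ e₁ - C q * V).eval x) (t : R)
    (ht : ϖ ^ n ∣ (derivative (X ^ e₁ - C q * V)).eval x * t - x ^ (c + (e₁ - 1))) :
    ∃ y, ϖ ∣ y ∧ (X ^ e₁ - C q * V).eval y = 0 := by
  obtain ⟨s, u, hu, hs⟩ := aux_val_root hϖ q e₁ e₂ he₁ υ hq V hV x hx
    ((pow_dvd_pow _ (by have := Nat.zero_le (e₂ * c); omega)).trans h)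
  set F := X ^ e₁ - C q * V with hF
  have hFd : F.natDegree < e₁ + 1 := by
    have h1 : (C q * V).degree ≤ V.degree := by
      rw [← smul_eq_C_mul]; exact degree_smul_le _ _
    refine Nat.lt_succ_of_le (natDegree_le_of_degree_le ?_)
    refine (degree_sub_le _ _).trans (max_le ?_ ?_)
    · exact degree_X_pow_le _
    · exact (h1.trans_lt hVd).le
  by_cases hF0 : F.eval x = 0
  · exact ⟨x, hx, hF0⟩
  obtain ⟨N, a, ha⟩ := IsDiscreteValuationRing.eq_unit_mul_pow_irreducible hF0 hϖ
  rw [ha, aux_dvd_unit hϖ] at h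
  have hx2 : x ^ (c + (e₁ - 1)) = ((u ^ (c + (e₁ - 1)) : Rˣ) : R) * ϖ ^ (s * (c + (e₁ - 1))) := by
    rw [hu, mul_pow, ← pow_mul]; push_cast; ring
  have hE : s * (c + (e₁ - 1)) + s = s * c + e₂ := by
    obtain ⟨m, rfl⟩ := Nat.exists_eq_add_of_le' he₁
    rw [← hs, Nat.add_sub_cancel]; ring
  have hsc : s * c ≤ e₂ * c := Nat.mul_le_mul_right _ (by rw [← hs]; exact Nat.le_mul_of_pos_left _ he₁)
  have hFx0 : ¬ ϖ ^ (s * (c + (e₁ - 1)) + 1) ∣ (derivative F).eval x := by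
    intro hd
    have h1 : ϖ ^ (s * (c + (e₁ - 1)) + 1) ∣ x ^ (c + (e₁ - 1)) :=
      (dvd_sub_right (hd.mul_right t)).1 ((pow_dvd_pow _ (by omega)).trans ht)
    rw [hx2, aux_dvd_unit hϖ] at h1
    omega
  have hFx1 : (derivative F).eval x ≠ 0 := by
    intro h0
    rw [h0] at hFx0
    simp at hFx0
  obtain ⟨D, b, hb⟩ := IsDiscreteValuationRing.eq_unit_mul_pow_irreducible hFx1 hϖ
  have hD : D ≤ s * (c + (e₁ - 1)) := by
    by_contra hlt
    apply hFx0
    rw [hb, aux_dvd_unit hϖ]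
    omega
  have hspos : 1 ≤ s := by
    rcases Nat.eq_zero_or_pos s with h0 | h0
    · exfalso
      rw [h0, pow_zero, mul_one] at hu
      exact hϖ.not_isUnit (isUnit_of_dvd_unit hx (hu ▸ u.isUnit))
    · exact h0
  have hDN : D + 1 ≤ N := by omega
  obtain ⟨M, rfl⟩ : ∃ M, N = D + M := ⟨N - D, by omega⟩
  set z : R := ((a * b⁻¹ : Rˣ) : R) * ϖ ^ M with hz
  have hcoef : ∀ i, 2 ≤ i → i ≤ e₁ → ∃ β, (taylor x F).coeff i * z ^ i = a * ϖ ^ (D + M) * (ϖ * β) := by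
    intro i hi1 hi2
    obtain ⟨d, hd⟩ : ϖ ^ (e₂ - i * s) ∣ (taylor x F).coeff i := by
      rw [taylor_coeff, hF, map_sub, ← smul_eq_C_mul, map_smul, eval_sub, eval_smul]
      apply dvd_sub
      · rw [← monomial_one_right_eq_X_pow, hasseDeriv_monomial, eval_monomial]
        apply Dvd.dvd.mul_left
        have : e₂ - i * s = s * (e₁ - i) := by
          rw [← hs, ← Nat.sub_mul, mul_comm]
        rw [this, hu, mul_pow, ← pow_mul]
        exact Dvd.intro_left _ rfl
      · rw [smul_eq_mul, hq]
        exact Dvd.dvd.mul_right (Dvd.dvd.mul_left (pow_dvd_pow _ (Nat.sub_le _ _)) _) _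
    have hle : D + M + 1 ≤ e₂ - i * s + M * i := by
      have h1 : i * s ≤ e₂ := by rw [← hs]; exact Nat.mul_le_mul_right _ hi2
      obtain ⟨r, hr⟩ := Nat.exists_eq_add_of_le h1
      rw [hr, Nat.add_sub_cancel_left]
      obtain ⟨j, rfl⟩ : ∃ j, i = j + 1 := ⟨i - 1, by omega⟩
      have hj : 1 ≤ j := by omega
      have h2 : D + s ≤ s * c + e₂ := by omega
      have h3 : e₂ + e₂ * c + 1 ≤ D + M := by omega
      have h4 : (j + 1) * (D + s) ≤ (j + 1) * (s * c + e₂) := Nat.mul_le_mul_left _ h2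
      have h5 : j * (e₂ + e₂ * c + 1) ≤ j * (D + M) := Nat.mul_le_mul_left _ h3
      have h6 : (j + 1) * (s * c) ≤ j * (e₂ * c) := by
        have h7 : j + 1 ≤ j * e₁ := by nlinarith
        calc (j + 1) * (s * c) ≤ (j * e₁) * (s * c) := Nat.mul_le_mul_right _ h7
          _ = j * (e₂ * c) := by rw [← hs]; ring
      nlinarith
    obtain ⟨k, hk⟩ := Nat.exists_eq_add_of_le hle
    refine ⟨((a⁻¹ : Rˣ) : R) * d * ((a * b⁻¹ : Rˣ) : R) ^ i * ϖ ^ k, ?_⟩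
    have h8 : (a : R) * ((a⁻¹ : Rˣ) : R) = 1 := Units.mul_inv a
    calc (taylor x F).coeff i * z ^ i
        = d * ((a * b⁻¹ : Rˣ) : R) ^ i * ϖ ^ (e₂ - i * s + M * i) := by
          rw [hd, hz, mul_pow, ← pow_mul, pow_add]; ring
      _ = ((a : R) * ((a⁻¹ : Rˣ) : R)) * (d * ((a * b⁻¹ : Rˣ) : R) ^ i * ϖ ^ (D + M + 1 + k)) := by
          rw [h8, one_mul, hk]
      _ = _ := by rw [pow_add, pow_succ]; ring
  choose! β hβ using hcoef
  let Q : R[X] := ∑ i ∈ Finset.range (e₁ - 1), C (β (i + 2)) * X ^ (i + 2)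
  obtain ⟨T, hT⟩ := aux_fixed (maximalIdeal R) (fun T => -1 - ϖ * Q.eval T) (by
    intro n a b hab
    rw [aux_mem_pow hϖ] at hab ⊢
    have h1 : (-1 - ϖ * Q.eval a) - (-1 - ϖ * Q.eval b) = - (ϖ * (Q.eval a - Q.eval b)) := by ring
    rw [h1, dvd_neg, pow_succ']
    exact mul_dvd_mul_left _ (hab.trans (sub_dvd_eval_sub a b Q)))
  refine ⟨x + z * T, ?_, ?_⟩
  · refine dvd_add hx (Dvd.dvd.mul_right (Dvd.dvd.mul_left (dvd_pow_self _ (by omega)) _) _)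
  · have h1 : F.eval (x + z * T) = (taylor x F).eval (z * T) := by
      rw [taylor_eval, add_comm]
    have h2 : (taylor x F).natDegree < e₁ - 1 + 1 + 1 := by
      rw [natDegree_taylor]; omega
    rw [h1, eval_eq_sum_range' h2, Finset.sum_range_succ', Finset.sum_range_succ',
      taylor_coeff_zero, taylor_coeff_one, ha, hb]
    have h3 : ∑ i ∈ Finset.range (e₁ - 1), (taylor x F).coeff (i + 1 + 1) * (z * T) ^ (i + 1 + 1) =
        a * ϖ ^ (D + M) * (ϖ * Q.eval T) := by
      rw [eval_finsetSum, Finset.mul_sum, Finset.mul_sum]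
      apply Finset.sum_congr rfl
      intro i hi
      have := Finset.mem_range.1 hi
      rw [mul_pow, ← mul_assoc, hβ (i + 1 + 1) (by omega) (by omega)]
      simp
      ring
    rw [h3]
    have h4 : (b : R) * ϖ ^ D * z = a * ϖ ^ (D + M) := by
      rw [hz, pow_add]; push_cast
      have h8 : (b : R) * ((b⁻¹ : Rˣ) : R) = 1 := Units.mul_inv b
      linear_combination (a : R) * ϖ ^ D * ϖ ^ M * h8
    have hT' : -1 - ϖ * Q.eval T = T := hT
    simp only [zero_add, pow_one, pow_zero]
    linear_combination T * h4 + (-(a : R) * ϖ ^ (D + M)) * hT'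
/-- Lifting of homomorphisms between residue rings of complete discrete valuation rings
of mixed characteristic `(0,p)` with perfect residue fields: any homomorphism
`φ : R₁/𝔪₁^{n₁} →+* R₂/𝔪₂^{n₂}` with `n₂ > e₂ + e₂·c` lifts to a homomorphism
`g : R₁ →+* R₂` inducing the same map to the residue field `R₂/𝔪₂`; moreover `g` can be
chosen bijective if `φ` is bijective. -/
theorem lift_residue_ring_hom (p : ℕ) [Fact p.Prime]
    (R₁ R₂ : Type) [CommRing R₁] [CommRing R₂] [IsDomain R₁] [IsDomain R₂]
    [IsLocalRing R₁] [IsLocalRing R₂]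
    [IsDiscreteValuationRing R₁] [IsDiscreteValuationRing R₂]
    [IsAdicComplete (maximalIdeal R₁) R₁] [IsAdicComplete (maximalIdeal R₂) R₂]
    [CharZero R₁] [CharZero R₂]
    [CharP (ResidueField R₁) p] [CharP (ResidueField R₂) p]
    [PerfectRing (ResidueField R₁) p] [PerfectRing (ResidueField R₂) p]
    (e₁ e₂ : ℕ) (he₁ : 1 ≤ e₁) (he₂ : 1 ≤ e₂)
    (hspan₁ : Ideal.span {(p : R₁)} = maximalIdeal R₁ ^ e₁)
    (hspan₂ : Ideal.span {(p : R₂)} = maximalIdeal R₂ ^ e₂)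
    (c : ℕ) (hc : Ideal.span {(e₁ : R₁)} = maximalIdeal R₁ ^ c)
    (n₁ n₂ : ℕ) (hn₁ : 1 ≤ n₁) (hn₂ : 1 ≤ n₂) (hbound : e₂ + e₂ * c < n₂)
    (φ : (R₁ ⧸ maximalIdeal R₁ ^ n₁) →+* (R₂ ⧸ maximalIdeal R₂ ^ n₂)) :
    ∃ g : R₁ →+* R₂,
      (Ideal.Quotient.factor (S := maximalIdeal R₂ ^ n₂) (T := maximalIdeal R₂)
          (Ideal.pow_le_self (by omega))).comp
        (φ.comp (Ideal.Quotient.mk (maximalIdeal R₁ ^ n₁))) =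
        (Ideal.Quotient.mk (maximalIdeal R₂)).comp g ∧
      (Function.Bijective φ → Function.Bijective g) := by
  obtain ⟨ι₁, hι₁⟩ := aux_witt_hom p R₁ e₁ he₁ hspan₁
  obtain ⟨ι₂, hι₂⟩ := aux_witt_hom p R₂ e₂ he₂ hspan₂
  obtain ⟨π, hπ⟩ := IsDiscreteValuationRing.exists_irreducible R₁
  obtain ⟨ϖ, hϖ⟩ := IsDiscreteValuationRing.exists_irreducible R₂
  obtain ⟨υ, hυ⟩ := aux_p_eq hϖ e₂ _ hspan₂
  obtain ⟨κ, hκ⟩ := aux_p_eq hπ c _ hc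
  obtain ⟨U, hU, hUd, hsurj, hfπ, hker, hder⟩ :=
    aux_structure p e₁ he₁ hspan₁ ι₁ hι₁ hπ
  set f := X ^ e₁ - C (p : WittVector p (ResidueField R₁)) * U with hf
  let Φ : R₁ →+* R₂ ⧸ maximalIdeal R₂ ^ n₂ := φ.comp (Ideal.Quotient.mk (maximalIdeal R₁ ^ n₁))
  let ρ : R₂ ⧸ maximalIdeal R₂ ^ n₂ →+* ResidueField R₂ :=
    Ideal.Quotient.factor (S := maximalIdeal R₂ ^ n₂) (T := maximalIdeal R₂)
          (Ideal.pow_le_self (by omega))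
  have hρ : ∀ r, ρ (Ideal.Quotient.mk _ r) = residue R₂ r := fun r => rfl
  let θ : R₁ →+* ResidueField R₂ := ρ.comp Φ
  have hθ : ∀ a ∈ maximalIdeal R₁, θ a = 0 := by
    intro a ha
    have h1 : Φ a ^ n₁ = 0 := by
      change φ (Ideal.Quotient.mk _ a) ^ n₁ = 0
      rw [← map_pow, ← map_pow, Ideal.Quotient.eq_zero_iff_mem.2 (Ideal.pow_mem_pow ha _), map_zero]
    have h2 : θ a ^ n₁ = 0 := by
      change (ρ (Φ a)) ^ n₁ = 0
      rw [← map_pow, h1, map_zero]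
    exact eq_zero_of_pow_eq_zero h2
  let φb : ResidueField R₁ →+* ResidueField R₂ := Ideal.Quotient.lift (maximalIdeal R₁) θ hθ
  have hφb : ∀ a, φb (residue R₁ a) = θ a := fun a => rfl
  let ψ : WittVector p (ResidueField R₁) →+* R₂ := ι₂.comp (WittVector.map φb)
  have hψ : ∀ w, residue R₂ (ψ w) = θ (ι₁ w) := by
    intro w
    change residue R₂ (ι₂ _) = _
    rw [hι₂, WittVector.map_coeff, ← hι₁, hφb]
  have hcompat : Φ.comp ι₁ = (Ideal.Quotient.mk (maximalIdeal R₂ ^ n₂)).comp ψ := by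
    refine aux_witt_ext p ((maximalIdeal R₂).map (Ideal.Quotient.mk (maximalIdeal R₂ ^ n₂)))
      ?_ n₂ ?_ _ _ ?_
    · rw [← map_natCast (Ideal.Quotient.mk (maximalIdeal R₂ ^ n₂))]
      apply Ideal.mem_map_of_mem
      have : (p : R₂) ∈ Ideal.span {(p : R₂)} := Ideal.mem_span_singleton_self _
      rw [hspan₂] at this
      exact Ideal.pow_le_self (by omega) this
    · rw [← Ideal.map_pow, Ideal.map_quotient_self]
    · intro w
      obtain ⟨r, hr⟩ := Ideal.Quotient.mk_surjective (Φ (ι₁ w))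
      have h1 : residue R₂ (r - ψ w) = 0 := by
        rw [map_sub, hψ, ← hρ, hr, sub_eq_zero]; rfl
      change Φ (ι₁ w) - Ideal.Quotient.mk (maximalIdeal R₂ ^ n₂) (ψ w) ∈ _
      rw [← hr, ← map_sub]
      exact Ideal.mem_map_of_mem _ ((residue_eq_zero_iff _).1 h1)
  obtain ⟨x, hx⟩ := Ideal.Quotient.mk_surjective (Φ π)
  have hπm : π ∈ maximalIdeal R₁ := hπ.not_isUnit
  have hdvd : ∀ r : R₂, residue R₂ r = 0 → ϖ ∣ r := by
    intro r hr
    rw [residue_eq_zero_iff, ← pow_one (maximalIdeal R₂), aux_mem_pow hϖ, pow_one] at hr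
    exact hr
  have hϖ0 : ∀ r : R₂, ϖ ∣ r → residue R₂ r = 0 := by
    intro r hr
    rw [residue_eq_zero_iff, ← pow_one (maximalIdeal R₂), aux_mem_pow hϖ, pow_one]
    exact hr
  have hxϖ : ϖ ∣ x := by
    apply hdvd
    rw [← hρ, hx]
    exact hθ π hπm
  have heval : ∀ h : (WittVector p (ResidueField R₁))[X],
      Ideal.Quotient.mk (maximalIdeal R₂ ^ n₂) ((h.map ψ).eval x) = Φ (h.eval₂ ι₁ π) := by
    intro h
    rw [eval_map, hom_eval₂, hom_eval₂, hcompat, hx]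
  have hfmap : f.map ψ = X ^ e₁ - C (p : R₂) * U.map ψ := by
    rw [hf]
    simp [Polynomial.map_sub, Polynomial.map_mul, Polynomial.map_pow]
  have hV : IsUnit ((U.map ψ).coeff 0) := by
    rw [coeff_map]; exact hU.map ψ
  have hVd : (U.map ψ).degree < e₁ := lt_of_le_of_lt degree_map_le hUd
  have hFx : ϖ ^ n₂ ∣ (X ^ e₁ - C (p : R₂) * U.map ψ).eval x := by
    rw [← hfmap, ← aux_mem_pow hϖ, ← Ideal.Quotient.eq_zero_iff_mem, heval, hfπ, map_zero]
  obtain ⟨t0, ht0⟩ := hder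
  obtain ⟨t, ht⟩ := Ideal.Quotient.mk_surjective (Φ (t0 * ((κ⁻¹ : R₁ˣ) : R₁)))
  have ht1 : (derivative f).eval₂ ι₁ π * (t0 * ((κ⁻¹ : R₁ˣ) : R₁)) = π ^ (c + (e₁ - 1)) := by
    rw [← mul_assoc, ← ht0, hκ, pow_add]
    have h8 : (κ : R₁) * ((κ⁻¹ : R₁ˣ) : R₁) = 1 := Units.mul_inv κ
    linear_combination π ^ c * π ^ (e₁ - 1) * h8
  have ht2 : ϖ ^ n₂ ∣ (derivative (X ^ e₁ - C (p : R₂) * U.map ψ)).eval x * t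
      - x ^ (c + (e₁ - 1)) := by
    rw [← hfmap, ← aux_mem_pow hϖ, ← Ideal.Quotient.eq_zero_iff_mem, map_sub, map_mul,
      derivative_map, heval, ht, ← map_mul, ht1, map_pow, map_pow, hx, sub_self]
  obtain ⟨y, hy, hFy⟩ := aux_root hϖ (p : R₂) e₁ e₂ he₁ υ hυ (U.map ψ) hV hVd x hxϖ c n₂ hbound
    hFx t ht2
  obtain ⟨s', u', hu', hs'⟩ := aux_val_root hϖ (p : R₂) e₁ e₂ he₁ υ hυ (U.map ψ) hV y hy
    (by rw [hFy]; exact dvd_zero _)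
  have hkerle : RingHom.ker (eval₂RingHom ι₁ π) ≤ RingHom.ker (eval₂RingHom ψ y) := by
    intro h hh
    obtain ⟨d, rfl⟩ := hker h hh
    rw [RingHom.mem_ker, map_mul]
    have : eval₂RingHom ψ y f = 0 := by
      rw [coe_eval₂RingHom, ← eval_map, hfmap, hFy]
    rw [this, zero_mul]
  let g : R₁ →+* R₂ :=
    RingHom.liftOfSurjective (eval₂RingHom ι₁ π) hsurj ⟨eval₂RingHom ψ y, hkerle⟩
  have hg : ∀ h, g (eval₂RingHom ι₁ π h) = eval₂RingHom ψ y h := fun h =>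
    RingHom.liftOfSurjective_comp_apply ..
  have hgπ : g π = y := by
    simpa using hg X
  have hy0 : y ≠ 0 := by
    rw [hu']
    exact mul_ne_zero u'.ne_zero (pow_ne_zero _ hϖ.ne_zero)
  have hres : θ = (residue R₂).comp g := by
    rw [← RingHom.cancel_right hsurj]
    apply Polynomial.ringHom_ext
    · intro w
      change θ (eval₂RingHom ι₁ π (C w)) = residue R₂ (g (eval₂RingHom ι₁ π (C w)))
      rw [hg, coe_eval₂RingHom, coe_eval₂RingHom, eval₂_C, eval₂_C, hψ]
    · change θ (eval₂RingHom ι₁ π X) = residue R₂ (g (eval₂RingHom ι₁ π X))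
      rw [hg, coe_eval₂RingHom, coe_eval₂RingHom, eval₂_X, eval₂_X, hθ π hπm, hϖ0 y hy]
  refine ⟨g, hres, fun hφ => ⟨?_, ?_⟩⟩
  · rw [injective_iff_map_eq_zero]
    intro r hr
    by_contra h0
    obtain ⟨n, u, hu⟩ := IsDiscreteValuationRing.eq_unit_mul_pow_irreducible h0 hπ
    rw [hu, map_mul, map_pow, hgπ] at hr
    exact mul_ne_zero (u.isUnit.map g).ne_zero (pow_ne_zero _ hy0) hr
  · have hΦ : Function.Surjective Φ := hφ.2.comp Ideal.Quotient.mk_surjective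
    have hbig : e₂ + 1 ≤ n₂ := by
      have := Nat.zero_le (e₂ * c)
      omega
    obtain ⟨s, u, hu, hs⟩ := aux_val_root hϖ (p : R₂) e₁ e₂ he₁ υ hυ (U.map ψ) hV x hxϖ
      ((pow_dvd_pow _ hbig).trans hFx)
    have hs1 : s ≤ 1 := by
      obtain ⟨r, hr⟩ := hΦ (Ideal.Quotient.mk _ ϖ)
      have hr0 : θ r = 0 := by
        change ρ (Φ r) = 0
        rw [hr, hρ, hϖ0 ϖ dvd_rfl]
      rw [← hφb] at hr0
      have hr1 := (map_eq_zero φb).1 hr0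
      rw [residue_eq_zero_iff, ← pow_one (maximalIdeal R₁), aux_mem_pow hπ, pow_one] at hr1
      obtain ⟨r', rfl⟩ := hr1
      obtain ⟨b, hb⟩ := Ideal.Quotient.mk_surjective (Φ r')
      rw [map_mul, ← hx, ← hb, ← map_mul, ← sub_eq_zero, ← map_sub,
        Ideal.Quotient.eq_zero_iff_mem, aux_mem_pow hϖ] at hr
      by_contra hlt
      have h2 : ϖ ^ 2 ∣ x * b := by
        apply Dvd.dvd.mul_right
        rw [hu, aux_dvd_unit hϖ]
        omega
      have h3 := (dvd_sub_right h2).1 ((pow_dvd_pow ϖ (by omega : 2 ≤ n₂)).trans hr)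
      have h4 := (aux_dvd_unit hϖ 2 1 1).1 (by simpa using h3)
      omega
    have hs2 : s = 1 := by
      rcases Nat.le_one_iff_eq_zero_or_eq_one.1 hs1 with h0 | h0
      · rw [h0] at hs; omega
      · exact h0
    have hs3 : s' = 1 := by
      rw [hs2] at hs
      have h5 : e₁ * s' = e₁ * 1 := by omega
      exact Nat.eq_of_mul_eq_mul_left he₁ h5
    have hmap : (maximalIdeal R₁).map g = maximalIdeal R₂ := by
      rw [hπ.maximalIdeal_eq, Ideal.map_span, Set.image_singleton, hgπ, hu', hs3, pow_one,
        Ideal.span_singleton_mul_left_unit u'.isUnit, hϖ.maximalIdeal_eq]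
    have hH : IsHausdorff ((maximalIdeal R₁).map g) R₂ := by
      rw [hmap]; infer_instance
    apply surjective_of_mk_map_comp_surjective g (I := maximalIdeal R₁)
    intro a
    obtain ⟨r₂, rfl⟩ := Ideal.Quotient.mk_surjective a
    obtain ⟨r₁, hr₁⟩ := hΦ (Ideal.Quotient.mk _ r₂)
    refine ⟨r₁, ?_⟩
    rw [RingHom.comp_apply, Ideal.Quotient.eq, hmap, ← residue_eq_zero_iff, map_sub, sub_eq_zero,
      ← hρ r₂, ← hr₁]
    exact (RingHom.congr_fun hres r₁).symm
end

section
/- Let p be a prime and let n, e ≥ 1 and c ≥ 0 be integers with n > e + e·c. Let R̄ be a nontrivial commutative Artinian local ring whose maximal ideal 𝔪̄ is a principal ideal, satisfying 𝔪̄^n = 0 and 𝔪̄^{n-1} ≠ 0, whose residue field R̄/𝔪̄ is a perfect field of characteristic p, and such that Ideal.span {(p : R̄)} = 𝔪̄^e and Ideal.span {(e : R̄)} = 𝔪̄^c. Then: (existence) there exists a complete discrete valuation ring R of characteristic zero, with maximal ideal 𝔪, together with a ring isomorphism R/𝔪^n ≃ R̄; (uniqueness) if R and R' are complete discrete valuation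 rings of characteristic zero with maximal ideals 𝔪 and 𝔪' such that R/𝔪^n ≃ R̄ and R'/𝔪'^n ≃ R̄ as rings, then R ≃ R' as rings. -/
open IsLocalRing

namespace CDVRAux

open WittVector

section witt

variable {p : ℕ} [Fact p.Prime] {k : Type} [Field k] [CharP k p]

lemma p_mem_ker {A : Type} [CommRing A] (q : A →+* k) : (p : A) ∈ RingHom.ker q := by
  simp [RingHom.mem_ker]

lemma nilp_unique [PerfectRing k p] {A : Type} [CommRing A] (q : A →+* k) {N : ℕ}
    (hN : RingHom.ker q ^ N = ⊥) (f g : WittVector p k →+* A)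
    (h : q.comp f = q.comp g) : f = g := by
  apply WittVector.eq_of_apply_teichmuller_eq f g
  · refine ⟨N, ?_⟩
    have := Ideal.pow_mem_pow (p_mem_ker (p := p) q) N
    rw [hN] at this
    simpa using this
  · intro x
    obtain ⟨y, hy⟩ : ∃ y : k, y ^ p ^ N = x :=
      (iterateFrobeniusEquiv k p N).surjective x
    rw [← hy, map_pow, map_pow, map_pow]
    have h1 : f (teichmuller p y) ≡ g (teichmuller p y) [SMOD RingHom.ker q] := by
      rw [SModEq.sub_mem, RingHom.mem_ker, map_sub, sub_eq_zero]
      exact RingHom.congr_fun h _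
    have h2 := SModEq.pow_pow_add_one (p_mem_ker (p := p) q) h1 N
    rw [SModEq.sub_mem, pow_succ, hN] at h2
    simpa [sub_eq_zero] using h2

lemma nilp_exists [PerfectRing k p] {A : Type} [CommRing A] (q : A →+* k)
    (hq : Function.Surjective q) {N : ℕ}
    (hN : RingHom.ker q ^ N = ⊥) : ∃ f : WittVector p k →+* A, q.comp f = constantCoeff := by
  have hker : RingHom.ker (WittVector.map q : WittVector p A →+* WittVector p k) ≤
      RingHom.ker (WittVector.ghostComponent (p := p) (R := A) N) := by
    intro x hx
    rw [RingHom.mem_ker] at hx ⊢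
    have hc : ∀ i, x.coeff i ∈ RingHom.ker q := by
      intro i
      have := congrArg (fun z => WittVector.coeff z i) hx
      simpa [WittVector.map_coeff] using this
    rw [ghostComponent_apply, wittPolynomial_eq_sum_C_mul_X_pow, map_sum]
    apply Finset.sum_eq_zero
    intro i hi
    have hi' : i ≤ N := by simpa [Nat.lt_succ_iff] using hi
    have hmem : (p : A) ^ i * x.coeff i ^ p ^ (N - i) ∈ RingHom.ker q ^ N := by
      have h1 : p ^ (N - i) ≥ N - i := (Nat.lt_pow_self (Fact.out : p.Prime).one_lt).le
      have h2 := Ideal.mul_mem_mul (Ideal.pow_mem_pow (p_mem_ker (p := p) q) i)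
        (Ideal.pow_le_pow_right h1 (Ideal.pow_mem_pow (hc i) (p ^ (N - i))))
      rw [← pow_add] at h2
      exact Ideal.pow_le_pow_right (by omega) h2
    rw [hN] at hmem
    simpa using hmem
  let h : WittVector p k →+* A := RingHom.liftOfSurjective (WittVector.map q)
    (map_surjective _ hq) ⟨WittVector.ghostComponent N, hker⟩
  have hh : ∀ x, h (WittVector.map q x) = WittVector.ghostComponent N x := fun x =>
    RingHom.liftOfSurjective_comp_apply ..
  refine ⟨h.comp (WittVector.map ((iterateFrobeniusEquiv k p N).symm : k →+* k)), ?_⟩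
  ext y
  obtain ⟨x, hx⟩ := map_surjective q hq
    (WittVector.map ((iterateFrobeniusEquiv k p N).symm : k →+* k) y)
  have hx0 : q (x.coeff 0) = (iterateFrobeniusEquiv k p N).symm (y.coeff 0) := by
    have := congrArg (fun z => WittVector.coeff z 0) hx
    simpa [WittVector.map_coeff] using this
  simp only [RingHom.comp_apply]
  rw [← hx, hh, ghostComponent_apply, wittPolynomial_eq_sum_C_mul_X_pow, map_sum, map_sum,
    Finset.sum_eq_single 0]
  · simp only [pow_zero, Nat.sub_zero, map_mul, map_pow, MvPolynomial.aeval_X, hx0]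
    rw [← iterateFrobeniusEquiv_def]
    simp
  · intro i _ hi
    simp [hi]
  · simp

lemma complete_exists [PerfectRing k p] {A : Type} [CommRing A] (q : A →+* k)
    (hq : Function.Surjective q) (I : Ideal A) (hI : RingHom.ker q = I) [IsAdicComplete I A] :
    ∃ f : WittVector p k →+* A, q.comp f = constantCoeff := by
  have hle : ∀ n, ∀ a ∈ I ^ (n + 1), q a = 0 := by
    intro n a ha
    have := Ideal.pow_le_self (by omega) ha
    rwa [← hI] at this
  let qn : ∀ n : ℕ, A ⧸ I ^ (n + 1) →+* k := fun n => Ideal.Quotient.lift _ q (hle n)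
  have hqn : ∀ n a, qn n (Ideal.Quotient.mk _ a) = q a := fun n a => rfl
  have hker : ∀ n, RingHom.ker (qn n) ^ (n + 1) = ⊥ := by
    intro n
    have : RingHom.ker (qn n) = I.map (Ideal.Quotient.mk (I ^ (n + 1))) := by
      ext a
      obtain ⟨a, rfl⟩ := Ideal.Quotient.mk_surjective a
      rw [RingHom.mem_ker, hqn]
      rw [Ideal.mem_map_iff_of_surjective _ Ideal.Quotient.mk_surjective]
      constructor
      · intro h
        exact ⟨a, hI ▸ (RingHom.mem_ker.2 h), rfl⟩
      · rintro ⟨b, hb, hab⟩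
        have := congrArg (qn n) hab
        rw [hqn, hqn] at this
        rw [← this]
        rw [← hI] at hb
        exact hb
    rw [this, ← Ideal.map_pow, Ideal.map_quotient_self]
  have hsurj : ∀ n, Function.Surjective (qn n) := fun n a => by
    obtain ⟨b, rfl⟩ := hq a
    exact ⟨Ideal.Quotient.mk _ b, rfl⟩
  choose f hf using fun n => nilp_exists (p := p) (qn n) (hsurj n) (hker n)
  have hcomp : ∀ n, (Ideal.Quotient.factorPowSucc I (n + 1)).comp (f (n + 1)) = f n := by
    intro n
    apply nilp_unique (qn n) (hker n)
    rw [hf, ← hf (n + 1), ← RingHom.comp_assoc]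
    congr 1
    ext a
    simp [hqn]
  let F := IsAdicComplete.StrictMono.liftRingHom I Order.succ_strictMono
    (fun n => f n) (fun {n} => hcomp n)
  have hF : ∀ x, Ideal.Quotient.mk (I ^ (0 + 1)) (F x) = f 0 x := fun x =>
    IsAdicComplete.StrictMono.mk_liftRingHom I Order.succ_strictMono (fun n => f n)
      (fun {n} => hcomp n) x
  refine ⟨F, ?_⟩
  ext x
  have := congrArg (qn 0) (hF x)
  rw [hqn] at this
  rw [RingHom.comp_apply, this, ← RingHom.comp_apply, hf]

lemma witt_lim [PerfectRing k p] (v : ℕ → WittVector p k) :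
    ∃ L : WittVector p k, ∀ j, (p : WittVector p k) ^ j ∣
      L - ∑ l ∈ Finset.range j, (p : WittVector p k) ^ l * v l := by
  obtain ⟨L, hL⟩ := IsPrecomplete.prec' (I := Ideal.span {(p : WittVector p k)})
    (fun j => ∑ l ∈ Finset.range j, (p : WittVector p k) ^ l * v l) (by
      intro m n hmn
      rw [SModEq.sub_mem, smul_eq_mul, Ideal.mul_top, Ideal.span_singleton_pow,
        Ideal.mem_span_singleton, ← neg_sub, dvd_neg, ← Finset.sum_Ico_eq_sub _ hmn]
      apply Finset.dvd_sum
      intro i hi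
      exact dvd_mul_of_dvd_left (pow_dvd_pow _ (Finset.mem_Ico.1 hi).1) _)
  refine ⟨L, fun j => ?_⟩
  have := (hL j).symm
  rwa [SModEq.sub_mem, smul_eq_mul, Ideal.mul_top, Ideal.span_singleton_pow,
        Ideal.mem_span_singleton] at this

end witt

section struct

variable {p : ℕ} [Fact p.Prime] {k : Type} [Field k] [CharP k p] [PerfectRing k p]
  {A : Type} [CommRing A] (q : A →+* k) (f : WittVector p k →+* A)
  (hf : q.comp f = constantCoeff) (pi : A) (hpi : RingHom.ker q = Ideal.span {pi})

include hf hpi in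
lemma expand (j : ℕ) (a : A) : ∃ (w : ℕ → WittVector p k) (b : A),
    a = ∑ i ∈ Finset.range j, f (w i) * pi ^ i + pi ^ j * b := by
  induction j with
  | zero => exact ⟨fun _ => 0, a, by simp⟩
  | succ j ih =>
    obtain ⟨w, b, hab⟩ := ih
    obtain ⟨z, hz⟩ : ∃ z : WittVector p k, constantCoeff z = q b :=
      constantCoeff_surjective p (q b)
    have hb : b - f z ∈ RingHom.ker q := by
      rw [RingHom.mem_ker, map_sub, ← hz, ← hf]
      simp
    rw [hpi, Ideal.mem_span_singleton] at hb
    obtain ⟨b', hb'⟩ := hb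
    refine ⟨fun i => if i = j then z else w i, b', ?_⟩
    rw [Finset.sum_range_succ, hab]
    have : ∑ i ∈ Finset.range j, f (if i = j then z else w i) * pi ^ i
        = ∑ i ∈ Finset.range j, f (w i) * pi ^ i := by
      apply Finset.sum_congr rfl
      intro i hi
      rw [if_neg (by have := Finset.mem_range.1 hi; omega)]
    beta_reduce
    rw [this, if_pos rfl]
    have hb2 : b = f z + pi * b' := by rw [← hb']; ring
    rw [hb2]
    ring

omit [PerfectRing k p] [CharP k p] in
lemma sum_dvd (e j : ℕ) (L s : ℕ → WittVector p k)
    (h : ∀ i, (p : WittVector p k) ^ j ∣ L i - s i) :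
    (p : A) ^ j ∣ ∑ i ∈ Finset.range e, f (L i) * pi ^ i
      - ∑ i ∈ Finset.range e, f (s i) * pi ^ i := by
  rw [← Finset.sum_sub_distrib]
  apply Finset.dvd_sum
  intro i _
  rw [← sub_mul, ← map_sub]
  apply dvd_mul_of_dvd_left
  have := map_dvd f (h i)
  simpa using this

omit [CharP k p] [PerfectRing k p] in
lemma sum_swap (e j : ℕ) (v : ℕ → ℕ → WittVector p k) :
    ∑ i ∈ Finset.range e,
      f (∑ l ∈ Finset.range j, (p : WittVector p k) ^ l * v l i) * pi ^ i =
    ∑ l ∈ Finset.range j, (p : A) ^ l * ∑ i ∈ Finset.range e, f (v l i) * pi ^ i := by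
  simp only [map_sum, map_mul, map_pow, map_natCast, Finset.sum_mul, Finset.mul_sum]
  rw [Finset.sum_comm]
  simp only [mul_assoc]

include hf hpi in
lemma surj_of_haus (e : ℕ) (hp : Ideal.span {(p : A)} = Ideal.span {pi ^ e})
    (haus : ∀ a : A, (∀ j, (p : A) ^ j ∣ a) → a = 0) (a : A) :
    ∃ w : ℕ → WittVector p k, a = ∑ i ∈ Finset.range e, f (w i) * pi ^ i := by
  have hdvd : (p : A) ∣ pi ^ e := by
    rw [← Ideal.mem_span_singleton, hp]; exact Ideal.mem_span_singleton_self _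
  have step : ∀ a : A, ∃ (w : ℕ → WittVector p k) (b : A),
      a = ∑ i ∈ Finset.range e, f (w i) * pi ^ i + p * b := by
    intro a
    obtain ⟨w, b, h⟩ := expand q f hf pi hpi e a
    obtain ⟨c, hc⟩ := hdvd
    exact ⟨w, c * b, by rw [h, hc]; ring⟩
  choose W B hWB using step
  let s : ℕ → A := fun n => Nat.rec a (fun _ b => B b) n
  have hs : ∀ j, a = ∑ l ∈ Finset.range j,
      (p : A) ^ l * ∑ i ∈ Finset.range e, f (W (s l) i) * pi ^ i + p ^ j * s j := by
    intro j
    induction j with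
    | zero => simp [s]
    | succ j ih =>
      rw [Finset.sum_range_succ]
      have h1 : s j = ∑ i ∈ Finset.range e, f (W (s j) i) * pi ^ i + p * s (j + 1) := hWB (s j)
      calc a = _ := ih
        _ = ∑ l ∈ Finset.range j,
          (p : A) ^ l * ∑ i ∈ Finset.range e, f (W (s l) i) * pi ^ i + p ^ j *
          (∑ i ∈ Finset.range e, f (W (s j) i) * pi ^ i + p * s (j + 1)) := by rw [← h1]
        _ = _ := by ring
  choose L hL using fun i => witt_lim (p := p) (k := k) (fun l => W (s l) i)
  refine ⟨L, ?_⟩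
  rw [← sub_eq_zero]
  apply haus
  intro j
  have h1 := sum_dvd f pi e j L _ (fun i => hL i j)
  rw [sum_swap] at h1
  have h2 : (p : A) ^ j ∣ p ^ j * s j := dvd_mul_right _ _
  have h3 := dvd_sub h2 h1
  convert h3 using 1
  have := hs j
  linear_combination this

lemma precomplete_of_surj (e : ℕ) (he : 1 ≤ e)
    (hp : Ideal.span {(p : A)} = Ideal.span {pi ^ e})
    (hsurj : ∀ a : A, ∃ w : ℕ → WittVector p k, a = ∑ i ∈ Finset.range e, f (w i) * pi ^ i) :
    IsPrecomplete (Ideal.span {pi}) A := by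
  have hdvd : (p : A) ∣ pi ^ e := by
    rw [← Ideal.mem_span_singleton, hp]; exact Ideal.mem_span_singleton_self _
  have hdvd' : pi ^ e ∣ (p : A) := by
    rw [← Ideal.mem_span_singleton, ← hp]; exact Ideal.mem_span_singleton_self _
  constructor
  intro g hg
  have hg' : ∀ {m n}, m ≤ n → pi ^ m ∣ g n - g m := by
    intro m n hmn
    have := (hg hmn).symm
    rwa [SModEq.sub_mem, smul_eq_mul, Ideal.mul_top, Ideal.span_singleton_pow,
        Ideal.mem_span_singleton] at this
  have hstep : ∀ j, ∃ w : ℕ → WittVector p k, g (e * (j + 1)) - g (e * j) =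
      p ^ j * ∑ i ∈ Finset.range e, f (w i) * pi ^ i := by
    intro j
    have h1 : pi ^ (e * j) ∣ g (e * (j + 1)) - g (e * j) := hg' (by nlinarith)
    rw [pow_mul] at h1
    obtain ⟨c, hc⟩ := (pow_dvd_pow_of_dvd hdvd j).trans h1
    obtain ⟨w, hw⟩ := hsurj c
    exact ⟨w, by rw [hc, hw]⟩
  choose v hv using hstep
  have hsum : ∀ j, g (e * j) = g 0 + ∑ l ∈ Finset.range j,
      (p : A) ^ l * ∑ i ∈ Finset.range e, f (v l i) * pi ^ i := by
    intro j
    induction j with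
    | zero => simp
    | succ j ih =>
      rw [Finset.sum_range_succ, ← hv]
      linear_combination ih
  choose L hL using fun i => witt_lim (p := p) (k := k) (fun l => v l i)
  refine ⟨g 0 + ∑ i ∈ Finset.range e, f (L i) * pi ^ i, fun m => ?_⟩
  apply SModEq.symm
  rw [SModEq.sub_mem, smul_eq_mul, Ideal.mul_top, Ideal.span_singleton_pow,
        Ideal.mem_span_singleton]
  have h1 := sum_dvd f pi e m L _ (fun i => hL i m)
  rw [sum_swap] at h1
  have h2 : pi ^ m ∣ (p : A) ^ m :=
    pow_dvd_pow_of_dvd ((dvd_pow_self pi (by omega)).trans hdvd') m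
  have h3 : pi ^ m ∣ g (e * m) - g m := hg' (by nlinarith)
  have h4 := dvd_add (h2.trans h1) h3
  convert h4 using 1
  rw [hsum m]
  ring

include hf in
lemma indep_aux [IsDomain A] (hirr : Irreducible pi) (hloc : ∀ a, q a ≠ 0 → IsUnit a) (e : ℕ)
    (hp : Ideal.span {(p : A)} = Ideal.span {pi ^ e}) (m i : ℕ) (w : WittVector p k)
    (hm : ¬ (m ≡ i [MOD e])) (h : pi ^ m ∣ f w * pi ^ i) : pi ^ (m + 1) ∣ f w * pi ^ i := by
  by_cases hw : w = 0
  · simp [hw]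
  obtain ⟨t, b, hb, rfl⟩ := WittVector.exists_eq_pow_p_mul w hw
  have hbu : IsUnit (f b) := by
    apply hloc
    have := RingHom.congr_fun hf b
    rw [RingHom.comp_apply] at this
    rw [this]
    exact hb
  have has : Associated (f (p ^ t * b) * pi ^ i) (pi ^ (e * t + i)) := by
    have h1 : Associated (p : A) (pi ^ e) := Ideal.span_singleton_eq_span_singleton.1 hp
    rw [pow_add, pow_mul, map_mul, map_pow, map_natCast]
    apply Associated.mul_right
    exact (associated_mul_unit_left _ _ hbu).trans (h1.pow_pow)
  rw [has.dvd_iff_dvd_right] at h ⊢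
  have h' := (pow_dvd_pow_iff hirr.ne_zero hirr.not_isUnit).1 h
  apply pow_dvd_pow
  rcases h'.lt_or_eq with h'' | h''
  · omega
  · exfalso
    apply hm
    rw [h'']
    simp [Nat.ModEq]

include hf in
lemma indep [IsDomain A] (hirr : Irreducible pi) (hloc : ∀ a, q a ≠ 0 → IsUnit a) (e : ℕ)
    (hp : Ideal.span {(p : A)} = Ideal.span {pi ^ e}) (m : ℕ) (w : ℕ → WittVector p k)
    (h : pi ^ m ∣ ∑ i ∈ Finset.range e, f (w i) * pi ^ i) :
    ∀ i < e, pi ^ m ∣ f (w i) * pi ^ i := by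
  induction m with
  | zero => simp
  | succ m ih =>
    have ih' := ih ((pow_dvd_pow _ (by omega)).trans h)
    have key : ∀ i < e, ¬ (m ≡ i [MOD e]) → pi ^ (m + 1) ∣ f (w i) * pi ^ i :=
      fun i hi hmi => indep_aux q f hf pi hirr hloc e hp m i (w i) hmi (ih' i hi)
    intro i hi
    by_cases hmi : m ≡ i [MOD e]
    · rw [← Finset.add_sum_erase _ _ (Finset.mem_range.2 hi)] at h
      refine (dvd_add_left ?_).1 h
      apply Finset.dvd_sum
      intro j hj
      obtain ⟨hji, hj⟩ := Finset.mem_erase.1 hj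
      have hj := Finset.mem_range.1 hj
      apply key j hj
      intro hmj
      have := hmj.symm.trans hmi
      rw [Nat.ModEq, Nat.mod_eq_of_lt hj, Nat.mod_eq_of_lt hi] at this
      exact hji this
    · exact key i hi hmi

end struct

section hensel

open Polynomial

/-- Newton's method for not necessarily monic polynomials. -/
lemma hensel_simple {R : Type} [CommRing R] (I : Ideal R) [IsAdicComplete I R]
    (f : R[X]) (a₀ : R) (h₁ : f.eval a₀ ∈ I)
    (h₂ : IsUnit (Ideal.Quotient.mk I (f.derivative.eval a₀))) :
    ∃ a, f.IsRoot a ∧ a - a₀ ∈ I := by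
  classical
    let f' := derivative f
    let c : ℕ → R := fun n => Nat.recOn n a₀ fun _ b => b - f.eval b * Ring.inverse (f'.eval b)
    have hc : ∀ n, c (n + 1) = c n - f.eval (c n) * Ring.inverse (f'.eval (c n)) := by
      intro n
      simp only [c]
    have hc_mod : ∀ n, c n ≡ a₀ [SMOD I] := by
      intro n
      induction n with
      | zero => rfl
      | succ n ih => ?_
      rw [hc, sub_eq_add_neg, ← add_zero a₀]
      refine ih.add ?_
      rw [SModEq.zero, Ideal.neg_mem_iff]
      refine I.mul_mem_right _ ?_
      rw [← SModEq.zero] at h₁ ⊢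
      exact (ih.eval f).trans h₁
    have hf'c : ∀ n, IsUnit (f'.eval (c n)) := by
      intro n
      have := isLocalHom_of_le_jacobson_bot I (IsAdicComplete.le_jacobson_bot I)
      apply IsUnit.of_map (Ideal.Quotient.mk I)
      convert! h₂ using 1
      exact SModEq.def.mp ((hc_mod n).eval _)
    have hfcI : ∀ n, f.eval (c n) ∈ I ^ (n + 1) := by
      intro n
      induction n with
      | zero => simpa only [Nat.rec_zero, zero_add, pow_one] using! h₁
      | succ n ih => ?_
      rw [← taylor_eval_sub (c n), hc, sub_eq_add_neg, sub_eq_add_neg,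
        add_neg_cancel_comm]
      rw [eval_eq_sum, sum_over_range' _ _ _ (lt_add_of_pos_right _ zero_lt_two), ←
        Finset.sum_range_add_sum_Ico _ (Nat.le_add_left _ _)]
      swap
      · intro i
        rw [zero_mul]
      refine Ideal.add_mem _ ?_ ?_
      · rw [← one_add_one_eq_two, Finset.sum_range_succ, Finset.range_one, Finset.sum_singleton,
          taylor_coeff_zero, taylor_coeff_one, pow_zero, pow_one, mul_one, mul_neg,
          mul_left_comm, Ring.mul_inverse_cancel _ (hf'c n), mul_one, add_neg_cancel]
        exact Ideal.zero_mem _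
      · refine Submodule.sum_mem _ ?_
        simp only [Finset.mem_Ico]
        rintro i ⟨h2i, _⟩
        have aux : n + 2 ≤ i * (n + 1) := by trans 2 * (n + 1) <;> nlinarith only [h2i]
        refine Ideal.mul_mem_left _ _ (Ideal.pow_le_pow_right aux ?_)
        rw [pow_mul']
        exact Ideal.pow_mem_pow ((Ideal.neg_mem_iff _).2 <| Ideal.mul_mem_right _ _ ih) _
    have aux : ∀ m n, m ≤ n → c m ≡ c n [SMOD (I ^ m • ⊤ : Ideal R)] := by
      intro m n hmn
      rw [← Ideal.one_eq_top, Ideal.smul_eq_mul, mul_one]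
      obtain ⟨k, rfl⟩ := Nat.exists_eq_add_of_le hmn
      clear hmn
      induction k with
      | zero => rw [add_zero]
      | succ k ih => ?_
      rw [← add_assoc, hc, ← add_zero (c m), sub_eq_add_neg]
      refine ih.add ?_
      symm
      rw [SModEq.zero, Ideal.neg_mem_iff]
      refine Ideal.mul_mem_right _ _ (Ideal.pow_le_pow_right ?_ (hfcI _))
      rw [add_assoc]
      exact le_self_add
    obtain ⟨a, ha⟩ := IsPrecomplete.prec' c (aux _ _)
    refine ⟨a, ?_, ?_⟩
    · show f.IsRoot a
      suffices ∀ n, f.eval a ≡ 0 [SMOD (I ^ n • ⊤ : Ideal R)] by exact IsHausdorff.haus' _ this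
      intro n
      specialize ha n
      rw [← Ideal.one_eq_top, Ideal.smul_eq_mul, mul_one] at ha ⊢
      refine (ha.symm.eval f).trans ?_
      rw [SModEq.zero]
      exact Ideal.pow_le_pow_right le_self_add (hfcI _)
    · show a - a₀ ∈ I
      specialize ha (0 + 1)
      rw [hc, pow_one, ← Ideal.one_eq_top, Ideal.smul_eq_mul, mul_one, sub_eq_add_neg] at ha
      rw [← SModEq.sub_mem, ← add_zero a₀]
      refine ha.symm.trans (SModEq.rfl.add ?_)
      rw [SModEq.zero, Ideal.neg_mem_iff]
      exact Ideal.mul_mem_right _ _ h₁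

lemma hensel_strong {A : Type} [CommRing A] (I : Ideal A) [IsAdicComplete I A]
    (H : A[X]) (t : A) (ht : t ∈ I) (h0 : H.eval 0 = (H.derivative.eval 0) ^ 2 * t) :
    ∃ y ∈ I, H.eval y = 0 := by
  set d := H.derivative.eval 0 with hd
  set h := H.divX.divX
  have hd1 : d = H.coeff 1 := by
    rw [hd, ← coeff_zero_eq_eval_zero, coeff_derivative]
    simp
  have hH : ∀ y, H.eval y = (h.eval y * y + d) * y + d ^ 2 * t := by
    intro y
    have e1 := divX_mul_X_add H
    have e2 := divX_mul_X_add H.divX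
    rw [← h0, hd1, ← coeff_zero_eq_eval_zero]
    conv_lhs => rw [← e1, ← e2]
    simp [coeff_divX, h]
  let P : A[X] := C t + X + X ^ 2 * h.comp (C d * X)
  obtain ⟨z, hz, hzI⟩ := hensel_simple I P 0 (by simpa [P] using ht) (by simp [P])
  refine ⟨d * z, I.mul_mem_left _ (by simpa using hzI), ?_⟩
  have hz' : t + z + z ^ 2 * h.eval (d * z) = 0 := by
    simpa [P, IsRoot] using hz
  rw [hH]
  linear_combination d ^ 2 * hz'

end hensel

section transfer

variable {R : Type} [CommRing R] [IsLocalRing R]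
  {B : Type} [CommRing B] [IsLocalRing B] (rho : R →+* B) (hrho : Function.Surjective rho)

include hrho in
lemma comap_max : (maximalIdeal B).comap rho = maximalIdeal R := by
  have : ((maximalIdeal B).comap rho).IsMaximal :=
    Ideal.comap_isMaximal_of_surjective rho hrho
  exact IsLocalRing.eq_maximalIdeal this

include hrho in
lemma map_max : (maximalIdeal R).map rho = maximalIdeal B := by
  rw [← comap_max rho hrho, Ideal.map_comap_of_surjective rho hrho]

include hrho in
lemma span_transfer [IsNoetherianRing R] {n j : ℕ} (hker : RingHom.ker rho = maximalIdeal R ^ n) (hj : j < n) (a : R)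
    (ha : Ideal.span {rho a} = maximalIdeal B ^ j) : Ideal.span {a} = maximalIdeal R ^ j := by
  have h1 : (Ideal.span {a}).map rho = (maximalIdeal R ^ j).map rho := by
    rw [Ideal.map_span, Set.image_singleton, ha, Ideal.map_pow, map_max rho hrho]
  have h2 := congrArg (Ideal.comap rho) h1
  rw [Ideal.comap_map_of_surjective' rho hrho, Ideal.comap_map_of_surjective' rho hrho, hker,
    sup_eq_left.2 (Ideal.pow_le_pow_right hj.le : maximalIdeal R ^ n ≤ maximalIdeal R ^ j)] at h2
  apply le_antisymm
  · rw [← h2]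
    exact le_sup_left
  · apply Submodule.le_of_le_smul_of_le_jacobson_bot (I := maximalIdeal R)
      (IsNoetherian.noetherian _) (IsLocalRing.maximalIdeal_le_jacobson _)
    rw [← h2]
    apply sup_le_sup_left
    rw [h2, smul_eq_mul, ← pow_succ']
    exact Ideal.pow_le_pow_right hj

end transfer

section eisen

open Polynomial

variable {p : ℕ} [Fact p.Prime] {k : Type} [Field k] [CharP k p] [PerfectRing k p]

/-- The Eisenstein polynomial `X ^ e - p * ∑ b i X ^ i`. -/
noncomputable def eis (p : ℕ) [Fact p.Prime] {k : Type} [Field k] (e : ℕ)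
    (b : ℕ → WittVector p k) : (WittVector p k)[X] :=
  X ^ e - C (p : WittVector p k) * ∑ i ∈ Finset.range e, C (b i) * X ^ i

lemma eis_deg_lt (e : ℕ) (b : ℕ → WittVector p k) :
    (C (p : WittVector p k) * ∑ i ∈ Finset.range e, C (b i) * X ^ i).degree < (e : WithBot ℕ) := by
  rw [← mem_degreeLT, ← smul_eq_C_mul]
  apply Submodule.smul_mem
  apply Submodule.sum_mem
  intro i hi
  rw [mem_degreeLT]
  refine (degree_C_mul_X_pow_le i _).trans_lt ?_
  exact_mod_cast Finset.mem_range.1 hi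

lemma eis_monic (e : ℕ) (b : ℕ → WittVector p k) : (eis p e b).Monic := by
  unfold eis
  exact monic_X_pow_sub (eis_deg_lt e b)

lemma eis_natDegree (e : ℕ) (b : ℕ → WittVector p k) : (eis p e b).natDegree = e := by
  unfold eis
  apply natDegree_eq_of_degree_eq_some
  rw [degree_sub_eq_left_of_degree_lt]
  · simp
  · simpa using eis_deg_lt e b

lemma eis_eval {A : Type} [CommRing A] (f : WittVector p k →+* A) (e : ℕ)
    (b : ℕ → WittVector p k) (x : A) :
    (eis p e b).eval₂ f x = x ^ e - p * ∑ i ∈ Finset.range e, f (b i) * x ^ i := by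
  simp [eis, eval₂_finsetSum, eval₂_mul, eval₂_sub]

lemma adj_expand (e : ℕ) (b : ℕ → WittVector p k) (a : AdjoinRoot (eis p e b)) :
    ∃ w : ℕ → WittVector p k,
      a = ∑ i ∈ Finset.range e, AdjoinRoot.of (eis p e b) (w i) * AdjoinRoot.root (eis p e b) ^ i := by
  obtain ⟨h, rfl⟩ := AdjoinRoot.mk_surjective a
  by_cases h1 : eis p e b = 1
  · refine ⟨fun _ => 0, ?_⟩
    have : Subsingleton (AdjoinRoot (eis p e b)) := by
      rw [h1]
      exact Ideal.Quotient.subsingleton_iff.2 (by simp)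
    exact Subsingleton.elim _ _
  refine ⟨fun i => (h %ₘ eis p e b).coeff i, ?_⟩
  have h2 : AdjoinRoot.mk (eis p e b) h = AdjoinRoot.mk (eis p e b) (h %ₘ eis p e b) := by
    conv_lhs => rw [← modByMonic_add_div h (eis p e b)]
    simp
  have hd : (h %ₘ eis p e b).natDegree < e := by
    have := natDegree_modByMonic_lt h (eis_monic e b) h1
    rwa [eis_natDegree] at this
  rw [h2]
  conv_lhs => rw [as_sum_range' _ e hd]
  simp [← C_mul_X_pow_eq_monomial, AdjoinRoot.mk_X]

lemma haus_of_mem {A : Type} [CommRing A] (I : Ideal A) [IsHausdorff I A] (x : A) (hx : x ∈ I)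
    (a : A) (h : ∀ j, x ^ j ∣ a) : a = 0 := by
  apply IsHausdorff.haus' (I := I)
  intro j
  rw [SModEq.zero, smul_eq_mul, Ideal.mul_top]
  exact Ideal.mem_of_dvd _ (h j) (Ideal.pow_mem_pow hx j)

lemma adj_bij {A : Type} [CommRing A] [IsDomain A] [CharZero A]
    (q : A →+* k) (f : WittVector p k →+* A)
    (hf : q.comp f = WittVector.constantCoeff) (pi : A) (hpi : RingHom.ker q = Ideal.span {pi})
    (hirr : Irreducible pi) (hloc : ∀ a, q a ≠ 0 → IsUnit a) (e : ℕ)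
    [IsHausdorff (Ideal.span {pi}) A]
    (hp : Ideal.span {(p : A)} = Ideal.span {pi ^ e}) (b : ℕ → WittVector p k)
    (hroot : (eis p e b).eval₂ f pi = 0) : Nonempty (AdjoinRoot (eis p e b) ≃+* A) := by
  have hpm : (p : A) ∈ Ideal.span {pi} := hpi ▸ p_mem_ker (p := p) q
  refine ⟨RingEquiv.ofBijective (AdjoinRoot.lift f pi hroot) ⟨?_, ?_⟩⟩
  · rw [injective_iff_map_eq_zero]
    intro a ha
    obtain ⟨w, rfl⟩ := adj_expand e b a
    simp only [map_sum, map_mul, map_pow, AdjoinRoot.lift_of, AdjoinRoot.lift_root] at ha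
    apply Finset.sum_eq_zero
    intro i hi
    have hz : f (w i) * pi ^ i = 0 := by
      apply haus_of_mem (Ideal.span {pi}) pi (Ideal.mem_span_singleton_self _)
      intro j
      exact indep q f hf pi hirr hloc e hp j w (by rw [ha]; exact dvd_zero _) i
        (Finset.mem_range.1 hi)
    have hz' : f (w i) = 0 := by
      rcases mul_eq_zero.1 hz with h | h
      · exact h
      · exact absurd h (pow_ne_zero _ hirr.ne_zero)
    have hw : w i = 0 := by
      by_contra hw
      obtain ⟨t, b', hb, hwb⟩ := WittVector.exists_eq_pow_p_mul (w i) hw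
      have hbu : IsUnit (f b') := by
        apply hloc
        have := RingHom.congr_fun hf b'
        rw [RingHom.comp_apply] at this
        rw [this]
        exact hb
      rw [hwb, map_mul, map_pow, map_natCast] at hz'
      have hp0 : (p : A) ≠ 0 := Nat.cast_ne_zero.2 (Fact.out : p.Prime).ne_zero
      exact (mul_ne_zero (pow_ne_zero t hp0) hbu.ne_zero) hz'
    rw [hw]
    simp
  · intro a
    obtain ⟨w, hw⟩ := surj_of_haus q f hf pi hpi e hp
      (haus_of_mem (Ideal.span {pi}) (p : A) hpm) a
    refine ⟨∑ i ∈ Finset.range e, AdjoinRoot.of (eis p e b) (w i) *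
      AdjoinRoot.root (eis p e b) ^ i, ?_⟩
    simp only [map_sum, map_mul, map_pow, AdjoinRoot.lift_of, AdjoinRoot.lift_root]
    exact hw.symm

end eisen

section unique

open Polynomial

variable {p : ℕ} [Fact p.Prime] {n e c : ℕ} {B : Type} [CommRing B] [IsLocalRing B]
  [CharP (ResidueField B) p] [PerfectRing (ResidueField B) p]

lemma root_lift {k : Type} [Field k] [CharP k p] [PerfectRing k p] (he : 1 ≤ e)
    (hec2 : 2 * c ≤ e * c) (hn : e + e * c < n)
    {R : Type} [CommRing R] [IsDomain R]
    (q : R →+* k) (f : WittVector p k →+* R)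
    (hf : q.comp f = WittVector.constantCoeff) (pi : R)
    [IsAdicComplete (Ideal.span {pi}) R]
    (hirr : Irreducible pi) (hloc : ∀ a, q a ≠ 0 → IsUnit a)
    (hdvr : ∀ a : R, a ≠ 0 → ∃ j, Associated a (pi ^ j))
    (hp : Ideal.span {(p : R)} = Ideal.span {pi ^ e})
    (hec : Ideal.span {(e : R)} = Ideal.span {pi ^ c})
    (b : ℕ → WittVector p k) (hb : (b 0).coeff 0 ≠ 0)
    (hroot : pi ^ n ∣ (eis p e b).eval₂ f pi) :
    ∃ y ∈ Ideal.span {pi}, (eis p e b).eval₂ f (pi * (1 + y)) = 0 := by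
  obtain ⟨u, hu⟩ : Associated (pi ^ e) (p : R) :=
    (Ideal.span_singleton_eq_span_singleton.1 hp).symm
  let H : R[X] := (1 + X) ^ e - C (u : R) * ∑ i ∈ Finset.range e, C (f (b i) * pi ^ i) * (1 + X) ^ i
  have hH : ∀ y, (eis p e b).eval₂ f (pi * (1 + y)) = pi ^ e * H.eval y := by
    intro y
    rw [eis_eval, ← hu]
    simp only [H, eval_sub, eval_pow, eval_add, eval_one, eval_X, eval_mul, eval_C, eval_finsetSum,
      mul_pow]
    rw [mul_sub]
    congr 1
    rw [mul_assoc]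
    congr 2
    apply Finset.sum_congr rfl
    intro i _
    ring
  have hpe : pi ^ e ≠ 0 := pow_ne_zero _ hirr.ne_zero
  have hH0 : pi ^ (n - e) ∣ H.eval 0 := by
    have h1 := hH 0
    rw [add_zero, mul_one] at h1
    rw [h1, ← Nat.add_sub_cancel' (show e ≤ n by omega), pow_add] at hroot
    exact (mul_dvd_mul_iff_left hpe).1 hroot
  have hd : H.derivative.eval 0 - e * H.eval 0 =
      u * ∑ i ∈ Finset.range e, f (((e - i : ℕ) : WittVector p k) * b i) * pi ^ i := by
    simp only [H, derivative_sub, derivative_mul, derivative_C, derivative_sum, eval_sub, eval_mul,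
      eval_C, eval_finsetSum, derivative_pow, derivative_add, derivative_one, derivative_X,
      eval_add, eval_one, eval_X, eval_pow, eval_natCast, map_mul, map_natCast, add_zero, one_pow,
      mul_one, zero_mul, zero_add, eval_zero]
    have h1 : ∀ i ∈ Finset.range e, (((e - i : ℕ) : R) * f (b i)) * pi ^ i =
        e * (f (b i) * pi ^ i) - f (b i) * pi ^ i * i := by
      intro i hi
      rw [Nat.cast_sub (Finset.mem_range.1 hi).le]
      ring
    rw [Finset.sum_congr rfl h1, Finset.sum_sub_distrib, ← Finset.mul_sum]
    ring_nf
    congr 2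
    apply Finset.sum_congr rfl
    intro x _
    ring
  have hcn : c + 1 ≤ n - e := by
    have : c ≤ e * c := by nlinarith
    omega
  have hd1 : ¬ pi ^ (c + 1) ∣ H.derivative.eval 0 := by
    intro h
    have h1 := dvd_sub h (dvd_mul_of_dvd_right ((pow_dvd_pow pi hcn).trans hH0) (e : R))
    rw [hd, u.isUnit.dvd_mul_left] at h1
    have h2 := indep q f hf pi hirr hloc e hp _ _ h1 0 (by omega)
    have hbu : IsUnit (f (b 0)) := by
      apply hloc
      have := RingHom.congr_fun hf (b 0)
      rw [RingHom.comp_apply] at this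
      rw [this]
      exact hb
    rw [pow_zero, mul_one, map_mul, hbu.dvd_mul_right, map_natCast, Nat.sub_zero,
      (Ideal.span_singleton_eq_span_singleton.1 hec).dvd_iff_dvd_right,
      pow_dvd_pow_iff hirr.ne_zero hirr.not_isUnit] at h2
    omega
  have hd0 : H.derivative.eval 0 ≠ 0 := by
    intro h
    rw [h] at hd1
    exact hd1 (dvd_zero _)
  obtain ⟨j, hj⟩ := hdvr _ hd0
  have hjc : j ≤ c := by
    by_contra hlt
    apply hd1
    rw [hj.dvd_iff_dvd_right]
    exact pow_dvd_pow _ (by omega)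
  obtain ⟨t, ht⟩ : (H.derivative.eval 0) ^ 2 * pi ∣ H.eval 0 := by
    have h1 : Associated ((H.derivative.eval 0) ^ 2 * pi) (pi ^ (j * 2 + 1)) := by
      rw [pow_succ pi, pow_mul]
      exact (hj.pow_pow).mul_right _
    rw [h1.dvd_iff_dvd_left]
    exact (pow_dvd_pow pi (by omega)).trans hH0
  obtain ⟨y, hyI, hy⟩ := hensel_strong (Ideal.span {pi}) H (pi * t)
    (Ideal.mul_mem_right _ _ (Ideal.mem_span_singleton_self _)) (by rw [ht]; ring)
  exact ⟨y, hyI, by rw [hH, hy, mul_zero]⟩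

lemma cdvr_iso (he : 1 ≤ e) (hec2 : 2 * c ≤ e * c) (hn : e + e * c < n)
    (hzero : maximalIdeal B ^ n = ⊥)
    (hp : Ideal.span {(p : B)} = maximalIdeal B ^ e)
    (hec : Ideal.span {(e : B)} = maximalIdeal B ^ c)
    (fB : WittVector p (ResidueField B) →+* B) (hfB : (residue B).comp fB = WittVector.constantCoeff)
    (piB : B) (hpiB : maximalIdeal B = Ideal.span {piB})
    (b : ℕ → WittVector p (ResidueField B)) (hb : (b 0).coeff 0 ≠ 0)
    (hroot : (eis p e b).eval₂ fB piB = 0)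
    {R : Type} [CommRing R] [IsDomain R] [IsDiscreteValuationRing R]
    [CharZero R] [IsAdicComplete (maximalIdeal R) R]
    (phi : (R ⧸ maximalIdeal R ^ n) ≃+* B) : Nonempty (AdjoinRoot (eis p e b) ≃+* R) := by
  let rho : R →+* B := (phi : (R ⧸ maximalIdeal R ^ n) →+* B).comp (Ideal.Quotient.mk _)
  have hrho : Function.Surjective rho := phi.surjective.comp Ideal.Quotient.mk_surjective
  have hker : RingHom.ker rho = maximalIdeal R ^ n := by
    ext a
    simp [rho, RingHom.mem_ker, Ideal.Quotient.eq_zero_iff_mem]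
  let q : R →+* ResidueField B := (residue B).comp rho
  have hq : Function.Surjective q := residue_surjective.comp hrho
  have hkq : RingHom.ker q = maximalIdeal R := by
    rw [← comap_max rho hrho]
    ext a
    simp [q, RingHom.mem_ker, residue_eq_zero_iff]
  obtain ⟨f, hf⟩ := complete_exists (p := p) q hq (maximalIdeal R) hkq
  have hff : rho.comp f = fB := by
    apply nilp_unique (residue B) (N := n)
    · rw [ker_residue, hzero]
    · rw [hfB, ← hf]; rfl
  obtain ⟨pi, hpi⟩ := hrho piB
  have hecn : c ≤ e * c := by nlinarith
  have hpi1 : Ideal.span {pi} = maximalIdeal R := by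
    have := span_transfer rho hrho hker (j := 1) (by omega) pi (by rw [hpi, hpiB, pow_one])
    rwa [pow_one] at this
  have hpR : Ideal.span {(p : R)} = Ideal.span {pi ^ e} := by
    rw [← Ideal.span_singleton_pow, hpi1]
    exact span_transfer rho hrho hker (by omega) _ (by rw [map_natCast, hp])
  have heR : Ideal.span {(e : R)} = Ideal.span {pi ^ c} := by
    rw [← Ideal.span_singleton_pow, hpi1]
    exact span_transfer rho hrho hker (by omega) _ (by rw [map_natCast, hec])
  have hirr : Irreducible pi :=
    (IsDiscreteValuationRing.irreducible_iff_uniformizer pi).2 hpi1.symm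
  have hloc : ∀ a, q a ≠ 0 → IsUnit a := by
    intro a ha
    rw [← notMem_maximalIdeal, ← hkq]
    exact ha
  have : IsAdicComplete (Ideal.span {pi}) R := by rw [hpi1]; infer_instance
  have hrt : pi ^ n ∣ (eis p e b).eval₂ f pi := by
    rw [← Ideal.mem_span_singleton, ← Ideal.span_singleton_pow, hpi1, ← hker, RingHom.mem_ker,
      hom_eval₂, hff, hpi, hroot]
  obtain ⟨y, hy, hyr⟩ := root_lift he hec2 hn q f hf pi hirr hloc
    (fun a ha => IsDiscreteValuationRing.associated_pow_irreducible ha hirr) hpR heR b hb hrt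
  have hu : IsUnit (1 + y) := by
    apply hloc
    rw [hpi1, ← hkq, RingHom.mem_ker] at hy
    simp [hy]
  have has : Associated (pi * (1 + y)) pi := associated_mul_unit_left _ _ hu
  have hsp : Ideal.span {pi * (1 + y)} = Ideal.span {pi} :=
    Ideal.span_singleton_eq_span_singleton.2 has
  have : IsHausdorff (Ideal.span {pi * (1 + y)}) R := by rw [hsp]; infer_instance
  exact adj_bij q f hf (pi * (1 + y)) (by rw [hsp, hpi1, hkq]) (has.irreducible_iff.2 hirr) hloc e
    (by rw [hpR]; exact Ideal.span_singleton_eq_span_singleton.2 (has.symm.pow_pow)) b hyr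

end unique

section exist

open Polynomial

variable {p : ℕ} [Fact p.Prime] {k : Type} [Field k] [CharP k p] [PerfectRing k p]

lemma eis_coeff (e : ℕ) (b : ℕ → WittVector p k) (j : ℕ) (hj : j < e) :
    (eis p e b).coeff j = - (p * b j) := by
  simp only [eis, coeff_sub, coeff_X_pow, coeff_C_mul, finsetSum_coeff, if_neg hj.ne]
  simp [hj]

lemma witt_span_prime : (Ideal.span {(p : WittVector p k)}).IsPrime := by
  rw [← WittVector.ker_constantCoeff]
  exact RingHom.ker_isPrime _

lemma witt_charZero : CharZero (WittVector p k) := by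
  apply charZero_of_inj_zero
  intro n
  induction n using Nat.strong_induction_on with
  | _ n ih =>
    intro h
    by_contra hn
    have h1 : ((n : ℕ) : k) = 0 := by
      have := congrArg (WittVector.constantCoeff : WittVector p k →+* k) h
      simpa using this
    rw [CharP.cast_eq_zero_iff k p] at h1
    obtain ⟨m, rfl⟩ := h1
    have hp0 : (p : WittVector p k) ≠ 0 := (WittVector.irreducible p).ne_zero
    rw [Nat.cast_mul] at h
    have hm := (mul_eq_zero.1 h).resolve_left hp0
    have hm0 : m ≠ 0 := by rintro rfl; exact hn (by simp)
    have hlt : m < p * m := by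
      have := (Fact.out : p.Prime).two_le
      nlinarith [Nat.pos_of_ne_zero hm0]
    exact hm0 (ih m hlt hm)

lemma eis_prime (e : ℕ) (he : 1 ≤ e) (b : ℕ → WittVector p k) (hb : (b 0).coeff 0 ≠ 0) :
    Prime (eis p e b) := by
  have hE : (eis p e b).IsEisensteinAt (Ideal.span {(p : WittVector p k)}) := by
    refine ⟨?_, ?_, ?_⟩
    · rw [(eis_monic e b).leadingCoeff]
      exact (Ideal.ne_top_iff_one _).1 witt_span_prime.ne_top
    · intro j hj
      rw [eis_natDegree] at hj
      rw [eis_coeff e b j hj]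
      exact neg_mem (Ideal.mul_mem_right _ _ (Ideal.mem_span_singleton_self _))
    · rw [eis_coeff e b 0 he, neg_mem_iff, Ideal.span_singleton_pow, Ideal.mem_span_singleton, sq]
      intro h
      have hp0 : (p : WittVector p k) ≠ 0 := (WittVector.irreducible p).ne_zero
      have h1 := (mul_dvd_mul_iff_left hp0).1 h
      rw [← Ideal.mem_span_singleton, WittVector.mem_span_p_iff_coeff_zero_eq_zero] at h1
      exact hb h1
  exact (hE.irreducible witt_span_prime (eis_monic e b).isPrimitive
    (by rw [eis_natDegree]; exact he)).prime

lemma adj_cdvr (e : ℕ) (he : 1 ≤ e) (b : ℕ → WittVector p k) (hb : (b 0).coeff 0 ≠ 0) :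
    ∃ (_ : IsDomain (AdjoinRoot (eis p e b))) (_ : IsLocalRing (AdjoinRoot (eis p e b)))
      (_ : IsDiscreteValuationRing (AdjoinRoot (eis p e b)))
      (_ : CharZero (AdjoinRoot (eis p e b)))
      (_ : IsAdicComplete (maximalIdeal (AdjoinRoot (eis p e b))) (AdjoinRoot (eis p e b))),
      maximalIdeal (AdjoinRoot (eis p e b)) = Ideal.span {AdjoinRoot.root (eis p e b)} := by
  set g := eis p e b with hg
  have hgm : g.Monic := eis_monic e b
  have hdom : IsDomain (AdjoinRoot g) := AdjoinRoot.isDomain_of_prime (eis_prime e he b hb)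
  set x := AdjoinRoot.root g with hx
  have hrel : x ^ e = p * ∑ i ∈ Finset.range e, AdjoinRoot.of g (b i) * x ^ i := by
    have h1 : (eis p e b).eval₂ (AdjoinRoot.of g) x = 0 := AdjoinRoot.eval₂_root g
    rw [eis_eval] at h1
    exact sub_eq_zero.1 h1
  have hq0 : g.eval₂ (WittVector.constantCoeff : WittVector p k →+* k) 0 = 0 := by
    rw [hg, eis_eval, zero_pow (by omega)]
    simp
  let q : AdjoinRoot g →+* k := AdjoinRoot.lift WittVector.constantCoeff 0 hq0
  have hqf : q.comp (AdjoinRoot.of g) = WittVector.constantCoeff := by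
    ext w
    simp [q]
  have hqx : q x = 0 := by simp [q, hx]
  have hqs : Function.Surjective q := by
    intro a
    obtain ⟨w, hw⟩ := WittVector.constantCoeff_surjective p a
    exact ⟨AdjoinRoot.of g w, by rw [← hw, ← hqf]; rfl⟩
  have hqsum : ∀ w : ℕ → WittVector p k,
      q (∑ i ∈ Finset.range e, AdjoinRoot.of g (w i) * x ^ i) = (w 0).coeff 0 := by
    intro w
    rw [map_sum, Finset.sum_eq_single 0]
    · rw [pow_zero, mul_one, ← RingHom.comp_apply, hqf]; rfl
    · intro i _ hi
      rw [map_mul, map_pow, hqx, zero_pow hi, mul_zero]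
    · intro h
      exact absurd (Finset.mem_range.2 (by omega)) h
  have hsplit : ∀ w : ℕ → WittVector p k,
      x ∣ ∑ i ∈ Finset.range e, AdjoinRoot.of g (w i) * x ^ i - AdjoinRoot.of g (w 0) := by
    intro w
    rw [← Finset.add_sum_erase _ _ (Finset.mem_range.2 he), pow_zero, mul_one, add_sub_cancel_left]
    apply Finset.dvd_sum
    intro i hi
    exact dvd_mul_of_dvd_right (dvd_pow_self x (Finset.mem_erase.1 hi).1) _
  have hxp : x ∣ (p : AdjoinRoot g) := by
    have hu : IsUnit (AdjoinRoot.of g (b 0)) :=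
      (WittVector.isUnit_of_coeff_zero_ne_zero (b 0) hb).map _
    rw [← hu.dvd_mul_right]
    have h1 : x ∣ p * ∑ i ∈ Finset.range e, AdjoinRoot.of g (b i) * x ^ i := by
      rw [← hrel]; exact dvd_pow_self x (by omega)
    have h2 := dvd_sub h1 (dvd_mul_of_dvd_right (hsplit b) (p : AdjoinRoot g))
    convert h2 using 1
    ring
  have hkq : RingHom.ker q = Ideal.span {x} := by
    apply le_antisymm
    · intro a ha
      obtain ⟨w, rfl⟩ := adj_expand e b a
      rw [RingHom.mem_ker] at ha
      have h0 : (w 0).coeff 0 = 0 := by rw [← hqsum w]; exact ha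
      rw [← WittVector.mem_span_p_iff_coeff_zero_eq_zero, Ideal.mem_span_singleton] at h0
      have h1 : x ∣ AdjoinRoot.of g (w 0) := by
        have := map_dvd (AdjoinRoot.of g) h0
        rw [map_natCast] at this
        exact hxp.trans this
      rw [Ideal.mem_span_singleton]
      have := dvd_add (hsplit w) h1
      rwa [sub_add_cancel] at this
    · rw [Ideal.span_singleton_le_iff_mem]
      exact hqx
  have hmaxx : (Ideal.span {x}).IsMaximal := by
    rw [← hkq]
    exact RingHom.ker_isMaximal_of_surjective q hqs
  have hfin : Module.Finite (WittVector p k) (AdjoinRoot g) := hgm.finite_adjoinRoot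
  have huniq : ∀ M : Ideal (AdjoinRoot g), M.IsMaximal → M = Ideal.span {x} := by
    intro M hM
    have hc : (M.comap (algebraMap (WittVector p k) (AdjoinRoot g))).IsMaximal :=
      Ideal.isMaximal_comap_of_isIntegral_of_isMaximal M
    have hc' := IsLocalRing.eq_maximalIdeal hc
    have hpM : (p : AdjoinRoot g) ∈ M := by
      have h1 : (p : WittVector p k) ∈ M.comap (algebraMap (WittVector p k) (AdjoinRoot g)) := by
        rw [hc', IsLocalRing.mem_maximalIdeal]
        exact (WittVector.irreducible p).not_isUnit
      simpa using h1
    have hxM : x ∈ M := by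
      apply hM.isPrime.mem_of_pow_mem e
      rw [hrel]
      exact M.mul_mem_right _ hpM
    exact (hmaxx.eq_of_le hM.ne_top ((Ideal.span_singleton_le_iff_mem _).2 hxM)).symm
  have hlocal : IsLocalRing (AdjoinRoot g) :=
    IsLocalRing.of_unique_max_ideal ⟨_, hmaxx, huniq⟩
  have hmax : maximalIdeal (AdjoinRoot g) = Ideal.span {x} :=
    (IsLocalRing.eq_maximalIdeal hmaxx).symm
  have hinj : Function.Injective (AdjoinRoot.of g) :=
    AdjoinRoot.of.injective_of_degree_ne_zero (by
      rw [degree_eq_natDegree hgm.ne_zero, hg, eis_natDegree]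
      exact_mod_cast (by omega : e ≠ 0))
  have hchar : CharZero (AdjoinRoot g) := by
    have hW : CharZero (WittVector p k) := witt_charZero
    exact charZero_of_injective_ringHom hinj
  have hnoeth : IsNoetherianRing (AdjoinRoot g) :=
    IsNoetherianRing.of_finite (WittVector p k) (AdjoinRoot g)
  have hx0 : x ≠ 0 := by
    intro h
    rw [h, zero_dvd_iff] at hxp
    exact (Nat.cast_ne_zero.2 (Fact.out : p.Prime).ne_zero) hxp
  have hnf : ¬ IsField (AdjoinRoot g) := by
    rw [IsLocalRing.isField_iff_maximalIdeal_eq, hmax, Ideal.span_singleton_eq_bot]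
    exact hx0
  have hpr : (maximalIdeal (AdjoinRoot g)).IsPrincipal := ⟨⟨x, hmax⟩⟩
  have hdvr : IsDiscreteValuationRing (AdjoinRoot g) := by
    have htf : IsDiscreteValuationRing (AdjoinRoot g) ↔
        (maximalIdeal (AdjoinRoot g)).IsPrincipal :=
      (IsDiscreteValuationRing.TFAE (AdjoinRoot g) hnf).out 0 4
    exact htf.2 hpr
  have hpx : Ideal.span {(p : AdjoinRoot g)} = Ideal.span {x ^ e} := by
    rw [hrel, Ideal.span_singleton_eq_span_singleton]
    apply Associated.symm
    apply associated_mul_unit_left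
    rw [← notMem_maximalIdeal, hmax, ← hkq, RingHom.mem_ker, hqsum]
    exact hb
  have hpre : IsPrecomplete (maximalIdeal (AdjoinRoot g)) (AdjoinRoot g) := by
    rw [hmax]
    exact precomplete_of_surj (AdjoinRoot.of g) x e he hpx (adj_expand e b)
  have hcomp : IsAdicComplete (maximalIdeal (AdjoinRoot g)) (AdjoinRoot g) := { }
  exact ⟨hdom, hlocal, hdvr, hchar, hcomp, hmax⟩

end exist

end CDVRAux


/-- For a principal Artinian local ring `Rbar` of length `n` with perfect residue field of
characteristic `p`, with `p` generating `𝔪̄^e`, `e` generating `𝔪̄^c`, and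
`n > e + e·c`, there exists a complete discrete valuation ring of characteristic zero
whose `n`-th residue ring is `Rbar`, and it is unique up to isomorphism. -/
theorem exists_unique_cdvr_of_residue_ring (p : ℕ) [Fact p.Prime]
    (n e c : ℕ) (he : 1 ≤ e) (hn : e + e * c < n)
    (Rbar : Type) [CommRing Rbar] [IsLocalRing Rbar] [IsArtinianRing Rbar]
    (hprinc : (maximalIdeal Rbar).IsPrincipal)
    (hzero : maximalIdeal Rbar ^ n = ⊥)
    (hnonzero : maximalIdeal Rbar ^ (n - 1) ≠ ⊥)
    [CharP (ResidueField Rbar) p] [PerfectRing (ResidueField Rbar) p]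
    (hp : Ideal.span {(p : Rbar)} = maximalIdeal Rbar ^ e)
    (hec : Ideal.span {(e : Rbar)} = maximalIdeal Rbar ^ c) :
    (∃ (R : Type) (_ : CommRing R) (_ : IsDomain R) (_ : IsLocalRing R)
        (_ : IsDiscreteValuationRing R) (_ : CharZero R)
        (_ : IsAdicComplete (maximalIdeal R) R),
        Nonempty ((R ⧸ maximalIdeal R ^ n) ≃+* Rbar)) ∧
    (∀ (R R' : Type) [CommRing R] [IsDomain R] [IsLocalRing R] [IsDiscreteValuationRing R]
        [CharZero R] [IsAdicComplete (maximalIdeal R) R]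
        [CommRing R'] [IsDomain R'] [IsLocalRing R'] [IsDiscreteValuationRing R']
        [CharZero R'] [IsAdicComplete (maximalIdeal R') R'],
        Nonempty ((R ⧸ maximalIdeal R ^ n) ≃+* Rbar) →
        Nonempty ((R' ⧸ maximalIdeal R' ^ n) ≃+* Rbar) →
        Nonempty (R ≃+* R')) := by
  have hn1 : 1 < n := by omega
  have hmne : maximalIdeal Rbar ≠ ⊤ := (maximalIdeal.isMaximal Rbar).ne_top
  have hec2 : 2 * c ≤ e * c := by
    rcases Nat.eq_or_lt_of_le he with h | h
    · subst h
      rcases Nat.eq_zero_or_pos c with hc | hc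
      · simp [hc]
      · exfalso
        rw [Nat.cast_one, Ideal.span_singleton_one] at hec
        exact hmne (top_le_iff.1 (hec.le.trans (Ideal.pow_le_self (by omega))))
    · exact Nat.mul_le_mul_right c h
  obtain ⟨⟨piB, hpiB⟩⟩ := hprinc
  have hpiB : maximalIdeal Rbar = Ideal.span {piB} := hpiB
  obtain ⟨fB, hfB⟩ := CDVRAux.complete_exists (p := p) (residue Rbar) residue_surjective
    (maximalIdeal Rbar) ker_residue
  have hpe : Ideal.span {(p : Rbar)} = Ideal.span {piB ^ e} := by
    rw [hp, hpiB, Ideal.span_singleton_pow]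
  have hpm : (p : Rbar) ∈ maximalIdeal Rbar := by
    rw [← ker_residue]; exact CDVRAux.p_mem_ker (p := p) (residue Rbar)
  have hexp := CDVRAux.surj_of_haus (residue Rbar) fB hfB piB (by rw [ker_residue, hpiB]) e hpe
    (CDVRAux.haus_of_mem (maximalIdeal Rbar) (p : Rbar) hpm)
  have hassoc : piB ^ e ∣ (p : Rbar) := by
    rw [← Ideal.mem_span_singleton, ← hpe]; exact Ideal.mem_span_singleton_self _
  have hassoc' : (p : Rbar) ∣ piB ^ e := by
    rw [← Ideal.mem_span_singleton, hpe]; exact Ideal.mem_span_singleton_self _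
  obtain ⟨v, hv⟩ := hassoc'
  obtain ⟨b, hvb⟩ := hexp v
  have hpn : piB ^ (n - 1) ≠ 0 := by
    intro h
    apply hnonzero
    rw [hpiB, Ideal.span_singleton_pow, h, Ideal.span_singleton_eq_bot]
  have hresb : residue Rbar v = (b 0).coeff 0 := by
    have hr0 : residue Rbar piB = 0 := by
      rw [residue_eq_zero_iff, hpiB]; exact Ideal.mem_span_singleton_self _
    rw [hvb, map_sum, Finset.sum_eq_single 0]
    · rw [pow_zero, mul_one, ← RingHom.comp_apply, hfB]; rfl
    · intro i _ hi
      rw [map_mul, map_pow, hr0, zero_pow hi, mul_zero]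
    · intro h
      exact absurd (Finset.mem_range.2 (by omega)) h
  have hb : (b 0).coeff 0 ≠ 0 := by
    rw [← hresb]
    intro h0
    rw [residue_eq_zero_iff, hpiB, Ideal.mem_span_singleton] at h0
    obtain ⟨s, hs⟩ := h0
    obtain ⟨t, ht⟩ := hassoc
    have h1 : piB ^ e = piB ^ (e + 1) * (t * s) := by
      calc piB ^ e = p * v := hv
        _ = piB ^ e * t * (piB * s) := by rw [← ht, ← hs]
        _ = _ := by ring
    have hu : IsUnit (1 - piB * (t * s)) := by
      by_contra hnu
      have h2 : 1 - piB * (t * s) ∈ maximalIdeal Rbar := hnu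
      have h3 : piB * (t * s) ∈ maximalIdeal Rbar := by
        rw [hpiB]; exact Ideal.mul_mem_right _ _ (Ideal.mem_span_singleton_self _)
      have h4 := add_mem h2 h3
      rw [sub_add_cancel] at h4
      exact hmne ((Ideal.eq_top_iff_one _).2 h4)
    have h5 : piB ^ e * (1 - piB * (t * s)) = 0 := by
      rw [mul_sub, mul_one, sub_eq_zero]
      conv_lhs => rw [h1]
      ring
    have h6 : piB ^ e = 0 := (hu.mul_left_eq_zero).1 h5
    apply hpn
    exact pow_eq_zero_of_le (by omega) h6
  have hroot : (CDVRAux.eis p e b).eval₂ fB piB = 0 := by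
    rw [CDVRAux.eis_eval, ← hvb, hv, sub_self]
  constructor
  · obtain ⟨hdom, hloc, hdvr, hchar, hcomp, hmax⟩ := CDVRAux.adj_cdvr e he b hb
    refine ⟨AdjoinRoot (CDVRAux.eis p e b), inferInstance, hdom, hloc, hdvr, hchar, hcomp, ?_⟩
    let psi : AdjoinRoot (CDVRAux.eis p e b) →+* Rbar := AdjoinRoot.lift fB piB hroot
    have hpsix : psi (AdjoinRoot.root _) = piB := AdjoinRoot.lift_root hroot
    have hpsis : Function.Surjective psi := by
      intro a
      obtain ⟨w, hw⟩ := hexp a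
      refine ⟨∑ i ∈ Finset.range e, AdjoinRoot.of (CDVRAux.eis p e b) (w i) *
        AdjoinRoot.root (CDVRAux.eis p e b) ^ i, ?_⟩
      simp only [psi, map_sum, map_mul, map_pow, AdjoinRoot.lift_of, AdjoinRoot.lift_root]
      exact hw.symm
    have hirr : Irreducible (AdjoinRoot.root (CDVRAux.eis p e b)) :=
      (IsDiscreteValuationRing.irreducible_iff_uniformizer _).2 hmax
    have hpin : piB ^ n = 0 := by
      have h1 : piB ^ n ∈ maximalIdeal Rbar ^ n := by
        apply Ideal.pow_mem_pow
        rw [hpiB]; exact Ideal.mem_span_singleton_self _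
      rw [hzero] at h1
      simpa using h1
    have hker : RingHom.ker psi = maximalIdeal (AdjoinRoot (CDVRAux.eis p e b)) ^ n := by
      rw [hmax, Ideal.span_singleton_pow]
      apply le_antisymm
      · intro a ha
        rw [Ideal.mem_span_singleton]
        by_cases ha0 : a = 0
        · rw [ha0]; exact dvd_zero _
        obtain ⟨j, hj⟩ := IsDiscreteValuationRing.associated_pow_irreducible ha0 hirr
        rw [hj.dvd_iff_dvd_right]
        apply pow_dvd_pow
        by_contra hlt
        have h1 : psi a = 0 := ha
        have h2 : psi (AdjoinRoot.root (CDVRAux.eis p e b) ^ j) = 0 := by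
          obtain ⟨u, hu⟩ := hj
          rw [← hu, map_mul, h1, zero_mul]
        rw [map_pow, hpsix] at h2
        exact hpn (pow_eq_zero_of_le (by omega) h2)
      · rw [Ideal.span_singleton_le_iff_mem, RingHom.mem_ker, map_pow, hpsix, hpin]
    exact ⟨(Ideal.quotEquivOfEq hker.symm).trans (RingHom.quotientKerEquivOfSurjective hpsis)⟩
  · intro R R' _ _ _ _ _ _ _ _ _ _ _ _ ⟨phi⟩ ⟨phi'⟩
    obtain ⟨F⟩ := CDVRAux.cdvr_iso he hec2 hn hzero hp hec fB hfB piB hpiB b hb hroot phi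
    obtain ⟨F'⟩ := CDVRAux.cdvr_iso he hec2 hn hzero hp hec fB hfB piB hpiB b hb hroot phi'
    exact ⟨F.symm.trans F'⟩
end

section
/- Let p be a prime and let R₁, R₂ be complete discrete valuation rings of mixed characteristic (0,p) with perfect residue fields, with maximal ideals 𝔪₁, 𝔪₂ and absolute ramification indices e₁, e₂ (so Ideal.span {(p : Rᵢ)} = 𝔪ᵢ^eᵢ). Let c ≥ 0 be the integer with Ideal.span {(e₁ : R₁)} = 𝔪₁^c. If n is an integer with n > e₂ + e₂·c and there exists a ring isomorphism R₁/𝔪₁^n ≃ R₂/𝔪₂^n, then there exists a ring isomorphism R₁ ≃ R₂. -/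
open IsLocalRing
open Polynomial in
/-- Newton iteration in an adically complete ring, for a not necessarily monic polynomial. -/
theorem aux_hensel {R : Type*} [CommRing R] (I : Ideal R) [IsAdicComplete I R] (f : R[X])
    (a₀ : R) (h₁ : f.eval a₀ ∈ I) (h₂ : IsUnit (Ideal.Quotient.mk I (f.derivative.eval a₀))) :
    ∃ a : R, f.IsRoot a ∧ a - a₀ ∈ I := by
  classical
      let f' := derivative f
      let c : ℕ → R := fun n => Nat.recOn n a₀ fun _ b => b - f.eval b * Ring.inverse (f'.eval b)
      have hc : ∀ n, c (n + 1) = c n - f.eval (c n) * Ring.inverse (f'.eval (c n)) := by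
        intro n
        simp only [c]
      have hc_mod : ∀ n, c n ≡ a₀ [SMOD I] := by
        intro n
        induction n with
        | zero => rfl
        | succ n ih => ?_
        rw [hc, sub_eq_add_neg, ← add_zero a₀]
        refine ih.add ?_
        rw [SModEq.zero, Ideal.neg_mem_iff]
        refine I.mul_mem_right _ ?_
        rw [← SModEq.zero] at h₁ ⊢
        exact (ih.eval f).trans h₁
      have hf'c : ∀ n, IsUnit (f'.eval (c n)) := by
        intro n
        have := isLocalHom_of_le_jacobson_bot I (IsAdicComplete.le_jacobson_bot I)
        apply IsUnit.of_map (Ideal.Quotient.mk I)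
        convert! h₂ using 1
        exact SModEq.def.mp ((hc_mod n).eval _)
      have hfcI : ∀ n, f.eval (c n) ∈ I ^ (n + 1) := by
        intro n
        induction n with
        | zero => simpa only [Nat.rec_zero, zero_add, pow_one] using! h₁
        | succ n ih => ?_
        rw [← taylor_eval_sub (c n), hc, sub_eq_add_neg, sub_eq_add_neg,
          add_neg_cancel_comm]
        rw [eval_eq_sum, sum_over_range' _ _ _ (lt_add_of_pos_right _ zero_lt_two), ←
          Finset.sum_range_add_sum_Ico _ (Nat.le_add_left _ _)]
        swap
        · intro i
          rw [zero_mul]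
        refine Ideal.add_mem _ ?_ ?_
        · rw [← one_add_one_eq_two, Finset.sum_range_succ, Finset.range_one, Finset.sum_singleton,
            taylor_coeff_zero, taylor_coeff_one, pow_zero, pow_one, mul_one, mul_neg,
            mul_left_comm, Ring.mul_inverse_cancel _ (hf'c n), mul_one, add_neg_cancel]
          exact Ideal.zero_mem _
        · refine Submodule.sum_mem _ ?_
          simp only [Finset.mem_Ico]
          rintro i ⟨h2i, _⟩
          have aux : n + 2 ≤ i * (n + 1) := by trans 2 * (n + 1) <;> nlinarith only [h2i]
          refine Ideal.mul_mem_left _ _ (Ideal.pow_le_pow_right aux ?_)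
          rw [pow_mul']
          exact Ideal.pow_mem_pow ((Ideal.neg_mem_iff _).2 <| Ideal.mul_mem_right _ _ ih) _
      have aux : ∀ m n, m ≤ n → c m ≡ c n [SMOD (I ^ m • ⊤ : Ideal R)] := by
        intro m n hmn
        rw [← Ideal.one_eq_top, Ideal.smul_eq_mul, mul_one]
        obtain ⟨k, rfl⟩ := Nat.exists_eq_add_of_le hmn
        clear hmn
        induction k with
        | zero => rw [add_zero]
        | succ k ih => ?_
        rw [← add_assoc, hc, ← add_zero (c m), sub_eq_add_neg]
        refine ih.add ?_
        symm
        rw [SModEq.zero, Ideal.neg_mem_iff]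
        refine Ideal.mul_mem_right _ _ (Ideal.pow_le_pow_right ?_ (hfcI _))
        rw [add_assoc]
        exact le_self_add
      obtain ⟨a, ha⟩ := IsPrecomplete.prec' c (aux _ _)
      refine ⟨a, ?_, ?_⟩
      · show f.IsRoot a
        suffices ∀ n, f.eval a ≡ 0 [SMOD (I ^ n • ⊤ : Ideal R)] by exact IsHausdorff.haus' _ this
        intro n
        specialize ha n
        rw [← Ideal.one_eq_top, Ideal.smul_eq_mul, mul_one] at ha ⊢
        refine (ha.symm.eval f).trans ?_
        rw [SModEq.zero]
        exact Ideal.pow_le_pow_right le_self_add (hfcI _)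
      · show a - a₀ ∈ I
        specialize ha (0 + 1)
        rw [hc, pow_one, ← Ideal.one_eq_top, Ideal.smul_eq_mul, mul_one, sub_eq_add_neg] at ha
        rw [← SModEq.sub_mem, ← add_zero a₀]
        refine ha.symm.trans (SModEq.rfl.add ?_)
        rw [SModEq.zero, Ideal.neg_mem_iff]
        exact Ideal.mul_mem_right _ _ h₁

section Abstract

variable {W R : Type*} [CommRing W] [CommRing R] [IsDomain R]

set_option linter.unusedSectionVars false

theorem aux_orth_one (θ : W →+* R) (p e : ℕ) (ϖ : R) (h0 : ϖ ≠ 0)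
    (hp : Associated (p : R) (ϖ ^ e)) (B : ∀ w, ϖ ∣ θ w → (p : W) ∣ w)
    (w : ℕ → W) (h : ϖ ^ e ∣ ∑ i ∈ Finset.range e, θ (w i) * ϖ ^ i) :
    ∀ i < e, (p : W) ∣ w i := by
  intro j
  induction j using Nat.strong_induction_on with
  | _ j ih =>
    intro hj
    apply B
    have h1 : ϖ ^ (j + 1) ∣ ∑ i ∈ Finset.range e, θ (w i) * ϖ ^ i :=
      (pow_dvd_pow _ hj).trans h
    rw [← Finset.add_sum_erase _ _ (Finset.mem_range.2 hj)] at h1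
    rw [dvd_add_left] at h1
    · rw [pow_succ', mul_comm ϖ, mul_comm (θ _)] at h1
      exact (mul_dvd_mul_iff_left (pow_ne_zero j h0)).1 h1
    · refine Finset.dvd_sum fun i hi => ?_
      rw [Finset.mem_erase, Finset.mem_range] at hi
      rcases lt_or_gt_of_ne hi.1 with hlt | hgt
      · apply Dvd.dvd.mul_right
        obtain ⟨v, hv⟩ := ih i hlt hi.2
        rw [hv, map_mul, map_natCast]
        exact ((pow_dvd_pow _ hj).trans hp.symm.dvd).mul_right _
      · exact (pow_dvd_pow _ hgt).mul_left _

theorem aux_orth (θ : W →+* R) (p e : ℕ) (ϖ : R) (h0 : ϖ ≠ 0)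
    (hp : Associated (p : R) (ϖ ^ e)) (B : ∀ w, ϖ ∣ θ w → (p : W) ∣ w)
    (s : ℕ) (w : ℕ → W) (h : ϖ ^ (e * s) ∣ ∑ i ∈ Finset.range e, θ (w i) * ϖ ^ i) :
    ∀ i < e, (p : W) ^ s ∣ w i := by
  induction s generalizing w with
  | zero => intro i _; simp
  | succ s ih =>
    have h1 := aux_orth_one θ p e ϖ h0 hp B w
      ((pow_dvd_pow _ (by nlinarith)).trans h)
    choose! v hv using h1
    have h2 : ∑ i ∈ Finset.range e, θ (w i) * ϖ ^ i
        = (p : R) * ∑ i ∈ Finset.range e, θ (v i) * ϖ ^ i := by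
      rw [Finset.mul_sum]
      refine Finset.sum_congr rfl fun i hi => ?_
      rw [hv i (Finset.mem_range.1 hi), map_mul, map_natCast, mul_assoc]
    rw [h2, mul_add, mul_one, pow_add, mul_comm] at h
    have h3 : ϖ ^ e * ϖ ^ (e * s) ∣ ϖ ^ e * ∑ i ∈ Finset.range e, θ (v i) * ϖ ^ i :=
      h.trans (mul_dvd_mul hp.dvd dvd_rfl)
    have h4 := ih v ((mul_dvd_mul_iff_left (pow_ne_zero _ h0)).1 h3)
    intro i hi
    rw [hv i hi, pow_succ']
    exact mul_dvd_mul_left _ (h4 i hi)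

theorem aux_digits (θ : W →+* R) (ϖ : R)
    (A : ∀ x : R, ∃ w, ϖ ∣ x - θ w) (x : R) (j : ℕ) :
    ∃ w : ℕ → W, ϖ ^ j ∣ x - ∑ i ∈ Finset.range j, θ (w i) * ϖ ^ i := by
  induction j with
  | zero => exact ⟨0, by simp⟩
  | succ j ih =>
    obtain ⟨w, y, hy⟩ := ih
    obtain ⟨v, z, hz⟩ := A y
    refine ⟨Function.update w j v, z, ?_⟩
    rw [Finset.sum_range_succ, Function.update_self]
    have : ∑ i ∈ Finset.range j, θ (Function.update w j v i) * ϖ ^ i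
        = ∑ i ∈ Finset.range j, θ (w i) * ϖ ^ i := by
      refine Finset.sum_congr rfl fun i hi => ?_
      rw [Function.update_of_ne (Finset.mem_range.1 hi).ne]
    rw [this]
    linear_combination hy + ϖ ^ j * hz

theorem aux_surj_s3 (θ : W →+* R) (p e : ℕ) (he : 1 ≤ e) (ϖ : R)
    (hp : Associated (p : R) (ϖ ^ e))
    (A : ∀ x : R, ∃ w, ϖ ∣ x - θ w) [IsPrecomplete (Ideal.span {(p : W)}) W]
    (sep : ∀ x : R, (∀ k, ϖ ^ k ∣ x) → x = 0) (x : R) :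
    ∃ w : ℕ → W, x = ∑ i ∈ Finset.range e, θ (w i) * ϖ ^ i := by
  have step : ∀ x : R, ∃ (w : ℕ → W) (y : R),
      x = ∑ i ∈ Finset.range e, θ (w i) * ϖ ^ i + p * y := by
    intro x
    obtain ⟨w, hw⟩ := aux_digits θ ϖ A x e
    obtain ⟨y, hy⟩ := hp.dvd.trans hw
    exact ⟨w, y, by linear_combination hy⟩
  choose d r hdr using step
  let X : ℕ → R := fun k => r^[k] x
  have hX : ∀ k, X k = ∑ i ∈ Finset.range e, θ (d (X k) i) * ϖ ^ i + p * X (k + 1) := by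
    intro k
    have : X (k + 1) = r (X k) := Function.iterate_succ_apply' r k x
    rw [this]
    exact hdr _
  let S : ℕ → ℕ → W := fun i k => ∑ j ∈ Finset.range k, (p : W) ^ j * d (X j) i
  have hS : ∀ k, x = ∑ i ∈ Finset.range e, θ (S i k) * ϖ ^ i + (p : R) ^ k * X k := by
    intro k
    induction k with
    | zero => simp [S, X]
    | succ k ih =>
      have : ∑ i ∈ Finset.range e, θ (S i (k + 1)) * ϖ ^ i
          = ∑ i ∈ Finset.range e, θ (S i k) * ϖ ^ i
            + (p : R) ^ k * ∑ i ∈ Finset.range e, θ (d (X k) i) * ϖ ^ i := by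
        rw [Finset.mul_sum, ← Finset.sum_add_distrib]
        refine Finset.sum_congr rfl fun i _ => ?_
        simp only [S, Finset.sum_range_succ, map_add, map_mul, map_pow, map_natCast]
        ring
      rw [this]
      linear_combination ih + (p : R) ^ k * hX k
  have hL : ∀ i, ∃ L : W, ∀ k, (p : W) ^ k ∣ S i k - L := by
    intro i
    obtain ⟨L, hL⟩ := IsPrecomplete.prec' (I := Ideal.span {(p : W)}) (S i) (by
      intro m n hmn
      rw [SModEq.sub_mem, smul_eq_mul, Ideal.mul_top, Ideal.span_singleton_pow,
        Ideal.mem_span_singleton, ← dvd_neg, neg_sub]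
      simp only [S]
      rw [← Finset.sum_range_add_sum_Ico _ hmn, add_sub_cancel_left]
      exact Finset.dvd_sum fun j hj => (pow_dvd_pow _ (Finset.mem_Ico.1 hj).1).mul_right _)
    refine ⟨L, fun k => ?_⟩
    have := hL k
    rwa [SModEq.sub_mem, smul_eq_mul, Ideal.mul_top, Ideal.span_singleton_pow,
        Ideal.mem_span_singleton] at this
  choose L hL using hL
  refine ⟨L, ?_⟩
  rw [← sub_eq_zero]
  apply sep
  intro k
  have hpk : ϖ ^ k ∣ (p : R) ^ k := by
    refine pow_dvd_pow_of_dvd ((dvd_pow_self ϖ (by omega)).trans hp.symm.dvd) k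
  refine hpk.trans ?_
  have : x - ∑ i ∈ Finset.range e, θ (L i) * ϖ ^ i
      = ∑ i ∈ Finset.range e, θ (S i k - L i) * ϖ ^ i + (p : R) ^ k * X k := by
    simp only [map_sub, sub_mul, Finset.sum_sub_distrib]
    linear_combination hS k
  rw [this]
  refine dvd_add (Finset.dvd_sum fun i _ => Dvd.dvd.mul_right ?_ _) (dvd_mul_right _ _)
  obtain ⟨v, hv⟩ := hL i k
  rw [hv]
  simp

open Polynomial in
theorem aux_ker (θ : W →+* R) (p e : ℕ) (he : 1 ≤ e) (ϖ : R) (h0 : ϖ ≠ 0)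
    (hp : Associated (p : R) (ϖ ^ e)) (B : ∀ w, ϖ ∣ θ w → (p : W) ∣ w)
    [IsHausdorff (Ideal.span {(p : W)}) W]
    (f : W[X]) (hf : f.Monic) (hd : f.natDegree = e) (hr : f.eval₂ θ ϖ = 0) :
    RingHom.ker (eval₂RingHom θ ϖ) = Ideal.span {f} := by
  apply le_antisymm
  · intro g hg
    rw [RingHom.mem_ker, coe_eval₂RingHom] at hg
    rw [Ideal.mem_span_singleton, ← modByMonic_eq_zero_iff_dvd hf]
    have h1 : (g %ₘ f).eval₂ θ ϖ = 0 := by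
      have := congrArg (eval₂ θ ϖ) (modByMonic_add_div g f)
      rw [eval₂_add, eval₂_mul, hr, zero_mul, add_zero, hg] at this
      exact this
    have hlt : (g %ₘ f).natDegree < e := by
      rw [← hd]
      exact natDegree_modByMonic_lt g hf (by rintro rfl; simp at hd; omega)
    rw [eval₂_eq_sum_range' θ hlt] at h1
    ext i
    rw [coeff_zero]
    by_cases hi : i < e
    · apply IsHausdorff.haus' (I := Ideal.span {(p : W)})
      intro k
      rw [SModEq.zero, smul_eq_mul, Ideal.mul_top, Ideal.span_singleton_pow,
        Ideal.mem_span_singleton]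
      exact aux_orth θ p e ϖ h0 hp B k (fun i => (g %ₘ f).coeff i) (by simp [h1]) i hi
    · exact coeff_eq_zero_of_natDegree_lt (by omega)
  · rw [Ideal.span_singleton_le_iff_mem, RingHom.mem_ker]
    simpa using hr

open Polynomial in
theorem aux_eval_surj (θ : W →+* R) (p e : ℕ) (he : 1 ≤ e) (ϖ : R)
    (hp : Associated (p : R) (ϖ ^ e))
    (A : ∀ x : R, ∃ w, ϖ ∣ x - θ w) [IsPrecomplete (Ideal.span {(p : W)}) W]
    (sep : ∀ x : R, (∀ k, ϖ ^ k ∣ x) → x = 0) :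
    Function.Surjective (eval₂RingHom θ ϖ) := by
  intro x
  obtain ⟨w, hw⟩ := aux_surj_s3 θ p e he ϖ hp A sep x
  refine ⟨∑ i ∈ Finset.range e, C (w i) * X ^ i, ?_⟩
  rw [hw]
  simp

open Polynomial in
/-- existence of the Eisenstein polynomial -/
theorem aux_eisenstein [Nontrivial W] (θ : W →+* R) (p e : ℕ) (he : 1 ≤ e) (ϖ : R) (h0 : ϖ ≠ 0)
    (hp : Associated (p : R) (ϖ ^ e)) (B : ∀ w, ϖ ∣ θ w → (p : W) ∣ w)
    (A : ∀ x : R, ∃ w, ϖ ∣ x - θ w) [IsPrecomplete (Ideal.span {(p : W)}) W]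
    (sep : ∀ x : R, (∀ k, ϖ ^ k ∣ x) → x = 0) :
    ∃ f : W[X], f.Monic ∧ f.natDegree = e ∧ f.eval₂ θ ϖ = 0 ∧
      ∀ i < e, (p : W) ∣ f.coeff i := by
  obtain ⟨w, hw⟩ := aux_surj_s3 θ p e he ϖ hp A sep (ϖ ^ e)
  have hdvd := aux_orth_one θ p e ϖ h0 hp B w (by rw [← hw])
  have hdeg : (∑ i ∈ Finset.range e, C (w i) * X ^ i : W[X]).degree < (e : WithBot ℕ) := by
    refine mem_degreeLT.1 (Submodule.sum_mem _ fun i hi => mem_degreeLT.2 ?_)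
    exact (degree_C_mul_X_pow_le _ _).trans_lt (by exact_mod_cast Finset.mem_range.1 hi)
  refine ⟨X ^ e - ∑ i ∈ Finset.range e, C (w i) * X ^ i, ?_, ?_, ?_, ?_⟩
  · exact monic_X_pow_sub (n := e) hdeg
  · rw [sub_eq_add_neg]
    exact natDegree_eq_of_degree_eq_some (by
      rw [degree_add_eq_left_of_degree_lt] <;> simp [hdeg])
  · simp [eval₂_finsetSum, ← hw]
  · intro i hi
    rw [coeff_sub, coeff_X_pow, if_neg hi.ne, zero_sub, dvd_neg]
    simp only [finsetSum_coeff, coeff_C_mul, coeff_X_pow]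
    simp [hi, hdvd]

end Abstract
open Polynomial in
theorem aux_root_s3 {R : Type*} [CommRing R] [IsDomain R] (β : R) (h0 : β ≠ 0)
    [IsAdicComplete (Ideal.span {β}) R] (hunit : ∀ x : R, ¬ β ∣ x → IsUnit x)
    (F : R[X]) (hF : F.Monic) (e c n : ℕ) (he : 1 ≤ e) (hd : F.natDegree = e)
    (hco : ∀ i < e, β ^ e ∣ F.coeff i) (hec : e = 1 → c = 0) (hn : e + e * c < n)
    (hev : β ^ n ∣ F.eval β) (hder : ¬ β ^ (c + e) ∣ F.derivative.eval β) :
    ∃ y : R, F.eval (β + β ^ 2 * y) = 0 := by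
  classical
  -- the exact valuation of the derivative
  obtain ⟨d, hdlt, u, hu, hub⟩ : ∃ d < c + e, ∃ u, F.derivative.eval β = β ^ d * u ∧ ¬ β ∣ u := by
    have hex : ∃ k, ¬ β ^ k ∣ F.derivative.eval β := ⟨_, hder⟩
    have hpos : Nat.find hex ≠ 0 := by
      intro h
      have := Nat.find_spec hex
      rw [h] at this
      simp at this
    obtain ⟨d, hd'⟩ := Nat.exists_eq_succ_of_ne_zero hpos
    have hle := Nat.find_min' hex hder
    have h1 : β ^ d ∣ F.derivative.eval β := by
      have := Nat.find_min hex (m := d) (by omega)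
      simpa using this
    obtain ⟨u, hu⟩ := h1
    refine ⟨d, by omega, u, hu, ?_⟩
    rintro ⟨v, rfl⟩
    apply Nat.find_spec hex
    rw [hd', hu, Nat.succ_eq_add_one, pow_succ]
    exact mul_dvd_mul_left _ (dvd_mul_right _ _)
  -- divisibility of Taylor coefficients
  have hG : C (β ^ e) ∣ F - X ^ e := by
    rw [C_dvd_iff_dvd_coeff]
    intro i
    rw [coeff_sub, coeff_X_pow]
    rcases lt_trichotomy i e with h | h | h
    · simpa [h.ne] using hco i h
    · subst h
      have : F.coeff i = 1 := by rw [← hd]; exact hF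
      simp [this]
    · rw [coeff_eq_zero_of_natDegree_lt (by omega)]
      simp [h.ne']
  obtain ⟨G, hG⟩ := hG
  have hT : ∀ j, β ^ (e - j) ∣ (taylor β F).coeff j := by
    intro j
    have h1 : F = X ^ e + C (β ^ e) * G := by rw [← hG]; ring
    have h2 : taylor β F = (X + C β) ^ e + C (β ^ e) * taylor β G := by
      rw [h1]; simp [taylor_mul]
    rw [h2, coeff_add, coeff_X_add_C_pow, coeff_C_mul]
    exact dvd_add (dvd_mul_right _ _) ((pow_dvd_pow _ (by omega)).mul_right _)
  have hT' : ∀ j, e < j → (taylor β F).coeff j = 0 := by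
    intro j hj
    apply coeff_eq_zero_of_natDegree_lt
    rw [natDegree_taylor]; omega
  have hkey : d + (c + 1) < n := by
    rcases Nat.lt_or_ge 1 e with h | h
    · nlinarith
    · have : e = 1 := by omega
      have := hec this
      subst this; omega
  have hP : C (β ^ (d + (c + 1))) ∣ (taylor β F).comp (C (β ^ (c + 1)) * X) := by
    rw [C_dvd_iff_dvd_coeff]
    intro j
    rw [comp_C_mul_X_coeff]
    match j with
    | 0 =>
      rw [taylor_coeff_zero]
      exact ((pow_dvd_pow _ hkey.le).trans hev).mul_right _
    | 1 =>
      rw [taylor_coeff_one, hu, pow_add, pow_one]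
      exact mul_dvd_mul (dvd_mul_right _ _) dvd_rfl
    | j + 2 =>
      by_cases hj : e < j + 2
      · rw [hT' _ hj]; simp
      · have h1 := mul_dvd_mul (hT (j + 2)) (dvd_refl ((β ^ (c + 1)) ^ (j + 2)))
        refine dvd_trans ?_ h1
        rw [← pow_mul, ← pow_add]
        apply pow_dvd_pow
        obtain ⟨t, ht⟩ := Nat.exists_eq_add_of_le (not_lt.1 hj)
        have : e - (j + 2) = t := by omega
        rw [this]
        nlinarith
  obtain ⟨h, hh⟩ := hP
  have hβ : β ^ (d + (c + 1)) ≠ 0 := pow_ne_zero _ h0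
  have e0 : h.eval 0 ∈ Ideal.span {β} := by
    have := congrArg (fun q => coeff q 0) hh
    simp only [comp_C_mul_X_coeff, coeff_C_mul, pow_zero, mul_one, taylor_coeff_zero] at this
    rw [← coeff_zero_eq_eval_zero, Ideal.mem_span_singleton]
    have h2 : β ^ (d + (c + 1)) * β ∣ β ^ (d + (c + 1)) * h.coeff 0 := by
      rw [← this, ← pow_succ]
      exact (pow_dvd_pow _ hkey).trans hev
    exact (mul_dvd_mul_iff_left hβ).1 h2
  have e1 : IsUnit (h.derivative.eval 0) := by
    have := congrArg (fun q => coeff q 1) hh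
    simp only [comp_C_mul_X_coeff, coeff_C_mul, pow_one, taylor_coeff_one] at this
    rw [← coeff_zero_eq_eval_zero, coeff_derivative]
    simp only [zero_add, Nat.cast_zero, mul_one]
    rw [hu, mul_right_comm, ← pow_add] at this
    rw [← mul_left_cancel₀ hβ this]
    exact hunit u hub
  obtain ⟨y, hy, hyI⟩ := aux_hensel (Ideal.span {β}) h 0 e0 (e1.map _)
  rw [sub_zero, Ideal.mem_span_singleton] at hyI
  obtain ⟨z, rfl⟩ := hyI
  refine ⟨β ^ c * z, ?_⟩
  have := congrArg (eval (β * z)) hh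
  rw [eval_mul, hy.eq_zero, mul_zero, eval_comp, taylor_eval] at this
  rw [← this]
  congr 1
  simp
  ring
section Theta

set_option linter.unusedSectionVars false
set_option linter.overlappingInstances false

variable (p : ℕ) [Fact p.Prime] (R : Type) [CommRing R] [IsDomain R] [IsLocalRing R]
    [IsDiscreteValuationRing R] [IsAdicComplete (maximalIdeal R) R]

theorem aux_complete (e : ℕ) (he : 1 ≤ e)
    (hspan : Ideal.span {(p : R)} = maximalIdeal R ^ e) :
    IsAdicComplete (Ideal.span {(p : R)}) R := by
  have hle : Ideal.span {(p : R)} ≤ maximalIdeal R := by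
    rw [hspan]; exact Ideal.pow_le_self (by omega)
  have hne : Ideal.span {(p : R)} ≠ ⊤ := fun h =>
    (maximalIdeal.isMaximal R).ne_top (top_le_iff.1 (h ▸ hle))
  have h1 : IsHausdorff (Ideal.span {(p : R)}) R := IsHausdorff.of_isDomain _ hne
  have h2 : IsPrecomplete (Ideal.span {(p : R)}) R := by
    refine ⟨fun f hf => ?_⟩
    simp only [SModEq.sub_mem, smul_eq_mul, Ideal.mul_top, hspan, ← pow_mul] at hf ⊢
    obtain ⟨L, hL⟩ := IsPrecomplete.prec' (I := maximalIdeal R) f (by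
      intro m n hmn
      rw [SModEq.sub_mem, smul_eq_mul, Ideal.mul_top]
      exact Ideal.pow_le_pow_right (by nlinarith) (hf hmn))
    refine ⟨L, fun n => ?_⟩
    have h3 := hL (e * n)
    rw [SModEq.sub_mem, smul_eq_mul, Ideal.mul_top] at h3
    have h4 := hf (m := n) (n := e * n) (by nlinarith)
    simpa using add_mem h4 h3
  exact { h1, h2 with }

theorem aux_coeff_pow [Fact ¬ IsUnit (p : R)] (z : PreTilt R p) (j k : ℕ) :
    PreTilt.coeff (j + k) z ^ p ^ k = PreTilt.coeff j z := by
  induction k with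
  | zero => simp
  | succ k ih => rw [pow_succ', pow_mul, ← add_assoc, PreTilt.coeff_pow_p, ih]

variable [Fact ¬ IsUnit (p : R)] [IsAdicComplete (Ideal.span {(p : R)}) R]

theorem aux_thetaB (e : ℕ) (hspan : Ideal.span {(p : R)} = maximalIdeal R ^ e) (he : 1 ≤ e)
    (w : WittVector p (PreTilt R p)) (hw : WittVector.fontaineTheta R p w ∈ maximalIdeal R) :
    w.coeff 0 = 0 := by
  have hle : Ideal.span {(p : R)} ≤ maximalIdeal R := by
    rw [hspan]; exact Ideal.pow_le_self (by omega)
  have h1 := WittVector.mk_fontaineTheta w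
  have hz : ∀ j, PreTilt.coeff j (w.coeff 0) = 0 := by
    intro j
    obtain ⟨r, hr⟩ := Ideal.Quotient.mk_surjective (PreTilt.coeff (j + e) (w.coeff 0))
    have h2 : Ideal.Quotient.mk (Ideal.span {(p : R)}) (r ^ p ^ (j + e))
        = Ideal.Quotient.mk _ (WittVector.fontaineTheta R p w) := by
      rw [h1, map_pow, hr]
      have := aux_coeff_pow p R (w.coeff 0) 0 (j + e)
      rwa [zero_add] at this
    rw [Ideal.Quotient.eq] at h2
    have h3 : r ^ p ^ (j + e) ∈ maximalIdeal R := by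
      simpa using add_mem (hle h2) hw
    have h4 : r ∈ maximalIdeal R := Ideal.IsPrime.mem_of_pow_mem inferInstance _ h3
    rw [← aux_coeff_pow p R (w.coeff 0) j e, ← hr, ← map_pow, Ideal.Quotient.eq_zero_iff_mem, hspan]
    exact Ideal.pow_le_pow_right (Nat.lt_pow_self (Fact.out : p.Prime).one_lt).le
      (Ideal.pow_mem_pow h4 _)
  exact Perfection.ext hz

theorem aux_thetaA (e : ℕ) (hspan : Ideal.span {(p : R)} = maximalIdeal R ^ e) (he : 1 ≤ e)
    [CharP (ResidueField R) p] [PerfectRing (ResidueField R) p] (x : R) :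
    ∃ w, x - WittVector.fontaineTheta R p w ∈ maximalIdeal R := by
  have hle : Ideal.span {(p : R)} ≤ maximalIdeal R := by
    rw [hspan]; exact Ideal.pow_le_self (by omega)
  have hb : ∀ j : ℕ, ∃ b : R, residue R b ^ p ^ (j + e) = residue R x := by
    intro j
    obtain ⟨b, hb⟩ := residue_surjective
      ((frobeniusEquiv (ResidueField R) p).symm^[j + e] (residue R x))
    refine ⟨b, ?_⟩
    rw [hb, ← iterate_frobenius]
    exact Function.LeftInverse.iterate
      (fun y => by simp) _ _
  choose b hb using hb
  have hstep : ∀ j, b (j + 1) ^ p - b j ∈ maximalIdeal R := by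
    intro j
    rw [← residue_eq_zero_iff, map_sub, map_pow, sub_eq_zero]
    have : Function.Injective (fun y : ResidueField R => y ^ p ^ (j + e)) := by
      have := (iterateFrobeniusEquiv (ResidueField R) p (j + e)).injective
      simpa [Function.Injective, iterateFrobenius_def] using this
    apply this
    simp only
    rw [hb, ← hb (j + 1), ← pow_mul]
    congr 1
    ring
  let y : PreTilt R p := ⟨fun j => (Ideal.Quotient.mk (Ideal.span {(p : R)}) (b j)) ^ p ^ e, by
    intro j
    rw [← sub_eq_zero, ← pow_mul, mul_comm, pow_mul, ← sub_pow_char_pow, ← map_pow, ← map_sub,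
      ← map_pow, Ideal.Quotient.eq_zero_iff_mem, hspan]
    exact Ideal.pow_le_pow_right (Nat.lt_pow_self (Fact.out : p.Prime).one_lt).le
      (Ideal.pow_mem_pow (hstep j) _)⟩
  refine ⟨WittVector.teichmuller p y, ?_⟩
  have h1 := WittVector.mk_fontaineTheta (WittVector.teichmuller p y)
  rw [WittVector.teichmuller_coeff_zero] at h1
  have h2 : PreTilt.coeff 0 y = Ideal.Quotient.mk (Ideal.span {(p : R)}) (b 0 ^ p ^ e) := by
    rw [map_pow]; rfl
  rw [h2, Ideal.Quotient.eq] at h1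
  have h3 : x - b 0 ^ p ^ e ∈ maximalIdeal R := by
    rw [← residue_eq_zero_iff, map_sub, map_pow, sub_eq_zero, ← hb 0, zero_add]
  have := sub_mem h3 (hle h1)
  simpa using this

end Theta

theorem aux_nilp {R : Type*} [CommRing R] [IsLocalRing R] (n : ℕ) (hn : 1 ≤ n) (x : R) :
    IsNilpotent (Ideal.Quotient.mk (maximalIdeal R ^ n) x) ↔ x ∈ maximalIdeal R := by
  constructor
  · rintro ⟨k, hk⟩
    rw [← map_pow, Ideal.Quotient.eq_zero_iff_mem] at hk
    exact Ideal.IsPrime.mem_of_pow_mem inferInstance k (Ideal.pow_le_self (by omega) hk)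
  · intro h
    refine ⟨n, ?_⟩
    rw [← map_pow, Ideal.Quotient.eq_zero_iff_mem]
    exact Ideal.pow_mem_pow h n

theorem aux_modMap (p : ℕ) {R₁ R₂ : Type*} [CommRing R₁] [CommRing R₂] (I₁ : Ideal R₁)
    (I₂ : Ideal R₂) (ψ : R₁ ⧸ I₁ →+* R₂ ⧸ I₂) (h₂ : I₂ ≤ Ideal.span {(p : R₂)}) :
    ∃ φ : ModP R₁ p →+* ModP R₂ p, ∀ x y, ψ (Ideal.Quotient.mk _ x) = Ideal.Quotient.mk _ y →
      φ (Ideal.Quotient.mk _ x) = Ideal.Quotient.mk _ y := by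
  refine ⟨Ideal.Quotient.lift _ ((Ideal.Quotient.factor h₂).comp
    (ψ.comp (Ideal.Quotient.mk I₁))) ?_, ?_⟩
  · intro a ha
    obtain ⟨b, rfl⟩ := Ideal.mem_span_singleton.1 ha
    have : ((p : ℕ) : ModP R₂ p) = 0 := by
      rw [← map_natCast (Ideal.Quotient.mk (Ideal.span {(p : R₂)})),
        Ideal.Quotient.eq_zero_iff_mem]
      exact Ideal.mem_span_singleton_self _
    rw [map_mul, map_natCast, this, zero_mul]
  · intro x y h
    rw [Ideal.Quotient.lift_mk, RingHom.comp_apply, RingHom.comp_apply, h]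
    simp

theorem aux_monoid_eq (p : ℕ) [Fact p.Prime] {P S : Type*} [CommRing P] [CharP P p]
    [PerfectRing P p] [CommRing S] (hp : IsNilpotent (p : S)) (f g : P →* S)
    (h : ∀ x, (p : S) ∣ f x - g x) (x : P) : f x = g x := by
  obtain ⟨k, hk⟩ := hp
  obtain ⟨y, rfl⟩ : ∃ y, y ^ p ^ k = x := by
    obtain ⟨y, hy⟩ := (iterateFrobeniusEquiv P p k).surjective x
    exact ⟨y, by simpa [iterateFrobenius_def] using hy⟩
  have := dvd_sub_pow_of_dvd_sub (h y) k
  rw [pow_succ, hk, zero_mul, zero_dvd_iff, sub_eq_zero] at this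
  rw [map_pow, map_pow, this]

set_option linter.overlappingInstances false

/-- If the `n`-th residue rings of two complete discrete valuation rings of mixed
characteristic `(0,p)` with perfect residue fields are isomorphic for a single
`n > e₂ + e₂·c`, then the rings are isomorphic. -/
theorem single_residue_ring_iso_imp_iso (p : ℕ) [Fact p.Prime]
    (R₁ R₂ : Type) [CommRing R₁] [CommRing R₂] [IsDomain R₁] [IsDomain R₂]
    [IsLocalRing R₁] [IsLocalRing R₂]
    [IsDiscreteValuationRing R₁] [IsDiscreteValuationRing R₂]
    [IsAdicComplete (maximalIdeal R₁) R₁] [IsAdicComplete (maximalIdeal R₂) R₂]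
    [CharZero R₁] [CharZero R₂]
    [CharP (ResidueField R₁) p] [CharP (ResidueField R₂) p]
    [PerfectRing (ResidueField R₁) p] [PerfectRing (ResidueField R₂) p]
    (e₁ e₂ : ℕ) (he₁ : 1 ≤ e₁) (he₂ : 1 ≤ e₂)
    (hspan₁ : Ideal.span {(p : R₁)} = maximalIdeal R₁ ^ e₁)
    (hspan₂ : Ideal.span {(p : R₂)} = maximalIdeal R₂ ^ e₂)
    (c : ℕ) (hc : Ideal.span {(e₁ : R₁)} = maximalIdeal R₁ ^ c)
    (n : ℕ) (hn : e₂ + e₂ * c < n)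
    (h : Nonempty ((R₁ ⧸ maximalIdeal R₁ ^ n) ≃+* (R₂ ⧸ maximalIdeal R₂ ^ n))) :
    Nonempty (R₁ ≃+* R₂) := by
  obtain ⟨ψ⟩ := h
  have hpprime : p.Prime := Fact.out
  have hn2 : e₂ < n := lt_of_le_of_lt (Nat.le_add_right _ _) hn
  obtain ⟨ϖ, hϖ⟩ := IsDiscreteValuationRing.exists_irreducible R₁
  obtain ⟨ρ, hρ⟩ := IsDiscreteValuationRing.exists_irreducible R₂
  have hm₁ : maximalIdeal R₁ = Ideal.span {ϖ} := hϖ.maximalIdeal_eq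
  have hm₂' : maximalIdeal R₂ = Ideal.span {ρ} := hρ.maximalIdeal_eq
  -- compatibility of `ψ` with the maximal ideals
  have hψm : ∀ x y, ψ (Ideal.Quotient.mk _ x) = Ideal.Quotient.mk _ y →
      (x ∈ maximalIdeal R₁ ↔ y ∈ maximalIdeal R₂) := by
    intro x y hxy
    rw [← aux_nilp n (by omega), ← aux_nilp n (by omega), ← hxy,
      IsNilpotent.map_iff ψ.injective]
  have hψ : ∀ x, ∃ y, ψ (Ideal.Quotient.mk _ x) = Ideal.Quotient.mk (maximalIdeal R₂ ^ n) y :=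
    fun x => (Ideal.Quotient.mk_surjective _).imp fun _ h => h.symm
  have hψ' : ∀ y, ∃ x, ψ (Ideal.Quotient.mk (maximalIdeal R₁ ^ n) x) = Ideal.Quotient.mk _ y := by
    intro y
    obtain ⟨x, hx⟩ := Ideal.Quotient.mk_surjective (ψ.symm (Ideal.Quotient.mk _ y))
    exact ⟨x, by rw [hx, ψ.apply_symm_apply]⟩
  obtain ⟨β, hβ⟩ := hψ ϖ
  have hϖm : ϖ ∈ maximalIdeal R₁ := by rw [hm₁]; exact Ideal.mem_span_singleton_self _
  have hρm : ρ ∈ maximalIdeal R₂ := by rw [hm₂']; exact Ideal.mem_span_singleton_self _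
  have hβm : β ∈ maximalIdeal R₂ := (hψm _ _ hβ).1 hϖm
  -- `β` is a uniformizer
  have hβρ : Associated β ρ := by
    obtain ⟨a, ha⟩ := hψ' ρ
    have ham := (hψm _ _ ha).2 hρm
    rw [hm₁, Ideal.mem_span_singleton] at ham
    obtain ⟨b, rfl⟩ := ham
    obtain ⟨b', hb'⟩ := hψ b
    rw [map_mul, map_mul, hβ, hb', ← map_mul, Ideal.Quotient.eq] at ha
    have h2 := Ideal.pow_le_pow_right (show 2 ≤ n by omega) ha
    rw [hm₂', Ideal.span_singleton_pow, Ideal.mem_span_singleton] at h2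
    have h3 := hβm
    rw [hm₂', Ideal.mem_span_singleton] at h3
    obtain ⟨t, rfl⟩ := h3
    have ht : IsUnit t := by
      by_contra hnt
      have : t ∈ maximalIdeal R₂ := (mem_maximalIdeal t).2 hnt
      rw [hm₂', Ideal.mem_span_singleton] at this
      obtain ⟨s, rfl⟩ := this
      obtain ⟨z, hz⟩ := h2
      apply hρ.not_isUnit
      have : ρ * 1 = ρ * (ρ * (s * b' - z)) := by linear_combination -hz
      exact IsUnit.of_mul_eq_one _ (mul_left_cancel₀ hρ.ne_zero this).symm
    exact associated_mul_unit_left _ _ ht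
  have hβirr : Irreducible β := hβρ.symm.irreducible hρ
  have hm₂ : maximalIdeal R₂ = Ideal.span {β} := hβirr.maximalIdeal_eq
  have hunit₂ : ∀ x : R₂, ¬ β ∣ x → IsUnit x := by
    intro x hx
    rw [← Ideal.mem_span_singleton, ← hm₂] at hx
    exact notMem_maximalIdeal.1 hx
  have hp₁ : Associated (p : R₁) (ϖ ^ e₁) := by
    rw [← Ideal.span_singleton_eq_span_singleton, hspan₁, hm₁, Ideal.span_singleton_pow]
  have hp₂ : Associated (p : R₂) (β ^ e₂) := by
    rw [← Ideal.span_singleton_eq_span_singleton, hspan₂, hm₂, Ideal.span_singleton_pow]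
  -- the ramification indices agree
  have hee : e₁ = e₂ := by
    obtain ⟨u, hu⟩ := hp₁.symm
    obtain ⟨v, hv⟩ := hp₂.symm
    obtain ⟨u', hu'⟩ := hψ u
    have hu'm : ¬ β ∣ u' := by
      rw [← Ideal.mem_span_singleton, ← hm₂, ← hψm _ _ hu', mem_maximalIdeal]
      exact fun h => h u.isUnit
    have hvm : ¬ β ∣ (v : R₂) := by
      rw [← Ideal.mem_span_singleton, ← hm₂, mem_maximalIdeal]
      exact fun h => h v.isUnit
    have h1 := congrArg (fun x => ψ (Ideal.Quotient.mk _ x)) hu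
    simp only [map_mul, map_pow, hβ, hu', map_natCast] at h1
    rw [← map_natCast (Ideal.Quotient.mk (maximalIdeal R₂ ^ n)), ← map_pow, ← map_mul,
      Ideal.Quotient.eq, hm₂, Ideal.span_singleton_pow, Ideal.mem_span_singleton, ← hv] at h1
    have hb0 := hβirr.ne_zero
    rcases lt_trichotomy e₁ e₂ with hlt | heq | hgt
    · exfalso
      apply hu'm
      have h2 := (pow_dvd_pow β (show e₁ + 1 ≤ n by omega)).trans h1
      have h3 : β ^ (e₁ + 1) ∣ β ^ e₂ * v := (pow_dvd_pow β hlt).mul_right _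
      have h4 := dvd_add h2 h3
      rw [sub_add_cancel, pow_succ] at h4
      exact (mul_dvd_mul_iff_left (pow_ne_zero _ hb0)).1 h4
    · exact heq
    · exfalso
      apply hvm
      have h2 := (pow_dvd_pow β (show e₂ + 1 ≤ n by omega)).trans h1
      have h3 : β ^ (e₂ + 1) ∣ β ^ e₁ * u' := (pow_dvd_pow β hgt).mul_right _
      have h4 := dvd_sub h3 h2
      rw [sub_sub_cancel, pow_succ] at h4
      exact (mul_dvd_mul_iff_left (pow_ne_zero _ hb0)).1 h4
  subst hee
  -- the theta maps
  have hple₁ : Ideal.span {(p : R₁)} ≤ maximalIdeal R₁ := by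
    rw [hspan₁]; exact Ideal.pow_le_self (by omega)
  have hple₂ : Ideal.span {(p : R₂)} ≤ maximalIdeal R₂ := by
    rw [hspan₂]; exact Ideal.pow_le_self (by omega)
  have hpm₁ : (p : R₁) ∈ maximalIdeal R₁ := hple₁ (Ideal.mem_span_singleton_self _)
  have hpm₂ : (p : R₂) ∈ maximalIdeal R₂ := hple₂ (Ideal.mem_span_singleton_self _)
  haveI : Fact ¬ IsUnit (p : R₁) := ⟨(mem_maximalIdeal _).1 hpm₁⟩
  haveI : Fact ¬ IsUnit (p : R₂) := ⟨(mem_maximalIdeal _).1 hpm₂⟩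
  haveI := aux_complete p R₁ e₁ he₁ hspan₁
  haveI := aux_complete p R₂ e₁ he₁ hspan₂
  have hI₁ : maximalIdeal R₁ ^ n ≤ Ideal.span {(p : R₁)} := by
    rw [hspan₁]; exact Ideal.pow_le_pow_right hn2.le
  have hI₂ : maximalIdeal R₂ ^ n ≤ Ideal.span {(p : R₂)} := by
    rw [hspan₂]; exact Ideal.pow_le_pow_right hn2.le
  obtain ⟨φ, hφ⟩ := aux_modMap p (maximalIdeal R₁ ^ n) (maximalIdeal R₂ ^ n) ψ.toRingHom hI₂
  obtain ⟨φ', hφ'⟩ := aux_modMap p (maximalIdeal R₂ ^ n) (maximalIdeal R₁ ^ n) ψ.symm.toRingHom hI₁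
  have hinv1 : ∀ a, φ' (φ a) = a := by
    intro a
    obtain ⟨x, rfl⟩ := Ideal.Quotient.mk_surjective a
    obtain ⟨y, hy⟩ := hψ x
    rw [hφ x y hy, hφ' y x (by simp [← hy])]
  have hinv2 : ∀ a, φ (φ' a) = a := by
    intro a
    obtain ⟨y, rfl⟩ := Ideal.Quotient.mk_surjective a
    obtain ⟨x, hx⟩ := hψ' y
    rw [hφ' y x (by simp [← hx]), hφ x y hx]
  let g : PreTilt R₁ p →+* PreTilt R₂ p := Perfection.map p φ
  let g' : PreTilt R₂ p →+* PreTilt R₁ p := Perfection.map p φ'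
  have hg0 : ∀ j z, PreTilt.coeff j (g z) = φ (PreTilt.coeff j z) := fun j z => rfl
  have hg0' : ∀ j z, PreTilt.coeff j (g' z) = φ' (PreTilt.coeff j z) := fun j z => rfl
  have hg1 : ∀ z, g' (g z) = z := fun z =>
    Perfection.ext fun j => (by
      change PreTilt.coeff j (g' (g z)) = PreTilt.coeff j z
      rw [hg0', hg0, hinv1])
  have hg2 : ∀ z, g (g' z) = z := fun z =>
    Perfection.ext fun j => (by
      change PreTilt.coeff j (g (g' z)) = PreTilt.coeff j z
      rw [hg0, hg0', hinv2])
  let θ₁ : WittVector p (PreTilt R₁ p) →+* R₁ := WittVector.fontaineTheta R₁ p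
  let θ₂ : WittVector p (PreTilt R₁ p) →+* R₂ :=
    (WittVector.fontaineTheta R₂ p).comp (WittVector.map g)
  have A₁ : ∀ x, ∃ w, x - θ₁ w ∈ maximalIdeal R₁ := aux_thetaA p R₁ e₁ hspan₁ he₁
  have A₂ : ∀ x, ∃ w, x - θ₂ w ∈ maximalIdeal R₂ := by
    intro x
    obtain ⟨w, hw⟩ := aux_thetaA p R₂ e₁ hspan₂ he₁ x
    obtain ⟨v, rfl⟩ := WittVector.map_surjective (p := p) g (fun z => ⟨g' z, hg2 z⟩) w
    exact ⟨v, hw⟩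
  have hdvdW : ∀ w : WittVector p (PreTilt R₁ p), w.coeff 0 = 0 →
      (p : WittVector p (PreTilt R₁ p)) ∣ w := by
    intro w hw
    rw [← Ideal.mem_span_singleton]
    exact (WittVector.mem_span_p_iff_coeff_zero_eq_zero w).2 hw
  have B₁ : ∀ w, θ₁ w ∈ maximalIdeal R₁ → (p : WittVector p (PreTilt R₁ p)) ∣ w := fun w hw =>
    hdvdW w (aux_thetaB p R₁ e₁ hspan₁ he₁ w hw)
  have B₂ : ∀ w, θ₂ w ∈ maximalIdeal R₂ → (p : WittVector p (PreTilt R₁ p)) ∣ w := by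
    intro w hw
    have h1 := aux_thetaB p R₂ e₁ hspan₂ he₁ (WittVector.map g w) hw
    rw [WittVector.map_coeff] at h1
    apply hdvdW
    rw [← hg1 (w.coeff 0), h1, map_zero]
  -- compatibility of the theta maps
  have hcompat : (ψ.toRingHom.comp (Ideal.Quotient.mk (maximalIdeal R₁ ^ n))).comp θ₁
      = (Ideal.Quotient.mk (maximalIdeal R₂ ^ n)).comp θ₂ := by
    have hnil : IsNilpotent (p : R₂ ⧸ maximalIdeal R₂ ^ n) := by
      rw [← map_natCast (Ideal.Quotient.mk (maximalIdeal R₂ ^ n))]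
      exact (aux_nilp n (by omega) _).2 hpm₂
    apply WittVector.eq_of_apply_teichmuller_eq _ _ hnil
    intro x
    simp only [RingHom.comp_apply, θ₁, θ₂, WittVector.map_teichmuller,
      WittVector.fontaineTheta_teichmuller]
    refine aux_monoid_eq p hnil
      ((ψ.toRingHom.comp (Ideal.Quotient.mk (maximalIdeal R₁ ^ n))).toMonoidHom.comp
        PreTilt.untilt)
      ((Ideal.Quotient.mk (maximalIdeal R₂ ^ n)).toMonoidHom.comp
        (PreTilt.untilt.comp g.toMonoidHom)) ?_ x
    intro z
    change _ ∣ ψ (Ideal.Quotient.mk _ z.untilt) - Ideal.Quotient.mk _ ((g z).untilt)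
    obtain ⟨y, hy⟩ := hψ z.untilt
    have h1 := hφ _ _ hy
    rw [PreTilt.mk_untilt_eq_coeff_zero, ← hg0, ← PreTilt.mk_untilt_eq_coeff_zero, eq_comm,
      Ideal.Quotient.eq, Ideal.mem_span_singleton] at h1
    rw [hy, ← map_sub, ← map_natCast (Ideal.Quotient.mk (maximalIdeal R₂ ^ n))]
    exact map_dvd _ h1
  have hsep₁ : ∀ π : R₁, maximalIdeal R₁ = Ideal.span {π} →
      ∀ x : R₁, (∀ k, π ^ k ∣ x) → x = 0 := by
    intro π hπ x hx
    apply IsHausdorff.haus' (I := maximalIdeal R₁)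
    intro k
    rw [SModEq.zero, smul_eq_mul, Ideal.mul_top, hπ, Ideal.span_singleton_pow,
      Ideal.mem_span_singleton]
    exact hx k
  have hsep₂ : ∀ π : R₂, maximalIdeal R₂ = Ideal.span {π} →
      ∀ x : R₂, (∀ k, π ^ k ∣ x) → x = 0 := by
    intro π hπ x hx
    apply IsHausdorff.haus' (I := maximalIdeal R₂)
    intro k
    rw [SModEq.zero, smul_eq_mul, Ideal.mul_top, hπ, Ideal.span_singleton_pow,
      Ideal.mem_span_singleton]
    exact hx k
  haveI : Nontrivial (WittVector p (PreTilt R₁ p)) := θ₁.domain_nontrivial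
  have A₁' : ∀ x, ∃ w, ϖ ∣ x - θ₁ w := by
    simpa only [hm₁, Ideal.mem_span_singleton] using A₁
  have B₁' : ∀ w, ϖ ∣ θ₁ w → (p : WittVector p (PreTilt R₁ p)) ∣ w := by
    simpa only [hm₁, Ideal.mem_span_singleton] using B₁
  have B₂' : ∀ w, β ∣ θ₂ w → (p : WittVector p (PreTilt R₁ p)) ∣ w := by
    simpa only [hm₂, Ideal.mem_span_singleton] using B₂
  obtain ⟨f, hfm, hfd, hfr, hfc⟩ := aux_eisenstein θ₁ p e₁ he₁ ϖ hϖ.ne_zero hp₁ B₁' A₁'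
    (hsep₁ ϖ hm₁)
  -- the valuation of `e₁`
  obtain ⟨t, u, hut, hetu⟩ := Nat.exists_eq_pow_mul_and_not_dvd (n := e₁) (by omega) p
    hpprime.ne_one
  have huunit : IsUnit (u : R₁) := by
    rw [← notMem_maximalIdeal, ← residue_eq_zero_iff, map_natCast,
      CharP.cast_eq_zero_iff (ResidueField R₁) p]
    exact hut
  have hct : c = e₁ * t := by
    have h1 : Ideal.span {(e₁ : R₁)} = maximalIdeal R₁ ^ (e₁ * t) := by
      have h2 : Associated (e₁ : R₁) ((p : R₁) ^ t) := by
        have : (e₁ : R₁) = (p : R₁) ^ t * u := by exact_mod_cast congrArg (Nat.cast (R := R₁)) hetu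
        rw [this]
        exact associated_mul_unit_left _ _ huunit
      rw [Ideal.span_singleton_eq_span_singleton.2 h2, ← Ideal.span_singleton_pow, hspan₁, pow_mul]
    rw [hc, hm₁, Ideal.span_singleton_pow, Ideal.span_singleton_pow,
      Ideal.span_singleton_eq_span_singleton] at h1
    have h2 := (pow_dvd_pow_iff hϖ.ne_zero hϖ.not_isUnit).1 h1.dvd
    have h3 := (pow_dvd_pow_iff hϖ.ne_zero hϖ.not_isUnit).1 h1.symm.dvd
    omega
  have hec : e₁ = 1 → c = 0 := by
    intro h
    have h1 : p ^ t * u = 1 := by rw [← hetu, h]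
    have h2 : p ^ t = 1 := Nat.eq_one_of_mul_eq_one_right h1
    have h3 : t = 0 := by
      by_contra h0
      exact (Nat.one_lt_pow h0 hpprime.one_lt).ne' h2
    rw [hct, h3, mul_zero]
  have hFev : ∀ x, (f.map θ₂).eval x = f.eval₂ θ₂ x := fun x => Polynomial.eval_map θ₂ x
  haveI : IsAdicComplete (Ideal.span {β}) R₂ := hm₂ ▸ inferInstance
  obtain ⟨y, hy⟩ := aux_root_s3 β hβirr.ne_zero hunit₂ (f.map θ₂) (hfm.map θ₂) e₁ c n he₁
    (by rw [hfm.natDegree_map, hfd])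
    (by
      intro i hi
      rw [Polynomial.coeff_map]
      have := map_dvd θ₂ (hfc i hi)
      rw [map_natCast] at this
      exact hp₂.symm.dvd.trans this)
    hec hn
    (by
      rw [hFev, ← Ideal.mem_span_singleton, ← Ideal.span_singleton_pow, ← hm₂,
        ← Ideal.Quotient.eq_zero_iff_mem, Polynomial.hom_eval₂, ← hcompat, ← hβ]
      have := Polynomial.hom_eval₂ f θ₁
        (ψ.toRingHom.comp (Ideal.Quotient.mk (maximalIdeal R₁ ^ n))) ϖ
      rw [hfr, map_zero] at this
      exact this.symm)
    (by
      intro hdvd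
      rw [Polynomial.derivative_map, Polynomial.eval_map, Polynomial.eval₂_eq_sum_range' θ₂
        (n := e₁) (by
          have := Polynomial.natDegree_derivative_lt (p := f) (by omega)
          omega), show c + e₁ = e₁ * (t + 1) by rw [hct]; ring] at hdvd
      have h1 := aux_orth θ₂ p e₁ β hβirr.ne_zero hp₂ B₂' (t + 1)
        (fun i => f.derivative.coeff i) hdvd (e₁ - 1) (by omega)
      simp only [Polynomial.coeff_derivative] at h1
      have h2 : e₁ - 1 + 1 = e₁ := by omega
      have h3 : f.coeff e₁ = 1 := by rw [← hfd]; exact hfm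
      have h4 : ((e₁ - 1 : ℕ) : WittVector p (PreTilt R₁ p)) + 1 = (e₁ : ℕ) := by
        exact_mod_cast congrArg (Nat.cast (R := WittVector p (PreTilt R₁ p))) h2
      rw [h2, h3, h4, one_mul] at h1
      have h5 := map_dvd θ₁ h1
      rw [map_pow, map_natCast, map_natCast, hetu, Nat.cast_mul, Nat.cast_pow, pow_succ] at h5
      have hp0 : (p : R₁) ^ t ≠ 0 := pow_ne_zero _ (Nat.cast_ne_zero.2 hpprime.ne_zero)
      have h6 := (mul_dvd_mul_iff_left hp0).1 h5
      exact (mem_maximalIdeal _).1 hpm₁ (isUnit_of_dvd_unit h6 huunit))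
  rw [hFev] at hy
  -- the new uniformizer
  set α := β + β ^ 2 * y with hα
  have hαβ : Associated β α := by
    have hu : IsUnit (1 + β * y) := by
      apply hunit₂
      intro hd
      exact hβirr.not_isUnit (isUnit_of_dvd_one ((dvd_add_left (dvd_mul_right β y)).1 hd))
    have : α = β * (1 + β * y) := by rw [hα]; ring
    rw [this]
    exact (associated_mul_unit_left _ _ hu).symm
  have hαirr : Irreducible α := hαβ.irreducible hβirr
  have hm₃ : maximalIdeal R₂ = Ideal.span {α} := hαirr.maximalIdeal_eq
  have hp₃ : Associated (p : R₂) (α ^ e₁) := hp₂.trans (hαβ.pow_pow)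
  have A₃ : ∀ x, ∃ w, α ∣ x - θ₂ w := by
    simpa only [hm₃, Ideal.mem_span_singleton] using A₂
  have B₃ : ∀ w, α ∣ θ₂ w → (p : WittVector p (PreTilt R₁ p)) ∣ w := by
    simpa only [hm₃, Ideal.mem_span_singleton] using B₂
  have k₁ := aux_ker θ₁ p e₁ he₁ ϖ hϖ.ne_zero hp₁ B₁' f hfm hfd hfr
  have k₂ := aux_ker θ₂ p e₁ he₁ α hαirr.ne_zero hp₃ B₃ f hfm hfd hy
  have s₁ := aux_eval_surj θ₁ p e₁ he₁ ϖ hp₁ A₁' (hsep₁ ϖ hm₁)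
  have s₂ := aux_eval_surj θ₂ p e₁ he₁ α hp₃ A₃ (hsep₂ α hm₃)
  exact ⟨(RingHom.quotientKerEquivOfSurjective s₁).symm.trans
    ((Ideal.quotEquivOfEq (k₁.trans k₂.symm)).trans (RingHom.quotientKerEquivOfSurjective s₂))⟩
end

section
/- Let p be a prime and let R₁, R₂ be discrete valuation rings of characteristic zero with maximal ideals 𝔪₁, 𝔪₂ such that Ideal.span {(p : Rᵢ)} = 𝔪ᵢ^eᵢ for integers e₁, e₂ ≥ 1. Let a ≥ 1 be a real number and let n be a positive integer with (n : ℝ) > a·e₂. Then for every ring homomorphism ι : R₁ →+* R₂/𝔪₂^n, there exists a positive integer m with (m : ℝ) > a·e₁ such that the kernel of ι equals 𝔪₁^m. -/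
open IsLocalRing

/-- For discrete valuation rings `R₁`, `R₂` of characteristic zero with ramification
indices `e₁`, `e₂`, a real `a ≥ 1`, and `n > a·e₂`, the kernel of any ring homomorphism
`ι : R₁ →+* R₂/𝔪₂^n` equals `𝔪₁^m` for some `m > a·e₁`. -/
theorem ker_of_hom_to_residue_ring (p : ℕ) [Fact p.Prime]
    (R₁ R₂ : Type) [CommRing R₁] [CommRing R₂] [IsDomain R₁] [IsDomain R₂]
    [IsLocalRing R₁] [IsLocalRing R₂]
    [IsDiscreteValuationRing R₁] [IsDiscreteValuationRing R₂]
    [CharZero R₁] [CharZero R₂]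
    (e₁ e₂ : ℕ) (he₁ : 1 ≤ e₁) (he₂ : 1 ≤ e₂)
    (hspan₁ : Ideal.span {(p : R₁)} = maximalIdeal R₁ ^ e₁)
    (hspan₂ : Ideal.span {(p : R₂)} = maximalIdeal R₂ ^ e₂)
    (a : ℝ) (ha : 1 ≤ a) (n : ℕ) (hnpos : 0 < n) (hn : a * (e₂ : ℝ) < (n : ℝ))
    (ι : R₁ →+* R₂ ⧸ maximalIdeal R₂ ^ n) :
    ∃ m : ℕ, 0 < m ∧ a * (e₁ : ℝ) < (m : ℝ) ∧ RingHom.ker ι = maximalIdeal R₁ ^ m := by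
  obtain ⟨π₁, h1⟩ := IsDiscreteValuationRing.exists_irreducible R₁
  obtain ⟨π₂, h2⟩ := IsDiscreteValuationRing.exists_irreducible R₂
  have m1 : maximalIdeal R₁ = Ideal.span {π₁} := h1.maximalIdeal_eq
  have m2 : maximalIdeal R₂ = Ideal.span {π₂} := h2.maximalIdeal_eq
  have hz : ∀ z : R₂, Ideal.Quotient.mk (maximalIdeal R₂ ^ n) z = 0 ↔ π₂ ^ n ∣ z := by
    intro z
    rw [Ideal.Quotient.eq_zero_iff_mem, m2, Ideal.span_singleton_pow, Ideal.mem_span_singleton]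
  rw [m1, Ideal.span_singleton_pow, Ideal.span_singleton_eq_span_singleton] at hspan₁
  rw [m2, Ideal.span_singleton_pow, Ideal.span_singleton_eq_span_singleton] at hspan₂
  have hen : e₂ + 1 ≤ n := by
    have h0 : (0 : ℝ) ≤ e₂ := Nat.cast_nonneg _
    have : (e₂ : ℝ) < n := by nlinarith
    exact_mod_cast this
  obtain ⟨x, hx⟩ := Ideal.Quotient.mk_surjective (ι π₁)
  obtain ⟨c, hc⟩ := hspan₁.dvd
  obtain ⟨d, hd⟩ := hspan₁.symm.dvd
  obtain ⟨cl, hcl⟩ := Ideal.Quotient.mk_surjective (ι c)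
  obtain ⟨dl, hdl⟩ := Ideal.Quotient.mk_surjective (ι d)
  have k1 : π₂ ^ n ∣ x ^ e₁ - p * cl := by
    rw [← hz]
    simp only [map_sub, map_mul, map_pow, map_natCast, hx, hcl]
    rw [← map_pow, hc]; simp
  have k2 : π₂ ^ n ∣ p - x ^ e₁ * dl := by
    rw [← hz]
    simp only [map_sub, map_mul, map_pow, map_natCast, hx, hdl]
    rw [← map_pow, ← map_mul, ← hd]; simp
  have l1 : π₂ ^ e₂ ∣ x ^ e₁ := by
    have := (pow_dvd_pow π₂ (by omega : e₂ ≤ n)).trans k1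
    exact (dvd_sub_left (hspan₂.symm.dvd.mul_right cl)).1 this
  have l2 : ¬ π₂ ^ (e₂ + 1) ∣ x ^ e₁ := by
    intro h
    have := (pow_dvd_pow π₂ hen).trans k2
    have h3 := ((dvd_sub_left (h.mul_right dl)).1 this).trans hspan₂.dvd
    rw [pow_dvd_pow_iff h2.ne_zero h2.not_isUnit] at h3
    omega
  have hx0 : x ≠ 0 := by
    rintro rfl
    exact l2 (by rw [zero_pow (by omega)]; exact dvd_zero _)
  obtain ⟨f, u, rfl⟩ := IsDiscreteValuationRing.eq_unit_mul_pow_irreducible hx0 h2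
  have key : ∀ i k : ℕ, π₂ ^ i ∣ (u * π₂ ^ f) ^ k ↔ i ≤ f * k := by
    intro i k
    rw [mul_pow, ← Units.val_pow_eq_pow_val, Units.dvd_mul_left, ← pow_mul,
      pow_dvd_pow_iff h2.ne_zero h2.not_isUnit]
  rw [key] at l1 l2
  have hfe : f * e₁ = e₂ := by omega
  have hf : 1 ≤ f := by
    rcases Nat.eq_zero_or_pos f with rfl | h
    · omega
    · exact h
  have hker : ∀ k : ℕ, π₁ ^ k ∈ RingHom.ker ι ↔ n ≤ f * k := by
    intro k
    rw [RingHom.mem_ker, map_pow, ← hx, ← map_pow, hz, key]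
  have hne : RingHom.ker ι ≠ ⊥ := by
    intro h
    have := (hker n).2 (by nlinarith)
    rw [h, Ideal.mem_bot] at this
    exact pow_ne_zero _ h1.ne_zero this
  obtain ⟨m, hm⟩ := IsDiscreteValuationRing.ideal_eq_span_pow_irreducible hne h1
  have hnm : n ≤ f * m := (hker m).1 (by rw [hm]; exact Ideal.mem_span_singleton_self _)
  refine ⟨m, ?_, ?_, ?_⟩
  · rcases Nat.eq_zero_or_pos m with rfl | h
    · omega
    · exact h
  · have a1 : (n : ℝ) ≤ f * m := by exact_mod_cast hnm
    have a2 : (f : ℝ) * e₁ = e₂ := by exact_mod_cast hfe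
    have a3 : (0 : ℝ) ≤ f := Nat.cast_nonneg _
    rw [← a2] at hn
    exact lt_of_mul_lt_mul_left (by linarith : (f : ℝ) * (a * e₁) < f * m) a3
  · rw [hm, m1, Ideal.span_singleton_pow]
end

section
/- Let p be a prime and let R₁, R₂ be discrete valuation rings of characteristic zero with maximal ideals 𝔪₁, 𝔪₂ such that Ideal.span {(p : Rᵢ)} = 𝔪ᵢ^eᵢ for integers e₁, e₂ ≥ 1. If n is an integer with n > e₂ and there exists a ring homomorphism ι : R₁ →+* R₂/𝔪₂^n, then e₁ divides e₂. -/
open IsLocalRing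

/-- If there is a ring homomorphism `R₁ →+* R₂/𝔪₂^n` with `n > e₂` between discrete
valuation rings of characteristic zero, then the ramification index `e₁` divides `e₂`. -/
theorem ramification_index_dvd_of_hom (p : ℕ) [Fact p.Prime]
    (R₁ R₂ : Type) [CommRing R₁] [CommRing R₂] [IsDomain R₁] [IsDomain R₂]
    [IsLocalRing R₁] [IsLocalRing R₂]
    [IsDiscreteValuationRing R₁] [IsDiscreteValuationRing R₂]
    [CharZero R₁] [CharZero R₂]
    (e₁ e₂ : ℕ) (he₁ : 1 ≤ e₁) (he₂ : 1 ≤ e₂)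
    (hspan₁ : Ideal.span {(p : R₁)} = maximalIdeal R₁ ^ e₁)
    (hspan₂ : Ideal.span {(p : R₂)} = maximalIdeal R₂ ^ e₂)
    (n : ℕ) (hn : e₂ < n)
    (ι : R₁ →+* R₂ ⧸ maximalIdeal R₂ ^ n) :
    e₁ ∣ e₂ := by
  obtain ⟨q, hq⟩ := IsDiscreteValuationRing.exists_irreducible R₁
  obtain ⟨t, ht⟩ := IsDiscreteValuationRing.exists_irreducible R₂
  have hm₁ := hq.maximalIdeal_eq
  have hm₂ := ht.maximalIdeal_eq
  rw [hm₁, Ideal.span_singleton_pow, Ideal.span_singleton_eq_span_singleton] at hspan₁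
  rw [hm₂, Ideal.span_singleton_pow, Ideal.span_singleton_eq_span_singleton] at hspan₂
  obtain ⟨u, hu⟩ := hspan₁.symm
  obtain ⟨w, hw⟩ := hspan₂.symm
  obtain ⟨a, ha⟩ := Ideal.Quotient.mk_surjective (ι q)
  obtain ⟨v, hv⟩ := Ideal.Quotient.mk_surjective (ι u)
  obtain ⟨v', hv'⟩ := Ideal.Quotient.mk_surjective (ι (u⁻¹ : R₁ˣ))
  have key : ∀ x y : R₂, Ideal.Quotient.mk (maximalIdeal R₂ ^ n) x =
      Ideal.Quotient.mk (maximalIdeal R₂ ^ n) y → t ^ n ∣ x - y := by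
    intro x y h
    rw [Ideal.Quotient.eq, hm₂, Ideal.span_singleton_pow, Ideal.mem_span_singleton] at h
    exact h
  have hvu : IsUnit v := by
    have h := key (v * v') 1 (by rw [map_mul, hv, hv', ← map_mul]; simp)
    have h1 : t ∣ v * v' - 1 := (dvd_pow_self t (by omega)).trans h
    by_contra hnu
    have h2 : v ∈ maximalIdeal R₂ := hnu
    rw [hm₂, Ideal.mem_span_singleton] at h2
    have h3 : t ∣ 1 := (dvd_sub_right (h2.mul_right v')).1 h1
    exact ht.not_isUnit (isUnit_of_dvd_one h3)
  have h := key (a ^ e₁ * v) (t ^ e₂ * w) (by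
    rw [hw, map_mul, map_pow, ha, hv, ← map_pow, ← map_mul, hu]; simp)
  have hd1 : t ^ e₂ ∣ a ^ e₁ := by
    have h1 : t ^ e₂ ∣ a ^ e₁ * v - t ^ e₂ * w := (pow_dvd_pow t hn.le).trans h
    have h2 := (dvd_sub_left (dvd_mul_right (t ^ e₂) (w : R₂))).1 h1
    exact hvu.dvd_mul_right.1 h2
  have hd2 : ¬ t ^ (e₂ + 1) ∣ a ^ e₁ := by
    intro h0
    have h1 : t ^ (e₂ + 1) ∣ a ^ e₁ * v - t ^ e₂ * w := (pow_dvd_pow t hn).trans h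
    have h2 := (dvd_sub_right (h0.mul_right v)).1 h1
    have h3 := w.isUnit.dvd_mul_right.1 h2
    rw [pow_dvd_pow_iff ht.ne_zero ht.not_isUnit] at h3
    omega
  have ha0 : a ≠ 0 := by
    rintro rfl
    apply hd2
    rw [zero_pow (by omega)]
    exact dvd_zero _
  obtain ⟨k, x, rfl⟩ := IsDiscreteValuationRing.eq_unit_mul_pow_irreducible ha0 ht
  rw [mul_pow, ← pow_mul, (x.isUnit.pow e₁).dvd_mul_left,
    pow_dvd_pow_iff ht.ne_zero ht.not_isUnit] at hd1 hd2
  exact ⟨k, by rw [mul_comm]; omega⟩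
end
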